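/- With the notation of the context, assume Conjecture C_n holds with exponent δ. Then for every ε > 0 there exists a constant C (depending only on ε, K, 𝒞ℓ, 𝔐, μ and F, and in particular not on 𝔪) such that for every integral ideal 𝔪 of 𝓞 with (𝔪, σ(𝔪)) = 1 and (𝔪, (F)) = 1, and every x ≥ 2, |A(x;𝔪)| ≤ C·x^{1−δ/(2n)+ε}, where A(x;𝔪) = ∑ r(𝔞)·spin(σ,𝔞), the sum being over all integral ideals 𝔞 with N𝔞 ≤ x, (𝔞,(F)) = 1 and 𝔪 ∣ 𝔞. -/

import Mathlib

set_option synthInstance.maxHeartbeats 1000000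
set_option maxHeartbeats 2000000

open NumberField
open scoped Classical

noncomputable section

variable {K : Type*} [Field K] [NumberField K]

/-- The quadratic residue symbol `(α/𝔭)` modulo a prime ideal `𝔭` of the ring of
integers: `1` if `α` is a nonzero square modulo `𝔭`, `-1` if it is a nonzero
non-square, and `0` if `α ∈ 𝔭`. -/
def legSym (𝔭 : Ideal (𝓞 K)) (α : 𝓞 K) : ℤ :=
  if Ideal.Quotient.mk 𝔭 α = 0 then 0
  else if IsSquare (Ideal.Quotient.mk 𝔭 α) then 1 else -1

/-- The quadratic residue symbol `(α/𝔟)` for an ideal `𝔟`, extended multiplicatively over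
the prime factorization of `𝔟` (with multiplicity). -/
def quadSym (𝔟 : Ideal (𝓞 K)) (α : 𝓞 K) : ℤ :=
  ((UniqueFactorizationMonoid.normalizedFactors 𝔟).map (fun 𝔭 => legSym 𝔭 α)).prod

/-- An element of `𝓞 K` is totally positive if it is positive under every real embedding. -/
def TotPos (α : 𝓞 K) : Prop := ∀ v : K →+* ℝ, 0 < v (α : K)

/-- The image of an ideal under a field automorphism. -/
def galMap (σ : K ≃ₐ[ℚ] K) (𝔞 : Ideal (𝓞 K)) : Ideal (𝓞 K) :=
  Ideal.map (RingOfIntegers.mapRingHom (σ : K →+* K)) 𝔞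

/-- The spin `spin(σ,𝔞) = (α/σ𝔞)` of a principal ideal `𝔞` having a totally positive
generator `α`; under the standing hypotheses (totally real, totally positive units are
squares) this is independent of the chosen totally positive generator, so the value below,
computed at an arbitrarily chosen such generator, is the spin. For ideals with no totally
positive generator the value is irrelevant (set to `0`). -/
def spin (σ : K ≃ₐ[ℚ] K) (𝔞 : Ideal (𝓞 K)) : ℤ :=
  if h : ∃ α : 𝓞 K, Ideal.span {α} = 𝔞 ∧ TotPos α then
    quadSym (galMap σ 𝔞) h.choose
  else 0

/-- An ideal of the ring of integers is odd if it is coprime to `2`. -/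
def OddIdeal (𝔞 : Ideal (𝓞 K)) : Prop := IsCoprime 𝔞 (Ideal.span {(2 : 𝓞 K)})

/-- The ideal class of a nonzero integral ideal (junk value `1` for the zero ideal). -/
def idealClass (𝔞 : Ideal (𝓞 K)) : ClassGroup (𝓞 K) :=
  if h : 𝔞 ≠ 0 then ClassGroup.mk0 ⟨𝔞, mem_nonZeroDivisors_of_ne_zero h⟩ else 1

/-- `r(𝔞) = 1` iff `𝔞` has a totally positive generator `≡ μ (mod 𝔐)`. -/
def rCond (𝔐 : Ideal (𝓞 K)) (μ : 𝓞 K) (𝔞 : Ideal (𝓞 K)) : Prop :=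
  ∃ α : 𝓞 K, Ideal.span {α} = 𝔞 ∧ TotPos α ∧ α - μ ∈ 𝔐

/-- **Conjecture `C_n`** with exponent `δ`: for every `ε > 0` there is a constant `C(ε)`
such that for all `Q ≥ 3`, all real `M ≥ 0`, all `1 ≤ N ≤ Q^{1/n}` and every non-principal
real Dirichlet character `χ` of modulus `q ≤ Q`,
`|∑_{M < m ≤ M+N} χ(m)| ≤ C(ε) Q^{(1-δ)/n+ε}`. -/
def ConjectureC (n : ℕ) (δ : ℝ) : Prop :=
  ∀ ε : ℝ, 0 < ε → ∃ C : ℝ, 0 < C ∧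
    ∀ Q : ℝ, 3 ≤ Q → ∀ M : ℝ, 0 ≤ M → ∀ N : ℝ, 1 ≤ N → N ≤ Q ^ ((1 : ℝ) / n) →
      ∀ q : ℕ, 0 < q → (q : ℝ) ≤ Q → ∀ χ : DirichletCharacter ℤ q, χ ≠ 1 →
        |∑ m ∈ Finset.Ioc ⌊M⌋₊ ⌊M + N⌋₊, ((χ (m : ZMod q) : ℤ) : ℝ)| ≤
          C * Q ^ ((1 - δ) / n + ε)

set_option linter.unusedSectionVars false
set_option linter.unusedSimpArgs false

/-- The additive character `x ↦ exp(2πix)` of the reals. -/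
def eexp (x : ℝ) : ℂ := Complex.exp (2 * Real.pi * Complex.I * x)

lemma eexp_add (x y : ℝ) : eexp (x + y) = eexp x * eexp y := by
  simp [eexp, mul_add, Complex.exp_add]

@[simp] lemma eexp_zero : eexp 0 = 1 := by simp [eexp]

lemma eexp_int (m : ℤ) : eexp m = 1 := by
  rw [eexp, Complex.exp_eq_one_iff]
  exact ⟨m, by push_cast; ring⟩

lemma eexp_eq_one_iff (x : ℝ) : eexp x = 1 ↔ ∃ m : ℤ, x = m := by
  constructor
  · intro h
    rw [eexp, Complex.exp_eq_one_iff] at h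
    obtain ⟨m, hm⟩ := h
    refine ⟨m, ?_⟩
    have h2 : (2 * Real.pi * Complex.I : ℂ) ≠ 0 := by
      simp [Real.pi_ne_zero]
    have : (x : ℂ) = m := by
      apply mul_left_cancel₀ h2
      rw [hm]; ring
    exact_mod_cast this
  · rintro ⟨m, rfl⟩
    exact eexp_int m

lemma norm_eexp (x : ℝ) : ‖eexp x‖ = 1 := by
  rw [eexp, Complex.norm_exp]; simp

lemma eexp_add_int (x : ℝ) (m : ℤ) : eexp (x + m) = eexp x := by
  rw [eexp_add, eexp_int, mul_one]

lemma conj_eexp (x : ℝ) : (starRingEnd ℂ) (eexp x) = eexp (-x) := by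
  rw [eexp, eexp, ← Complex.exp_conj]
  congr 1
  simp [map_ofNat]

/-- The quadratic Gauss sum `∑_{k mod 2a} e(k²/4a)`. -/
def gaussOne (a : ℕ) : ℂ := ∑ k ∈ Finset.range (2 * a), eexp ((k : ℝ) ^ 2 / (4 * a))

lemma eexp_gauss_period (a : ℕ) (ha : 0 < a) (k m : ℤ) :
    eexp (((2 * a * m + k : ℤ) : ℝ) ^ 2 / (4 * a)) = eexp ((k : ℝ) ^ 2 / (4 * a)) := by
  have : (((2 * a * m + k : ℤ) : ℝ) ^ 2 / (4 * a)) =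
      (k : ℝ) ^ 2 / (4 * a) + ((a * m ^ 2 + m * k : ℤ) : ℝ) := by
    have : (a : ℝ) ≠ 0 := by positivity
    push_cast; field_simp; ring
  rw [this, eexp_add_int]

/-- A periodic function on the integers summed over a shifted period. -/
lemma sum_range_shift_of_periodic (N : ℕ) (hN : 0 < N) (f : ℤ → ℂ)
    (hf : ∀ m k, f (N * m + k) = f k) (n : ℤ) :
    ∑ k ∈ Finset.range N, f (k - n) = ∑ k ∈ Finset.range N, f k := by
  have : NeZero N := ⟨hN.ne'⟩
  have key : ∀ g : ℤ → ℂ, (∀ m k, g (N * m + k) = g k) →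
      ∑ k ∈ Finset.range N, g k = ∑ z : ZMod N, g z.val := by
    intro g hg
    refine Finset.sum_bij' (fun k _ => (k : ZMod N)) (fun z _ => z.val) ?_ ?_ ?_ ?_ ?_
    · simp
    · intro z _; simpa using ZMod.val_lt z
    · intro k hk; exact ZMod.val_cast_of_lt (by simpa using hk)
    · intro z _; simp
    · intro k hk
      rw [ZMod.val_cast_of_lt (by simpa using hk)]
  have hmod : ∀ g : ℤ → ℂ, (∀ m k, g (N * m + k) = g k) → ∀ j : ℤ, g j = g ((j : ZMod N).val) := by
    intro g hg j
    rw [ZMod.val_intCast]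
    conv_lhs => rw [← Int.mul_ediv_add_emod j N]
    exact hg _ _
  rw [key f hf, key (fun k => f (k - n))]
  · rw [← Equiv.sum_comp (Equiv.subRight (n : ZMod N)) (fun z => f z.val)]
    apply Finset.sum_congr rfl
    intro z _
    rw [hmod f hf]
    simp
  · intro m k
    rw [← hf m (k - n)]; ring_nf

lemma summable_exp_neg_sq (t : ℝ) (ht : 0 < t) :
    Summable (fun n : ℤ => Real.exp (-Real.pi * t * (n : ℝ) ^ 2)) := by
  refine (summable_pow_mul_jacobiTheta₂_term_bound 0 ht 0).congr ?_
  intro n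
  simp
  ring

theorem gaussOne_phase (a : ℕ) (ha : 0 < a) :
    ∃ c : ℝ, 0 < c ∧ gaussOne a = c * (1 + Complex.I) := by
  have ha' : (0 : ℝ) < a := by exact_mod_cast ha
  have hac : (a : ℂ) ≠ 0 := by exact_mod_cast ha.ne'
  set A : ℂ := (1 - Complex.I) / (2 * a) with hA
  have hAinv : 1 / A = a * (1 + Complex.I) := by
    have h1 : (1 - Complex.I) * (1 + Complex.I) = 2 := by
      ring_nf; simp; norm_num
    have h2 : (1 - Complex.I) ≠ 0 := by
      intro h; rw [h, zero_mul] at h1; norm_num at h1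
    rw [hA]; field_simp
    rw [h1]
  have hA0 : A ≠ 0 := by
    intro h; rw [h] at hAinv
    simp at hAinv
    rcases hAinv with h | h
    · exact ha.ne' h
    · have := congrArg Complex.re h; simp at this
  have hAre : 0 < A.re := by
    have : A = ((1 / (2 * a) : ℝ) : ℂ) - ((1 / (2 * a) : ℝ) : ℂ) * Complex.I := by
      rw [hA]; push_cast; field_simp
    rw [this]; simp; exact ha
  set f : ℤ → ℂ := fun n => eexp ((n : ℝ) ^ 2 / (4 * a)) with hfdef
  set w : ℤ → ℝ := fun n => Real.exp (-Real.pi * (1 / (2 * a)) * (n : ℝ) ^ 2) with hw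
  have hwsum : Summable w := summable_exp_neg_sq (1 / (2 * a)) (by positivity)
  set S : ℂ := ∑' n : ℤ, f n * w n with hS
  have hfnorm : ∀ n, ‖f n‖ = 1 := fun n => norm_eexp _
  have hfw : Summable (fun n => f n * w n) := by
    apply Summable.of_norm
    refine hwsum.congr ?_
    intro n
    rw [norm_mul, hfnorm, one_mul, Complex.norm_real, Real.norm_of_nonneg (Real.exp_pos _).le]
  have hSA : S = ∑' n : ℤ, Complex.exp (-Real.pi * A * (n : ℂ) ^ 2) := by
    rw [hS]
    apply tsum_congr
    intro n
    simp only [hfdef, hw, eexp]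
    rw [Complex.ofReal_exp, ← Complex.exp_add]
    congr 1
    rw [hA]; push_cast; field_simp; ring
  obtain ⟨r, hr, hSr⟩ : ∃ r : ℝ, 0 < r ∧ S = 1 / A ^ (1 / 2 : ℂ) * r := by
    have h1 := Complex.tsum_exp_neg_quadratic (a := (a : ℂ)) (by simpa using ha) (Complex.I * a / 2)
    have h2 : ∑' n : ℤ, Complex.exp (-Real.pi / A * (n : ℂ) ^ 2) =
        ∑' n : ℤ, Complex.exp (-Real.pi * a * (n : ℂ) ^ 2 + 2 * Real.pi * (Complex.I * a / 2) *
            n) := by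
      apply tsum_congr
      intro n
      rw [Complex.exp_eq_exp_iff_exists_int]
      obtain ⟨m, hm⟩ : ∃ m : ℤ, n * (n + 1) = 2 * m := by
        obtain ⟨m, hm⟩ := Int.even_mul_succ_self n
        exact ⟨m, by rw [hm]; ring⟩
      refine ⟨-(a * m), ?_⟩
      have hm' : (n : ℂ) * (n + 1) = 2 * m := by exact_mod_cast hm
      have : -(Real.pi : ℂ) / A = -Real.pi * (a * (1 + Complex.I)) := by
        rw [← hAinv]; ring
      rw [this]
      push_cast
      linear_combination (-(Real.pi : ℂ) * a * Complex.I) * hm'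
    have h3 : ∀ n : ℤ, Complex.exp (-Real.pi / a * ((n : ℂ) + Complex.I * (Complex.I * a /
        2)) ^ 2) =
        ((Real.exp (-Real.pi / a * ((n : ℝ) - a / 2) ^ 2) : ℝ) : ℂ) := by
      intro n
      rw [Complex.ofReal_exp]
      congr 1
      push_cast
      have : Complex.I * (Complex.I * a / 2) = -(a / 2) := by
        have := Complex.I_mul_I
        linear_combination (a / 2 : ℂ) * this
      rw [this]; ring
    have h4 : (1 / (a : ℂ) ^ (1 / 2 : ℂ)) = ((1 / (a : ℝ) ^ (1 / 2 : ℝ) : ℝ) : ℂ) := by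
      rw [Complex.ofReal_div, Complex.ofReal_cpow ha'.le]
      simp
    have h5 : Summable (fun n : ℤ => Real.exp (-Real.pi / a * ((n : ℝ) - a / 2) ^ 2)) := by
      refine Summable.of_nonneg_of_le (fun _ => (Real.exp_pos _).le) ?_
          ((summable_exp_neg_sq (1 / (2 * a))
          (by positivity)).mul_left (Real.exp (Real.pi * a / 4)))
      intro n
      rw [← Real.exp_add]
      apply Real.exp_le_exp.mpr
      have : (Real.pi * a / 4 + -Real.pi * (1 / (2 * a)) * (n : ℝ) ^ 2) - (-Real.pi / a *
          ((n : ℝ) - a / 2) ^ 2) = Real.pi / (2 * a) * (n - a) ^ 2 := by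
        field_simp; ring
      have h7 : 0 ≤ Real.pi / (2 * a) * ((n : ℝ) - a) ^ 2 := by positivity
      linarith
    refine ⟨1 / (a : ℝ) ^ (1 / 2 : ℝ) * ∑' n : ℤ, Real.exp (-Real.pi / a * ((n : ℝ) - a / 2) ^ 2),
        ?_, ?_⟩
    · apply mul_pos
      · positivity
      · exact h5.tsum_pos (fun _ => (Real.exp_pos _).le) 0 (Real.exp_pos _)
    · rw [hSA, Complex.tsum_exp_neg_mul_int_sq hAre]
      congr 1
      rw [h2, h1, h4, tsum_congr h3]
      push_cast
      rfl
  have hN : (0 : ℝ) < 2 * a := by positivity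
  -- Poisson summation in residue classes
  have hpois : ∀ k : ℤ, ∑' m : ℤ, (w (2 * a * m + k) : ℂ) =
      1 / ((2 * a : ℝ) ^ (1 / 2 : ℝ) : ℝ) * ∑' n : ℤ, (w n : ℂ) * eexp (-(n * k) / (2 * a)) := by
    intro k
    have h1 := Complex.tsum_exp_neg_quadratic (a := ((1 / (2 * a) : ℝ) : ℂ)) (by rw [Complex.ofReal_re]; positivity) (-Complex.I * k / (2 * a))
    have h2 : ∀ n : ℤ, (w n : ℂ) * eexp (-(n * k) / (2 * a)) =
       Complex.exp (-Real.pi * ((1 / (2 * a) : ℝ) : ℂ) * (n : ℂ) ^ 2 + 2 * Real.pi * (-Complex.I *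
           k / (2 * a)) * n) := by
      intro n
      simp only [hw, eexp]
      rw [Complex.ofReal_exp, ← Complex.exp_add]
      congr 1
      push_cast
      ring
    have h3 : ∀ m : ℤ, (w (2 * a * m + k) : ℂ) =
        Complex.exp (-Real.pi / ((1 / (2 * a) : ℝ) : ℂ) * ((m : ℂ) + Complex.I * (-Complex.I * k /
        (2 * a))) ^ 2) := by
      intro m
      simp only [hw]
      rw [Complex.ofReal_exp]
      congr 1
      have : Complex.I * (-Complex.I * k / (2 * a)) = k / (2 * a) := by
        have := Complex.I_mul_I
        linear_combination (-(k : ℂ) / (2 * a)) * this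
      rw [this]
      push_cast
      field_simp
    rw [tsum_congr h2, tsum_congr h3, h1, ← mul_assoc]
    have h4 : 1 / (((2 * a : ℝ) ^ (1 / 2 : ℝ) : ℝ) : ℂ) * (1 / ((1 / (2 * a) : ℝ) : ℂ) ^ (1 /
        2 : ℂ)) = 1 := by
      have : ((1 / (2 * a) : ℝ) : ℂ) ^ (1 / 2 : ℂ) = (((1 / (2 * a) : ℝ) ^ (1 / 2 : ℝ) : ℝ) : ℂ) :=
          by
        rw [Complex.ofReal_cpow (by positivity)]; simp
      rw [this]
      rw [Real.div_rpow (by norm_num) (by positivity), Real.one_rpow]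
      have h8 : ((2 * a : ℝ) ^ (1 / 2 : ℝ)) ≠ 0 := by positivity
      have h9 : (((2 * a : ℝ) ^ (1 / 2 : ℝ) : ℝ) : ℂ) ≠ 0 := by exact_mod_cast h8
      rw [Complex.ofReal_div]
      field_simp
      simp
    rw [h4, one_mul]
  have hcomb : S = (gaussOne a / ((2 * a : ℝ) ^ (1 / 2 : ℝ) : ℝ)) * (starRingEnd ℂ) S := by
    have : NeZero (2 * a) := ⟨by positivity⟩
    have e1 : S = ∑' p : ℤ × Fin (2 * a), f (2 * a * p.1 + p.2) * w (2 * a * p.1 + p.2) := by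
      rw [hS, ← (Int.divModEquiv (2 * a)).symm.tsum_eq]
      apply tsum_congr
      rintro ⟨m, k⟩
      simp [Int.divModEquiv, mul_comm]
    have e2 : Summable (fun p : ℤ × Fin (2 * a) => f (2 * a * p.1 + p.2) * w (2 * a * p.1 +
        p.2)) := by
      have := (Int.divModEquiv (2 * a)).symm.summable_iff.mpr hfw
      refine this.congr ?_
      rintro ⟨m, k⟩
      simp [Int.divModEquiv, mul_comm]
    have e3 : S = ∑ k : Fin (2 * a), ∑' m : ℤ, f (2 * a * m + k) * w (2 * a * m + k) := by
      rw [e1, ← (Equiv.prodComm (Fin (2 * a)) ℤ).tsum_eq]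
      have h10 : Summable (fun p : Fin (2 * a) × ℤ => f (2 * a * p.2 + p.1) * w (2 * a * p.2 +
          p.1)) :=
        (Equiv.prodComm (Fin (2 * a)) ℤ).summable_iff.mpr e2
      rw [← tsum_fintype (L := .unconditional _)]
      exact h10.tsum_prod
    have e4 : S = ∑ k ∈ Finset.range (2 * a),
        f k * (1 / ((2 * a : ℝ) ^ (1 / 2 : ℝ) : ℝ) * ∑' n : ℤ,
        (w n : ℂ) * eexp (-(n * k) / (2 * a))) := by
      rw [e3, ← Fin.sum_univ_eq_sum_range (fun k : ℕ => f k * (1 / ((2 * a : ℝ) ^ (1 /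
          2 : ℝ) : ℝ) * ∑' n : ℤ, (w n : ℂ) * eexp (-(n * k) / (2 * a))))]
      apply Finset.sum_congr rfl
      intro k _
      have := hpois (k : ℕ)
      push_cast at this
      rw [← this, ← tsum_mul_left]
      apply tsum_congr
      intro m
      congr 1
      exact eexp_gauss_period a ha k m
    have hsw : ∀ k : ℕ, Summable (fun n : ℤ => (w n : ℂ) * eexp (-(n * k) / (2 * a))) := by
      intro k
      apply Summable.of_norm
      refine hwsum.congr ?_
      intro n
      rw [norm_mul, norm_eexp, mul_one, Complex.norm_real, Real.norm_of_nonneg (Real.exp_pos _).le]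
    have e5 : S = 1 / ((2 * a : ℝ) ^ (1 / 2 : ℝ) : ℝ) * ∑' n : ℤ, ∑ k ∈ Finset.range (2 * a),
        f k * ((w n : ℂ) * eexp (-(n * k) / (2 * a))) := by
      rw [Summable.tsum_finsetSum (fun k _ => (hsw k).mul_left _), e4, Finset.mul_sum]
      apply Finset.sum_congr rfl
      intro k _
      rw [tsum_mul_left]; ring
    have e6 : ∀ n : ℤ, ∑ k ∈ Finset.range (2 * a), f k * ((w n : ℂ) * eexp (-(n * k) / (2 * a))) =
        gaussOne a * (starRingEnd ℂ) (f n * w n) := by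
      intro n
      have h11 := sum_range_shift_of_periodic (2 * a) (by positivity) f (by
        intro m k
        have := eexp_gauss_period a ha k m
        simp only [hfdef]
        push_cast at this ⊢
        exact this) n
      have h12 : gaussOne a = ∑ k ∈ Finset.range (2 * a), f k := by
        simp [gaussOne, hfdef]
      rw [h12, ← h11, Finset.sum_mul]
      apply Finset.sum_congr rfl
      intro k _
      rw [map_mul, Complex.conj_ofReal]
      have : f k * eexp (-(n * k) / (2 * a)) = f (k - n) * (starRingEnd ℂ) (f n) := by
        simp only [hfdef, conj_eexp, ← eexp_add]
        congr 1
        push_cast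
        field_simp
        ring
      linear_combination (w n : ℂ) * this
    rw [tsum_congr e6, tsum_mul_left, ← Complex.conj_tsum, ← hS] at e5
    rw [one_div, ← mul_assoc, inv_mul_eq_div] at e5
    exact e5
  have hS0 : S ≠ 0 := by
    rw [hSr]
    have : A ^ (1 / 2 : ℂ) ≠ 0 := by
      rw [Ne, Complex.cpow_eq_zero_iff]; tauto
    have hr' : (r : ℂ) ≠ 0 := by exact_mod_cast hr.ne'
    exact mul_ne_zero (one_div_ne_zero this) hr'
  have hsq : S * S = a * (1 + Complex.I) * (r : ℂ) ^ 2 := by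
    have : A ^ (1 / 2 : ℂ) * A ^ (1 / 2 : ℂ) = A := by
      rw [← Complex.cpow_add _ _ hA0]; norm_num
    rw [← hAinv, hSr]
    have h0 : A ^ (1 / 2 : ℂ) ≠ 0 := by
      rw [Ne, Complex.cpow_eq_zero_iff]; tauto
    field_simp
    rw [sq (A ^ (1 / 2 : ℂ)), this]
    ring
  have hns : 0 < Complex.normSq S := Complex.normSq_pos.mpr hS0
  refine ⟨(2 * a : ℝ) ^ (1 / 2 : ℝ) * (a * r ^ 2) / Complex.normSq S, by positivity, ?_⟩
  have hm : S * (starRingEnd ℂ) S = Complex.normSq S := Complex.mul_conj S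
  set q : ℝ := (2 * a : ℝ) ^ (1 / 2 : ℝ) with hq
  have hq0 : (q : ℂ) ≠ 0 := by
    have : q ≠ 0 := by positivity
    exact_mod_cast this
  have hnc : (Complex.normSq S : ℂ) ≠ 0 := by exact_mod_cast hns.ne'
  have h20 : S * S * q = gaussOne a * Complex.normSq S := by
    rw [← hm]
    have : S * q = gaussOne a * (starRingEnd ℂ) S := by
      conv_lhs => rw [hcomb]
      field_simp
    linear_combination S * this
  push_cast
  field_simp
  rw [← h20, hsq]
  ring

section Mean

universe u v w

variable {A : Type u} {B : Type v} {G : Type w} [AddCommGroup A] [AddCommGroup B] [AddCommGroup G]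

/-- A function on an abelian group is finitely periodic if it factors through a finite
quotient group. -/
def FinPeriodic (f : A → ℂ) : Prop :=
  ∃ C : AddSubgroup A, C.FiniteIndex ∧ ∀ a, ∀ c ∈ C, f (a + c) = f a

/-- The mean of a finitely periodic function (junk value `0` otherwise). -/
def mean (f : A → ℂ) : ℂ :=
  if h : FinPeriodic f then
    (Nat.card (A ⧸ h.choose) : ℂ)⁻¹ * ∑ᶠ q : A ⧸ h.choose, f q.out
  else 0

lemma sum_comp_surj {H H' : Type*} [AddCommGroup H] [AddCommGroup H'] [Fintype H] [Fintype H']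
    (π : H →+ H') (hπ : Function.Surjective π) (F : H' → ℂ) :
    (Fintype.card H : ℂ)⁻¹ * ∑ x, F (π x) = (Fintype.card H' : ℂ)⁻¹ * ∑ y, F y := by
  have hfib : ∀ y : H', (Finset.univ.filter (fun x => π x = y)).card =
      (Finset.univ.filter (fun x => π x = 0)).card := by
    intro y
    obtain ⟨x0, hx0⟩ := hπ y
    refine Finset.card_bij' (fun x _ => x - x0) (fun x _ => x + x0) ?_ ?_ ?_ ?_ <;>
      simp +contextual [hx0]
  set k := (Finset.univ.filter (fun x => π x = 0)).card with hk
  have hk0 : k ≠ 0 := by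
    rw [hk, Finset.card_ne_zero]
    exact ⟨0, by simp⟩
  have h1 : ∑ x, F (π x) = k * ∑ y, F y := by
    rw [← Finset.sum_fiberwise (s := Finset.univ) (g := π) (f := fun x => F (π x)), Finset.mul_sum]
    apply Finset.sum_congr rfl
    intro y _
    rw [← hfib y, Finset.sum_congr rfl (g := fun _ => F y)]
    · simp
    · intro x hx; simp at hx; rw [hx]
  have h2 : Fintype.card H = k * Fintype.card H' := by
    have h3 := Finset.card_eq_sum_card_fiberwise (s := (Finset.univ : Finset H)) (t := Finset.univ)
      (f := π) (by intro x _; simp)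
    rw [← Finset.card_univ, h3, Finset.sum_congr rfl (fun y _ => hfib y)]
    simp [mul_comm, hk]
  rw [h1, h2]
  have : (Fintype.card H' : ℂ) ≠ 0 := by simp
  push_cast
  field_simp

lemma mean_eq_of_hom {H : Type*} [AddCommGroup H] [Fintype H] (π : A →+ H)
    (hπ : Function.Surjective π) (F : H → ℂ) (f : A → ℂ) (hf : ∀ a, f a = F (π a)) :
    mean f = (Fintype.card H : ℂ)⁻¹ * ∑ x, F x := by
  have hfp : FinPeriodic f := by
    refine ⟨π.ker, ?_, ?_⟩
    · have : Finite (A ⧸ π.ker) := Finite.of_injective _ (QuotientAddGroup.kerLift_injective π)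
      exact AddSubgroup.finiteIndex_of_finite_quotient
    · intro a c hc
      rw [hf, hf, map_add, (AddMonoidHom.mem_ker).mp hc, add_zero]
  rw [mean, dif_pos hfp]
  set C := hfp.choose with hC
  obtain ⟨hC1, hC2⟩ := hfp.choose_spec
  rw [← hC] at hC1 hC2
  have : Finite (A ⧸ C) := AddSubgroup.finite_quotient_of_finiteIndex
  have : Fintype (A ⧸ C) := Fintype.ofFinite _
  rw [finsum_eq_sum_of_fintype, Nat.card_eq_fintype_card]
  set ρ : A →+ (A ⧸ C) × H := (QuotientAddGroup.mk' C).prod π with hρ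
  have hfC : ∀ a : A, f (QuotientAddGroup.mk a : A ⧸ C).out = f a := by
    intro a
    obtain ⟨c, hc⟩ := QuotientAddGroup.mk_out_eq_add C a
    rw [hc, hC2 _ _ c.2]
  let p1 : ρ.range →+ (A ⧸ C) := (AddMonoidHom.fst _ _).comp ρ.range.subtype
  let p2 : ρ.range →+ H := (AddMonoidHom.snd _ _).comp ρ.range.subtype
  have hp1 : Function.Surjective p1 := by
    intro q
    obtain ⟨a, rfl⟩ := QuotientAddGroup.mk_surjective q
    exact ⟨⟨ρ a, a, rfl⟩, rfl⟩
  have hp2 : Function.Surjective p2 := by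
    intro q
    obtain ⟨a, rfl⟩ := hπ q
    exact ⟨⟨ρ a, a, rfl⟩, rfl⟩
  rw [← sum_comp_surj p1 hp1, ← sum_comp_surj p2 hp2]
  congr 1
  apply Finset.sum_congr rfl
  rintro ⟨_, a, rfl⟩ _
  change f (QuotientAddGroup.mk a : A ⧸ C).out = F (π a)
  rw [hfC, hf]

/-- A finitely periodic function comes from a finite quotient. -/
lemma FinPeriodic.exists_hom {f : A → ℂ} (hf : FinPeriodic f) (T : AddSubgroup A)
    (hT : T.FiniteIndex) :
    ∃ (H : Type u) (_ : AddCommGroup H) (_ : Fintype H) (π : A →+ H) (F : H → ℂ),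
      Function.Surjective π ∧ (∀ a, f a = F (π a)) ∧ π.ker ≤ T := by
  obtain ⟨C, hC, hf⟩ := hf
  have : (C ⊓ T).FiniteIndex := inferInstance
  have : Finite (A ⧸ (C ⊓ T)) := AddSubgroup.finite_quotient_of_finiteIndex
  refine ⟨A ⧸ (C ⊓ T), inferInstance, Fintype.ofFinite _, QuotientAddGroup.mk' _, fun q => f q.out,
    QuotientAddGroup.mk'_surjective _, ?_, ?_⟩
  · intro a
    obtain ⟨c, hc⟩ := QuotientAddGroup.mk_out_eq_add (C ⊓ T) a
    simp only [QuotientAddGroup.mk'_apply]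
    rw [hc, hf _ _ c.2.1]
  · rw [QuotientAddGroup.ker_mk']; exact inf_le_right

lemma FinPeriodic.comp {f : G → ℂ} (hf : FinPeriodic f) (φ : A →+ G) :
    FinPeriodic (fun a => f (φ a)) := by
  obtain ⟨C, hC, hf⟩ := hf
  refine ⟨C.comap φ, ?_, ?_⟩
  · have : Finite (G ⧸ C) := AddSubgroup.finite_quotient_of_finiteIndex
    have h : C.comap φ = ((QuotientAddGroup.mk' C).comp φ).ker := by
      ext a; simp [AddMonoidHom.mem_ker]
    rw [h]
    have : Finite (A ⧸ ((QuotientAddGroup.mk' C).comp φ).ker) :=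
      Finite.of_injective _ (QuotientAddGroup.kerLift_injective _)
    exact AddSubgroup.finiteIndex_of_finite_quotient
  intro a c hc
  simp only [map_add]
  exact hf _ _ hc

lemma mean_comp_surj {f : G → ℂ} (hf : FinPeriodic f) (φ : A →+ G) (hφ : Function.Surjective φ) :
    mean (fun a => f (φ a)) = mean f := by
  obtain ⟨H, _, _, π, F, hπ, hF, -⟩ := hf.exists_hom ⊤ inferInstance
  rw [mean_eq_of_hom π hπ F f hF, mean_eq_of_hom (π.comp φ) (hπ.comp hφ) F _ (fun a => hF _)]

lemma mean_prod {f₁ : A → ℂ} {f₂ : B → ℂ} (h₁ : FinPeriodic f₁) (h₂ : FinPeriodic f₂) :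
    mean (fun p : A × B => f₁ p.1 * f₂ p.2) = mean f₁ * mean f₂ := by
  obtain ⟨H, _, _, π, F, hπ, hF, -⟩ := h₁.exists_hom ⊤ inferInstance
  obtain ⟨H', _, _, π', F', hπ', hF', -⟩ := h₂.exists_hom ⊤ inferInstance
  rw [mean_eq_of_hom π hπ F _ hF, mean_eq_of_hom π' hπ' F' _ hF',
    mean_eq_of_hom (π.prodMap π') (hπ.prodMap hπ') (fun p => F p.1 * F' p.2)]
  · rw [Fintype.sum_prod_type, Fintype.card_prod]
    push_cast
    rw [mul_inv, mul_mul_mul_comm, Fintype.sum_mul_sum]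
  · rintro ⟨a, b⟩
    simp [hF, hF']

/-- If `G` is the sum of the images of `A` and `B` and `f` is multiplicative along this
decomposition, then its mean is the product of the means. -/
lemma mean_add {f : G → ℂ} (hf : FinPeriodic f) (φ₁ : A →+ G) (φ₂ : B →+ G)
    (hφ : ∀ g, ∃ a b, φ₁ a + φ₂ b = g) {f₁ : A → ℂ} {f₂ : B → ℂ}
    (h0₁ : f₁ 0 = 1) (h0₂ : f₂ 0 = 1) (hmul : ∀ a b, f (φ₁ a + φ₂ b) = f₁ a * f₂ b) :
    mean f = mean f₁ * mean f₂ := by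
  have h₁ : FinPeriodic f₁ := by
    have := hf.comp φ₁
    convert this using 2 with a
    have := hmul a 0
    simp [h0₂] at this
    exact this.symm
  have h₂ : FinPeriodic f₂ := by
    have := hf.comp φ₂
    convert this using 2 with a
    have := hmul 0 a
    simp [h0₁] at this
    exact this.symm
  rw [← mean_prod h₁ h₂, ← mean_comp_surj hf (φ₁.coprod φ₂)]
  · congr 1
    ext ⟨a, b⟩
    simp [hmul]
  · intro g
    obtain ⟨a, b, h⟩ := hφ g
    exact ⟨(a, b), by simpa using h⟩

lemma mean_one : mean (fun _ : A => (1 : ℂ)) = 1 := by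
  rw [mean_eq_of_hom (0 : A →+ Unit) (fun _ => ⟨0, rfl⟩) (fun _ => 1) _ (fun _ => rfl)]
  simp

lemma mean_restrict {f : A → ℂ} (hf : FinPeriodic f) (S T : AddSubgroup A) (hT : T.FiniteIndex)
    (h1 : ∀ y ∈ T, ∀ x ∈ S, f (y + x) = f y)
    (h2 : ∀ y ∉ T, ∃ x₀ ∈ S, ∃ c ≠ (1 : ℂ), ∀ x ∈ S, f (y + x + x₀) = c * f (y + x)) :
    mean f = (T.index : ℂ)⁻¹ * mean (fun y : T => f y) := by
  obtain ⟨H, _, _, π, F, hπ, hF, hker⟩ := hf.exists_hom T hT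
  rw [mean_eq_of_hom π hπ F _ hF]
  let π' : T →+ T.map π := (π.comp T.subtype).codRestrict (T.map π) (fun x => ⟨x, x.2, rfl⟩)
  have hπ' : Function.Surjective π' := by
    rintro ⟨_, x, hx, rfl⟩
    exact ⟨⟨x, hx⟩, rfl⟩
  rw [mean_eq_of_hom π' hπ' (fun z => F z) (fun y : T => f y) (fun a => hF _)]
  have hidx : T.index = (T.map π).index := by
    rw [AddSubgroup.index_map_eq T hπ hker]
  have hcard : (T.map π).index * Fintype.card (T.map π) = Fintype.card H := by
    have := AddSubgroup.card_mul_index (T.map π)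
    rw [Nat.card_eq_fintype_card, Nat.card_eq_fintype_card] at this
    rw [mul_comm]; exact this
  have hmem : ∀ y : A, π y ∈ T.map π ↔ y ∈ T := by
    intro y
    constructor
    · rintro ⟨x, hx, hxy⟩
      have : y - x ∈ π.ker := by rw [AddMonoidHom.mem_ker, map_sub, hxy, sub_self]
      have := T.add_mem (hker this) hx
      simpa using this
    · intro hy; exact ⟨y, hy, rfl⟩
  have hsum : ∑ x, F x = ∑ z : T.map π, F z := by
    have e1 : ∀ z : H, ∑ s : S.map π, F (z + s) =
        if z ∈ T.map π then (Fintype.card (S.map π) : ℂ) * F z else 0 := by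
      intro z
      obtain ⟨y, rfl⟩ := hπ z
      rw [hmem]
      split_ifs with hy
      · rw [Finset.sum_congr rfl (g := fun _ => F (π y))]
        · simp
        · rintro ⟨_, x, hx, rfl⟩ _
          simp only
          rw [← map_add, ← hF, ← hF, h1 y hy x hx]
      · obtain ⟨x₀, hx₀, c, hc, h⟩ := h2 y hy
        have h3 : ∑ s : S.map π, F (π y + s) = c * ∑ s : S.map π, F (π y + s) := by
          rw [Finset.mul_sum]
          refine (Equiv.sum_comp (Equiv.addRight (⟨π x₀, x₀, hx₀, rfl⟩ : S.map π)) _).symm.trans ?_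
          apply Finset.sum_congr rfl
          rintro ⟨_, x, hx, rfl⟩ _
          have := h x hx
          rw [hF, hF, map_add, map_add] at this
          simp only [Equiv.coe_addRight, AddSubgroup.coe_add]
          rw [← add_assoc]
          exact this
        have h4 : (1 - c) * ∑ s : S.map π, F (π y + s) = 0 := by
          linear_combination h3
        rcases mul_eq_zero.mp h4 with h5 | h5
        · exact absurd (sub_eq_zero.mp h5).symm hc
        · exact h5
    have e2 : ∑ z, ∑ s : S.map π, F (z + s) = (Fintype.card (S.map π) : ℂ) * ∑ x, F x := by
      rw [Finset.sum_comm]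
      rw [Finset.sum_congr rfl (g := fun _ => ∑ x, F x)]
      · simp
      · intro s _
        exact Equiv.sum_comp (Equiv.addRight (s : H)) F
    rw [Finset.sum_congr rfl (fun z _ => e1 z), ← Finset.sum_filter, ← Finset.mul_sum] at e2
    have hne : (Fintype.card (S.map π) : ℂ) ≠ 0 := by
      exact_mod_cast Fintype.card_ne_zero
    rw [← mul_left_cancel₀ hne e2]
    exact Finset.sum_subtype _ (by simp) _
  rw [hsum, hidx, ← hcard]
  push_cast
  rw [mul_inv]; ring

end Mean

section Symbol

lemma finite_quot {I : Ideal (𝓞 K)} (hI : I ≠ ⊥) : Finite (𝓞 K ⧸ I) :=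
  Ideal.finiteQuotientOfFreeOfNeBot I hI

/-- The residue field at a nonzero prime. -/
@[reducible] def resField (𝔭 : Ideal (𝓞 K)) (hp : 𝔭.IsPrime) (h0 : 𝔭 ≠ ⊥) : Field (𝓞 K ⧸ 𝔭) :=
  haveI := Ring.DimensionLEOne.maximalOfPrime h0 hp
  Ideal.Quotient.field 𝔭

lemma legSym_eq_quadraticChar (𝔭 : Ideal (𝓞 K)) (hp : 𝔭.IsPrime) (h0 : 𝔭 ≠ ⊥) :
    letI := resField 𝔭 hp h0
    letI : Fintype (𝓞 K ⧸ 𝔭) := @Fintype.ofFinite _ (finite_quot h0)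
    ∀ α, legSym 𝔭 α = quadraticChar (𝓞 K ⧸ 𝔭) (Ideal.Quotient.mk 𝔭 α) := by
  intro α
  rw [quadraticChar_apply, quadraticCharFun, legSym]
  split_ifs <;> rfl

lemma legSym_mul {𝔭 : Ideal (𝓞 K)} (hp : 𝔭.IsPrime) (h0 : 𝔭 ≠ ⊥) (α β : 𝓞 K) :
    legSym 𝔭 (α * β) = legSym 𝔭 α * legSym 𝔭 β := by
  rw [legSym_eq_quadraticChar 𝔭 hp h0, legSym_eq_quadraticChar 𝔭 hp h0,
    legSym_eq_quadraticChar 𝔭 hp h0, map_mul]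
  exact map_mul _ _ _

lemma legSym_congr {𝔭 : Ideal (𝓞 K)} {α β : 𝓞 K} (h : α - β ∈ 𝔭) : legSym 𝔭 α = legSym 𝔭 β := by
  rw [legSym, legSym, Ideal.Quotient.eq.mpr h]

lemma legSym_eq_zero_iff {𝔭 : Ideal (𝓞 K)} {α : 𝓞 K} : legSym 𝔭 α = 0 ↔ α ∈ 𝔭 := by
  rw [legSym, ← Ideal.Quotient.eq_zero_iff_mem]
  split_ifs <;> simp_all

lemma legSym_trichotomy (𝔭 : Ideal (𝓞 K)) (α : 𝓞 K) :
    legSym 𝔭 α = 0 ∨ legSym 𝔭 α = 1 ∨ legSym 𝔭 α = -1 := by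
  rw [legSym]; split_ifs <;> simp

lemma quadSym_mul_ideal {𝔞 𝔟 : Ideal (𝓞 K)} (ha : 𝔞 ≠ ⊥) (hb : 𝔟 ≠ ⊥) (α : 𝓞 K) :
    quadSym (𝔞 * 𝔟) α = quadSym 𝔞 α * quadSym 𝔟 α := by
  rw [quadSym, UniqueFactorizationMonoid.normalizedFactors_mul ha hb, Multiset.map_add,
    Multiset.prod_add]; rfl

lemma quadSym_prime {𝔭 : Ideal (𝓞 K)} (hp : 𝔭.IsPrime) (h0 : 𝔭 ≠ ⊥) (α : 𝓞 K) :
    quadSym 𝔭 α = legSym 𝔭 α := by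
  rw [quadSym, UniqueFactorizationMonoid.normalizedFactors_irreducible
    (Ideal.prime_of_isPrime h0 hp).irreducible]
  simp

@[simp] lemma quadSym_top (α : 𝓞 K) : quadSym (⊤ : Ideal (𝓞 K)) α = 1 := by
  rw [quadSym, ← Ideal.one_eq_top, UniqueFactorizationMonoid.normalizedFactors_one]; simp

lemma isPrime_of_mem_factors {𝔟 𝔭 : Ideal (𝓞 K)}
    (h : 𝔭 ∈ UniqueFactorizationMonoid.normalizedFactors 𝔟) : 𝔭.IsPrime ∧ 𝔭 ≠ ⊥ := by
  have := UniqueFactorizationMonoid.prime_of_normalized_factor 𝔭 h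
  exact ⟨Ideal.isPrime_of_prime this, this.ne_zero⟩

lemma quadSym_mul (𝔟 : Ideal (𝓞 K)) (α β : 𝓞 K) :
    quadSym 𝔟 (α * β) = quadSym 𝔟 α * quadSym 𝔟 β := by
  rw [quadSym, quadSym, quadSym, ← Multiset.prod_map_mul]
  congr 1
  apply Multiset.map_congr rfl
  intro 𝔭 h
  exact legSym_mul (isPrime_of_mem_factors h).1 (isPrime_of_mem_factors h).2 _ _

lemma quadSym_congr {𝔟 : Ideal (𝓞 K)} {α β : 𝓞 K} (h : ∀ 𝔭, 𝔭.IsPrime → 𝔟 ≤ 𝔭 → α - β ∈ 𝔭) :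
    quadSym 𝔟 α = quadSym 𝔟 β := by
  rw [quadSym, quadSym]
  congr 1
  apply Multiset.map_congr rfl
  intro 𝔭 hp
  apply legSym_congr
  exact h _ (isPrime_of_mem_factors hp).1
    (Ideal.dvd_iff_le.mp (UniqueFactorizationMonoid.dvd_of_mem_normalizedFactors hp))

lemma quadSym_trichotomy (𝔟 : Ideal (𝓞 K)) (α : 𝓞 K) :
    quadSym 𝔟 α = 0 ∨ quadSym 𝔟 α = 1 ∨ quadSym 𝔟 α = -1 := by
  rw [quadSym]
  induction UniqueFactorizationMonoid.normalizedFactors 𝔟 using Multiset.induction_on with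
  | empty => simp
  | cons a s ih =>
    rw [Multiset.map_cons, Multiset.prod_cons]
    rcases legSym_trichotomy a α with h | h | h <;> rcases ih with h' | h' | h' <;> simp [h, h']

lemma quadSym_ne_zero_iff {𝔟 : Ideal (𝓞 K)} (hb : 𝔟 ≠ ⊥) {α : 𝓞 K} :
    quadSym 𝔟 α ≠ 0 ↔ IsCoprime 𝔟 (Ideal.span {α}) := by
  rw [quadSym, Ne, Multiset.prod_eq_zero_iff, Multiset.mem_map]
  constructor
  · intro h
    rw [Ideal.isCoprime_iff_sup_eq]
    by_contra hne
    obtain ⟨𝔭, hm, hle⟩ := Ideal.exists_le_maximal _ hne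
    apply h
    have hb0 : 𝔭 ≠ ⊥ := by
      rintro rfl
      exact hb (le_bot_iff.mp (le_sup_left.trans hle))
    refine ⟨𝔭, ?_, ?_⟩
    · rw [UniqueFactorizationMonoid.mem_normalizedFactors_iff hb]
      exact ⟨Ideal.prime_of_isPrime hb0 hm.isPrime, Ideal.dvd_iff_le.mpr (le_sup_left.trans hle)⟩
    · rw [legSym_eq_zero_iff]
      exact hle (Ideal.mem_sup_right (Ideal.mem_span_singleton_self α))
  · rintro h ⟨𝔭, hp, h0⟩
    rw [legSym_eq_zero_iff] at h0
    rw [Ideal.isCoprime_iff_sup_eq] at h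
    have := (isPrime_of_mem_factors hp).1.ne_top
    apply this
    rw [← top_le_iff, ← h]
    apply sup_le
    · exact Ideal.dvd_iff_le.mp (UniqueFactorizationMonoid.dvd_of_mem_normalizedFactors hp)
    · rwa [Ideal.span_singleton_le_iff_mem]

lemma quadSym_one (𝔟 : Ideal (𝓞 K)) : quadSym 𝔟 1 = 1 := by
  rw [quadSym]
  apply Multiset.prod_eq_one
  intro x hx
  obtain ⟨𝔭, hp, rfl⟩ := Multiset.mem_map.mp hx
  rw [legSym, if_neg, if_pos ⟨1, by simp⟩]
  rw [Ideal.Quotient.eq_zero_iff_mem]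
  exact fun h => (isPrime_of_mem_factors hp).1.ne_top ((Ideal.eq_top_iff_one _).mpr h)

lemma quadSym_sq_mul {𝔟 : Ideal (𝓞 K)} (hb : 𝔟 ≠ ⊥) {u : 𝓞 K} (hu : IsCoprime 𝔟 (Ideal.span {u}))
    (α : 𝓞 K) : quadSym 𝔟 (u ^ 2 * α) = quadSym 𝔟 α := by
  rw [quadSym_mul, sq, quadSym_mul]
  have := (quadSym_ne_zero_iff hb).mpr hu
  rcases quadSym_trichotomy 𝔟 u with h | h | h
  · contradiction
  · simp [h]
  · simp [h]

end Symbol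

section QuadraticMean

/-- `ψ` is trivial on the multiples of `z` exactly when `z ∈ 𝔟`. -/
def HasConductor (ψ : AddChar (𝓞 K) ℂ) (𝔟 : Ideal (𝓞 K)) : Prop :=
  ∀ z, z ∈ 𝔟 ↔ ∀ x, ψ (z * x) = 1

lemma HasConductor.eq_one {ψ : AddChar (𝓞 K) ℂ} {𝔟 : Ideal (𝓞 K)} (h : HasConductor ψ 𝔟)
    {z : 𝓞 K} (hz : z ∈ 𝔟) : ψ z = 1 := by
  simpa using (h z).mp hz 1

lemma finiteIndex_of_ne_bot {I : Ideal (𝓞 K)} (hI : I ≠ ⊥) :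
    (Submodule.toAddSubgroup I).FiniteIndex := by
  have : Finite (𝓞 K ⧸ Submodule.toAddSubgroup I) := finite_quot hI
  exact AddSubgroup.finiteIndex_of_finite_quotient

lemma finPeriodic_quad {ψ : AddChar (𝓞 K) ℂ} {𝔟 : Ideal (𝓞 K)} (hb : 𝔟 ≠ ⊥)
    (h : ∀ z ∈ 𝔟, ψ z = 1) (κ : 𝓞 K) : FinPeriodic (fun y : 𝓞 K => ψ (κ * y ^ 2)) := by
  refine ⟨Submodule.toAddSubgroup 𝔟, finiteIndex_of_ne_bot hb, ?_⟩
  intro a c hc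
  have hc' : c ∈ 𝔟 := hc
  have : κ * (a + c) ^ 2 = κ * a ^ 2 + (κ * (2 * a + c)) * c := by ring
  simp only
  rw [this, AddChar.map_add_eq_mul, h _ (𝔟.mul_mem_left _ hc'), mul_one]

lemma sum_finField_quad {k : Type*} [Field k] [Fintype k] (hchar : ringChar k ≠ 2) (F : k → ℂ)
    (hF : ∑ z, F z = 0) (c : k) (hc : c ≠ 0) :
    ∑ y, F (c * y ^ 2) = ((if IsSquare c then 1 else -1 : ℤ) : ℂ) * ∑ y, F (y ^ 2) := by
  have hcount : ∀ c : k, c ≠ 0 → ∑ y, F (c * y ^ 2) =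
      ∑ z, ((quadraticChar k (c⁻¹ * z) : ℤ) + 1 : ℂ) * F z := by
    intro c hc
    rw [← Finset.sum_fiberwise (s := Finset.univ) (g := fun y => c * y ^ 2)
      (f := fun y => F (c * y ^ 2))]
    apply Finset.sum_congr rfl
    intro z _
    have h7 := quadraticChar_card_sqrts hchar (c⁻¹ * z)
    have h8 : (Finset.univ.filter (fun y => c * y ^ 2 = z)) =
        {x : k | x ^ 2 = c⁻¹ * z}.toFinset := by
      ext y
      simp only [Finset.mem_filter, Finset.mem_univ, true_and, Set.mem_toFinset,
        Set.mem_ofPred_eq]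
      rw [eq_inv_mul_iff_mul_eq₀ hc]
    rw [Finset.sum_congr rfl (g := fun _ => F z) (by intro y hy; simp at hy; rw [hy]),
      Finset.sum_const, nsmul_eq_mul, h8]
    congr 1
    have : (((({x : k | x ^ 2 = c⁻¹ * z}.toFinset).card : ℤ)) : ℂ) =
      ((quadraticChar k (c⁻¹ * z) + 1 : ℤ) : ℂ) := by rw [h7]
    push_cast at this
    exact this
  have e1 := hcount c hc
  have e2 := hcount 1 one_ne_zero
  simp only [inv_one, one_mul] at e2
  rw [e1, e2]
  have hkey : ∀ s : ℤ, quadraticChar k c⁻¹ = s →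
      ∑ z, ((quadraticChar k (c⁻¹ * z) : ℤ) + 1 : ℂ) * F z =
      s * ∑ z, ((quadraticChar k z : ℤ) + 1 : ℂ) * F z := by
    intro s hs
    have h1 : ∑ z, ((quadraticChar k (c⁻¹ * z) : ℤ) + 1 : ℂ) * F z -
        s * ∑ z, ((quadraticChar k z : ℤ) + 1 : ℂ) * F z = (1 - s) * ∑ z, F z := by
      rw [Finset.mul_sum, ← Finset.sum_sub_distrib, Finset.mul_sum]
      apply Finset.sum_congr rfl
      intro z _
      rw [map_mul, hs]; push_cast; ring
    rw [hF, mul_zero] at h1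
    exact sub_eq_zero.mp h1
  apply hkey
  have hci : c⁻¹ ≠ 0 := inv_ne_zero hc
  have hiff : IsSquare c⁻¹ ↔ IsSquare c := by
    constructor
    · rintro ⟨s, hs⟩
      exact ⟨s⁻¹, by rw [← mul_inv, ← hs, inv_inv]⟩
    · rintro ⟨s, hs⟩
      exact ⟨s⁻¹, by rw [← mul_inv, ← hs]⟩
  rw [quadraticChar_apply, quadraticCharFun, if_neg hci]
  simp only [hiff]

lemma mean_quad_prime {𝔭 : Ideal (𝓞 K)} (hp : 𝔭.IsPrime) (h0 : 𝔭 ≠ ⊥) (h2 : (2 : 𝓞 K) ∉ 𝔭)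
    (ψ : AddChar (𝓞 K) ℂ) (hψ : HasConductor ψ 𝔭) (κ : 𝓞 K) (hκ : κ ∉ 𝔭) :
    mean (fun y : 𝓞 K => ψ (κ * y ^ 2)) = legSym 𝔭 κ * mean (fun y : 𝓞 K => ψ (y ^ 2)) := by
  let _ := resField 𝔭 hp h0
  let _ : Fintype (𝓞 K ⧸ 𝔭) := @Fintype.ofFinite _ (finite_quot h0)
  let π : 𝓞 K →+ (𝓞 K ⧸ 𝔭) := (Ideal.Quotient.mk 𝔭).toAddMonoidHom
  have hπ : Function.Surjective π := Ideal.Quotient.mk_surjective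
  let F : (𝓞 K ⧸ 𝔭) → ℂ := fun z => ψ (Function.surjInv hπ z)
  have hF : ∀ y, ψ y = F (Ideal.Quotient.mk 𝔭 y) := by
    intro y
    have h1 : π (Function.surjInv hπ (π y)) = π y := Function.surjInv_eq hπ _
    have h3 : y - Function.surjInv hπ (π y) ∈ 𝔭 := Ideal.Quotient.eq.mp h1.symm
    have h4 : y = Function.surjInv hπ (π y) + (y - Function.surjInv hπ (π y)) := by ring
    change ψ y = ψ (Function.surjInv hπ (π y))
    conv_lhs => rw [h4]
    rw [AddChar.map_add_eq_mul, hψ.eq_one h3, mul_one]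
  set k := Ideal.Quotient.mk 𝔭 κ with hk
  have hk0 : k ≠ 0 := by rwa [hk, Ne, Ideal.Quotient.eq_zero_iff_mem]
  rw [mean_eq_of_hom π hπ (fun z => F (k * z ^ 2)) _ (fun y => by rw [hF]; simp [π, hk]),
    mean_eq_of_hom π hπ (fun z => F (z ^ 2)) _ (fun y => by rw [hF]; simp [π]), legSym, ← hk,
    if_neg hk0]
  have hchar : ringChar (𝓞 K ⧸ 𝔭) ≠ 2 := by
    intro h
    apply h2
    rw [← Ideal.Quotient.eq_zero_iff_mem, map_ofNat]
    have := ringChar.Nat.cast_ringChar (R := 𝓞 K ⧸ 𝔭)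
    rw [h] at this
    simpa using this
  have hsum0 : ∑ z, F z = 0 := by
    obtain ⟨x, hx⟩ : ∃ x, ψ x ≠ 1 := by
      by_contra! hall
      have : (1 : 𝓞 K) ∈ 𝔭 := (hψ 1).mpr (fun x => hall _)
      exact hp.ne_top ((Ideal.eq_top_iff_one _).mpr this)
    have h5 : ∑ z, F z = ψ x * ∑ z, F z := by
      rw [Finset.mul_sum]
      refine (Equiv.sum_comp (Equiv.addRight (Ideal.Quotient.mk 𝔭 x)) F).symm.trans ?_
      apply Finset.sum_congr rfl
      intro z _
      obtain ⟨y, rfl⟩ := Ideal.Quotient.mk_surjective z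
      change F (Ideal.Quotient.mk 𝔭 y + Ideal.Quotient.mk 𝔭 x) = _
      rw [← map_add, ← hF, ← hF, AddChar.map_add_eq_mul, mul_comm]
    have : (1 - ψ x) * ∑ z, F z = 0 := by linear_combination h5
    rcases mul_eq_zero.mp this with h6 | h6
    · exact absurd (sub_eq_zero.mp h6).symm hx
    · exact h6
  have hgen := @sum_finField_quad (𝓞 K ⧸ 𝔭) (resField 𝔭 hp h0) _ hchar F hsum0 k hk0
  refine (congrArg (fun w => _ * w) hgen).trans ?_
  rw [mul_left_comm]
  congr!

lemma not_mem_of_odd {𝔟 𝔭 : Ideal (𝓞 K)} (hodd : OddIdeal 𝔟) (hle : 𝔟 ≤ 𝔭) (hp : 𝔭 ≠ ⊤) :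
    (2 : 𝓞 K) ∉ 𝔭 := by
  intro h
  apply hp
  rw [OddIdeal, Ideal.isCoprime_iff_sup_eq] at hodd
  rw [← top_le_iff, ← hodd]
  exact sup_le hle (by rwa [Ideal.span_singleton_le_iff_mem])

lemma not_mem_of_coprime {𝔟 𝔭 : Ideal (𝓞 K)} {κ : 𝓞 K} (hc : IsCoprime 𝔟 (Ideal.span {κ}))
    (hle : 𝔟 ≤ 𝔭) (hp : 𝔭 ≠ ⊤) : κ ∉ 𝔭 := by
  intro h
  apply hp
  rw [Ideal.isCoprime_iff_sup_eq] at hc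
  rw [← top_le_iff, ← hc]
  exact sup_le hle (by rwa [Ideal.span_singleton_le_iff_mem])

lemma mean_quad_sq {𝔭 𝔠 : Ideal (𝓞 K)} (hp : 𝔭.IsPrime) (h0 : 𝔭 ≠ ⊥) (hc : 𝔠 ≠ ⊥)
    (hodd : OddIdeal (𝔭 ^ 2 * 𝔠)) (ψ : AddChar (𝓞 K) ℂ) (hψ : HasConductor ψ (𝔭 ^ 2 * 𝔠)) :
    ∃ ψ' : AddChar (𝓞 K) ℂ, HasConductor ψ' 𝔠 ∧ ∃ C : ℂ, ∀ κ : 𝓞 K,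
      IsCoprime (𝔭 ^ 2 * 𝔠) (Ideal.span {κ}) →
      mean (fun y : 𝓞 K => ψ (κ * y ^ 2)) = C * mean (fun y : 𝓞 K => ψ' (κ * y ^ 2)) := by
  set 𝔟 := 𝔭 ^ 2 * 𝔠 with h𝔟
  have hb0 : 𝔟 ≠ ⊥ := mul_ne_zero (pow_ne_zero _ h0) hc
  have hbp : 𝔟 ≤ 𝔭 := Ideal.mul_le_left.trans (Ideal.pow_le_self two_ne_zero)
  obtain ⟨π, hπ⟩ := IsDedekindDomain.exists_sup_span_eq hbp hb0
  have hπp : π ∈ 𝔭 := by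
    rw [← hπ]; exact Ideal.mem_sup_right (Ideal.mem_span_singleton_self π)
  obtain ⟨𝔮, h𝔮⟩ := Ideal.dvd_iff_le.mpr ((Ideal.span_singleton_le_iff_mem _).mpr hπp)
  have hcop : IsCoprime 𝔠 𝔮 := by
    have h1 : 𝔭 * (𝔭 * 𝔠 ⊔ 𝔮) = 𝔭 * ⊤ := by
      rw [Ideal.mul_sup, ← h𝔮, ← mul_assoc, ← sq, hπ, Ideal.mul_top]
    have h2 := mul_left_cancel₀ h0 h1
    have h3 : IsCoprime (𝔭 * 𝔠) 𝔮 := Ideal.isCoprime_iff_sup_eq.mpr h2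
    exact h3.of_mul_left_right
  refine ⟨ψ.mulShift (π ^ 2), ?_, ((Submodule.toAddSubgroup 𝔭).index : ℂ)⁻¹, ?_⟩
  · intro z
    simp only [AddChar.mulShift_apply, ← mul_assoc]
    rw [← hψ]
    constructor
    · intro hz
      exact Ideal.mul_mem_mul (Ideal.pow_mem_pow hπp 2) hz
    · intro h
      rw [← Ideal.span_singleton_le_iff_mem, ← Ideal.dvd_iff_le,
          ← Ideal.span_singleton_mul_span_singleton,
        ← Ideal.span_singleton_pow, h𝔮, mul_pow, mul_assoc, h𝔟] at h
      have h2 := (mul_dvd_mul_iff_left (pow_ne_zero 2 h0)).mp h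
      have h3 := (hcop.pow_right (n := 2)).dvd_of_dvd_mul_left h2
      rwa [Ideal.dvd_iff_le, Ideal.span_singleton_le_iff_mem] at h3
  · intro κ hκ
    have h2p := not_mem_of_odd hodd hbp hp.ne_top
    have hκp := not_mem_of_coprime hκ hbp hp.ne_top
    have hfp : FinPeriodic (fun y : 𝓞 K => ψ (κ * y ^ 2)) :=
      finPeriodic_quad hb0 (fun z hz => hψ.eq_one hz) κ
    rw [mean_restrict hfp (Submodule.toAddSubgroup (𝔭 * 𝔠)) (Submodule.toAddSubgroup 𝔭)
      (finiteIndex_of_ne_bot h0)]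
    · congr 1
      let φ₁ : 𝓞 K →+ Submodule.toAddSubgroup 𝔭 :=
        (AddMonoidHom.mulLeft π).codRestrict (Submodule.toAddSubgroup 𝔭)
          (fun u => 𝔭.mul_mem_right u hπp)
      let φ₂ : Submodule.toAddSubgroup 𝔟 →+ Submodule.toAddSubgroup 𝔭 :=
        AddSubgroup.inclusion (show Submodule.toAddSubgroup 𝔟 ≤ Submodule.toAddSubgroup 𝔭 from hbp)
      refine (mean_add (f₁ := fun u => ψ (π ^ 2 * (κ * u ^ 2))) (f₂ := fun _ => 1)
        (hfp.comp (Submodule.toAddSubgroup 𝔭).subtype) φ₁ φ₂ ?_ ?_ ?_ ?_).trans ?_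
      · rintro ⟨g, hg⟩
        have hg' : g ∈ 𝔭 := hg
        rw [← hπ, sup_comm, Submodule.mem_sup] at hg'
        obtain ⟨y, hy, z, hz, rfl⟩ := hg'
        obtain ⟨u, rfl⟩ := Ideal.mem_span_singleton'.mp hy
        refine ⟨u, ⟨z, hz⟩, Subtype.ext ?_⟩
        change π * u + z = u * π + z
        ring
      · simp
      · rfl
      · rintro u ⟨w, hw⟩
        have hw' : w ∈ 𝔟 := hw
        change ψ (κ * (π * u + w) ^ 2) = ψ (π ^ 2 * (κ * u ^ 2)) * 1
        have : κ * (π * u + w) ^ 2 = π ^ 2 * (κ * u ^ 2) + (κ * (2 * π * u + w)) * w := by ring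
        rw [this, AddChar.map_add_eq_mul, hψ.eq_one (𝔟.mul_mem_left _ hw')]
      · rw [mean_one, mul_one]
        rfl
    · intro y hy x hx
      have hy' : y ∈ 𝔭 := hy
      have hx' : x ∈ 𝔭 * 𝔠 := hx
      have hxx : x ∈ 𝔭 := Ideal.mul_le_left hx'
      have h3 : (2 * y + x) * x ∈ 𝔟 := by
        rw [h𝔟, sq, mul_assoc]
        exact Ideal.mul_mem_mul (𝔭.add_mem (𝔭.mul_mem_left _ hy') hxx) hx'
      have : κ * (y + x) ^ 2 = κ * y ^ 2 + κ * ((2 * y + x) * x) := by ring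
      rw [this, AddChar.map_add_eq_mul, hψ.eq_one (𝔟.mul_mem_left _ h3), mul_one]
    · intro y hy
      have hy' : y ∉ 𝔭 := hy
      obtain ⟨x₀, hx₀, hne⟩ : ∃ x₀ ∈ 𝔭 * 𝔠, ψ (2 * κ * y * x₀) ≠ 1 := by
        by_contra! hall
        apply hy'
        have h3 : Ideal.span {2 * κ * y} * (𝔭 * 𝔠) ≤ 𝔟 := by
          rw [Ideal.span_singleton_mul_le_iff]
          intro z hz
          rw [hψ]
          intro x
          rw [mul_assoc]
          exact hall _ (Ideal.mul_mem_right _ _ hz)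
        rw [h𝔟, sq, mul_assoc 𝔭 𝔭, ← Ideal.dvd_iff_le,
          mul_dvd_mul_iff_right (mul_ne_zero h0 hc), Ideal.dvd_iff_le,
          Ideal.span_singleton_le_iff_mem] at h3
        rcases hp.mem_or_mem h3 with h4 | h4
        · rcases hp.mem_or_mem h4 with h5 | h5
          · exact absurd h5 h2p
          · exact absurd h5 hκp
        · exact h4
      refine ⟨x₀, hx₀, _, hne, ?_⟩
      intro x hx
      have hx' : x ∈ 𝔭 * 𝔠 := hx
      have hx0p : x₀ ∈ 𝔭 := Ideal.mul_le_left hx₀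
      have h3 : x₀ * (2 * x + x₀) ∈ 𝔟 := by
        rw [h𝔟, sq, mul_assoc]
        exact Ideal.mul_mem_mul hx0p ((𝔭 * 𝔠).add_mem ((𝔭 * 𝔠).mul_mem_left _ hx') hx₀)
      have : κ * (y + x + x₀) ^ 2 = 2 * κ * y * x₀ + κ * (y + x) ^ 2 + κ * (x₀ * (2 * x +
          x₀)) := by ring
      rw [this, AddChar.map_add_eq_mul, AddChar.map_add_eq_mul, hψ.eq_one (𝔟.mul_mem_left _ h3),
          mul_one]

/-- The mean of a quadratic exponential splits along a decomposition `1 = e₁ + e₂`. -/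
lemma mean_quad_split (ψ : AddChar (𝓞 K) ℂ) {𝔟 : Ideal (𝓞 K)} (hb : 𝔟 ≠ ⊥)
    (hψ : ∀ z ∈ 𝔟, ψ z = 1) {e₁ e₂ : 𝓞 K} (he : e₁ + e₂ = 1) (hmul : ∀ z, ψ (2 * e₁ * e₂ * z) = 1)
    (κ : 𝓞 K) :
    mean (fun y : 𝓞 K => ψ (κ * y ^ 2)) =
      mean (fun y : 𝓞 K => ψ.mulShift (e₁ ^ 2) (κ * y ^ 2)) *
      mean (fun y : 𝓞 K => ψ.mulShift (e₂ ^ 2) (κ * y ^ 2)) := by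
  refine mean_add (finPeriodic_quad hb hψ κ) (AddMonoidHom.mulLeft e₁) (AddMonoidHom.mulLeft e₂)
    ?_ (by simp) (by simp) ?_
  · intro g
    exact ⟨g, g, by simp [← add_mul, he]⟩
  · intro a b
    simp only [AddMonoidHom.coe_mulLeft, AddChar.mulShift_apply]
    have : κ * (e₁ * a + e₂ * b) ^ 2 = e₁ ^ 2 * (κ * a ^ 2) + e₂ ^ 2 * (κ * b ^ 2) + 2 * e₁ * e₂ *
        (κ * a * b) := by ring
    rw [this, AddChar.map_add_eq_mul, AddChar.map_add_eq_mul, hmul, mul_one]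

lemma HasConductor.mulShift_sq {ψ : AddChar (𝓞 K) ℂ} {𝔞 𝔟 : Ideal (𝓞 K)} (hψ : HasConductor ψ (𝔞 *
    𝔟))
    {e₁ e₂ : 𝓞 K} (he : e₁ + e₂ = 1) (h₁ : e₁ ∈ 𝔟) (h₂ : e₂ ∈ 𝔞) :
    HasConductor (ψ.mulShift (e₁ ^ 2)) 𝔞 := by
  intro z
  simp only [AddChar.mulShift_apply, ← mul_assoc]
  rw [← hψ]
  constructor
  · intro hz
    have : e₁ ^ 2 * z = z * e₁ * e₁ := by ring
    rw [this]
    exact Ideal.mul_mem_right _ _ (Ideal.mul_mem_mul hz h₁)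
  · intro h
    have h3 : e₁ ^ 2 * z ∈ 𝔞 := Ideal.mul_le_left h
    have : z = e₁ ^ 2 * z + (e₁ + 1) * z * e₂ := by
      have : e₂ = 1 - e₁ := by linear_combination he
      rw [this]; ring
    rw [this]
    exact 𝔞.add_mem h3 (𝔞.mul_mem_left _ h₂)

theorem mean_quad_eq {𝔟 : Ideal (𝓞 K)} (hb : 𝔟 ≠ ⊥) (hodd : OddIdeal 𝔟) (ψ : AddChar (𝓞 K) ℂ)
    (hψ : HasConductor ψ 𝔟) (κ : 𝓞 K) (hκ : IsCoprime 𝔟 (Ideal.span {κ})) :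
    mean (fun y : 𝓞 K => ψ (κ * y ^ 2)) = quadSym 𝔟 κ * mean (fun y : 𝓞 K => ψ (y ^ 2)) := by
  induction hN : Ideal.absNorm 𝔟 using Nat.strong_induction_on generalizing 𝔟 ψ with
  | _ N ih =>
  subst hN
  by_cases htop : 𝔟 = ⊤
  · subst htop
    have : ∀ z, ψ z = 1 := fun z => hψ.eq_one trivial
    simp [this]
  obtain ⟨𝔭, hm, hle⟩ := Ideal.exists_le_maximal 𝔟 htop
  have hp := hm.isPrime
  have hp0 : 𝔭 ≠ ⊥ := by rintro rfl; exact hb (le_bot_iff.mp hle)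
  obtain ⟨𝔞, rfl⟩ := Ideal.dvd_iff_le.mpr hle
  have ha0 : 𝔞 ≠ ⊥ := by rintro rfl; exact hb (by simp)
  have hNp : 1 < Ideal.absNorm 𝔭 := by
    have h1 : Ideal.absNorm 𝔭 ≠ 0 := by rwa [Ne, Ideal.absNorm_eq_zero_iff]
    have h2 : Ideal.absNorm 𝔭 ≠ 1 := by rw [Ne, Ideal.absNorm_eq_one_iff]; exact hp.ne_top
    omega
  have hone : ∀ ψ : AddChar (𝓞 K) ℂ, mean (fun y : 𝓞 K => ψ (y ^ 2)) =
      mean (fun y : 𝓞 K => ψ (1 * y ^ 2)) := by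
    intro ψ; simp
  have hone' : IsCoprime (𝔭 * 𝔞) (Ideal.span {(1 : 𝓞 K)}) := by
    rw [Ideal.span_singleton_one, ← Ideal.one_eq_top]; exact isCoprime_one_right
  by_cases h2 : 𝔞 ≤ 𝔭
  · obtain ⟨𝔠, rfl⟩ := Ideal.dvd_iff_le.mpr h2
    rw [← mul_assoc, ← sq] at *
    have hc0 : 𝔠 ≠ ⊥ := by rintro rfl; exact hb (by simp)
    obtain ⟨ψ', hψ', C, hC⟩ := mean_quad_sq hp hp0 hc0 hodd ψ hψ
    rw [hC κ hκ, hone, hC 1 hone']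
    have hlt : Ideal.absNorm 𝔠 < Ideal.absNorm (𝔭 ^ 2 * 𝔠) := by
      rw [map_mul, map_pow]
      have h1 : Ideal.absNorm 𝔠 ≠ 0 := by rwa [Ne, Ideal.absNorm_eq_zero_iff]
      exact lt_mul_of_one_lt_left (Nat.pos_of_ne_zero h1) (Nat.one_lt_pow two_ne_zero hNp)
    rw [ih _ hlt hc0 (IsCoprime.of_mul_left_right hodd) ψ' hψ' hκ.of_mul_left_right rfl,
      quadSym_mul_ideal (pow_ne_zero _ hp0) hc0, sq, quadSym_mul_ideal hp0 hp0]
    have h5 := (quadSym_ne_zero_iff hp0).mpr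
      ((IsCoprime.of_mul_left_left hκ).of_isCoprime_of_dvd_left (dvd_pow_self 𝔭 two_ne_zero))
    rw [← hone]
    rcases quadSym_trichotomy 𝔭 κ with h | h | h
    · contradiction
    · rw [h]; push_cast; ring
    · rw [h]; push_cast; ring
  · have hcop : IsCoprime 𝔭 𝔞 := by
      rw [Ideal.isCoprime_iff_sup_eq]
      exact hm.out.2 _ (left_lt_sup.mpr h2)
    obtain ⟨e₂, h₂, e₁, h₁, he⟩ := Ideal.isCoprime_iff_exists.mp hcop
    have he' : e₁ + e₂ = 1 := by rw [add_comm]; exact he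
    have hs := mean_quad_split ψ hb (fun z hz => hψ.eq_one hz) he' (by
      intro z
      apply hψ.eq_one
      have : 2 * e₁ * e₂ * z = (2 * z) * (e₂ * e₁) := by ring
      rw [this]
      exact Ideal.mul_mem_left _ _ (Ideal.mul_mem_mul h₂ h₁))
    have hψ1 : HasConductor (ψ.mulShift (e₁ ^ 2)) 𝔭 := hψ.mulShift_sq he' h₁ h₂
    have hψ2 : HasConductor (ψ.mulShift (e₂ ^ 2)) 𝔞 := by
      rw [mul_comm] at hψ
      exact hψ.mulShift_sq he h₂ h₁
    have hlt : Ideal.absNorm 𝔞 < Ideal.absNorm (𝔭 * 𝔞) := by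
      rw [map_mul]
      have h1 : Ideal.absNorm 𝔞 ≠ 0 := by rwa [Ne, Ideal.absNorm_eq_zero_iff]
      exact lt_mul_of_one_lt_left (Nat.pos_of_ne_zero h1) hNp
    rw [hs, hone, hs, ← hone, ← hone, mean_quad_prime hp hp0 (not_mem_of_odd hodd hle hp.ne_top) _ hψ1 κ
      (not_mem_of_coprime hκ hle hp.ne_top),
      ih _ hlt ha0 (IsCoprime.of_mul_left_right hodd) _ hψ2 hκ.of_mul_left_right rfl,
      quadSym_mul_ideal hp0 ha0, quadSym_prime hp hp0]
    push_cast
    ring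

end QuadraticMean

section WeilPhase

/-- The standard additive character `x ↦ exp(2πi Tr x)` of a number field. -/
def trChar : AddChar K ℂ where
  toFun x := eexp ((Algebra.trace ℚ K x : ℚ) : ℝ)
  map_zero_eq_one' := by simp
  map_add_eq_mul' x y := by rw [map_add, Rat.cast_add, eexp_add]

lemma trChar_apply (x : K) : trChar x = eexp ((Algebra.trace ℚ K x : ℚ) : ℝ) := rfl

lemma trChar_eq_one_iff {x : K} : trChar x = 1 ↔ ∃ m : ℤ, Algebra.trace ℚ K x = m := by
  rw [trChar_apply, eexp_eq_one_iff]
  constructor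
  · rintro ⟨m, hm⟩; exact ⟨m, by exact_mod_cast hm⟩
  · rintro ⟨m, hm⟩; exact ⟨m, by rw [hm]; norm_cast⟩

/-- The elements `y` with `Tr(θ y x) ∈ ℤ` for all integral `x`. -/
def dualGrp (θ : K) : AddSubgroup K where
  carrier := {y | ∀ x : 𝓞 K, trChar (θ * y * (x : K)) = 1}
  zero_mem' := by intro x; simp
  add_mem' := by
    intro a b ha hb x
    rw [mul_add, add_mul, AddChar.map_add_eq_mul, ha, hb, mul_one]
  neg_mem' := by
    intro a ha x
    rw [mul_neg, neg_mul, AddChar.map_neg_eq_inv, ha, inv_one]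

lemma mem_dualGrp {θ y : K} : y ∈ dualGrp θ ↔ ∀ x : 𝓞 K, trChar (θ * y * (x : K)) = 1 := Iff.rfl

lemma exists_orthogonal_integral_basis {ω : K} (hω : ω ≠ 0)
    (hint : ∀ x y : 𝓞 K, trChar (ω * x * (y : K)) = 1) :
    ∃ (e : Module.Basis (Fin (Module.finrank ℚ K)) ℚ K) (a : Fin (Module.finrank ℚ K) → ℤ),
      (∀ i, a i ≠ 0) ∧ (∀ i, ∃ x : 𝓞 K, e i = x) ∧
      ∀ i j, Algebra.trace ℚ K (ω * e i * e j) = if i = j then (a i : ℚ) else 0 := by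
  let B : LinearMap.BilinForm ℚ K :=
    (Algebra.traceForm ℚ K).comp (LinearMap.mulLeft ℚ ω) LinearMap.id
  have hB : ∀ x y, B x y = Algebra.trace ℚ K (ω * x * y) := fun x y => rfl
  have hsymm : LinearMap.IsSymm B := by
    refine ⟨fun x y => ?_⟩
    change B x y = B y x
    rw [hB, hB, mul_right_comm]
  have : Invertible (2 : ℚ) := invertibleOfNonzero two_ne_zero
  obtain ⟨v, hv⟩ := LinearMap.BilinForm.exists_orthogonal_basis (B := B) hsymm
  have hmul : ∀ i, ∃ m : ℤ, m ≠ 0 ∧ ∃ x : 𝓞 K, (m : K) * v i = x := by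
    intro i
    have halg : IsAlgebraic ℤ (v i) := by
      rw [IsFractionRing.isAlgebraic_iff ℤ ℚ K]
      exact Algebra.IsAlgebraic.isAlgebraic _
    obtain ⟨m, hm, hmi⟩ := halg.exists_integral_multiple
    exact ⟨m, hm, ⟨_, hmi⟩, by simp [zsmul_eq_mul]⟩
  choose m hm x hx using hmul
  let e := v.isUnitSMul (w := fun i => (m i : ℚ)) (fun i => (Int.cast_ne_zero.mpr (hm i)).isUnit)
  have he : ∀ i, e i = x i := by
    intro i
    rw [Module.Basis.isUnitSMul_apply, ← hx, Algebra.smul_def]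
    simp
  have hsq : ∀ i, ∃ a : ℤ, Algebra.trace ℚ K (ω * e i * e i) = a := by
    intro i
    rw [he]
    exact trChar_eq_one_iff.mp (hint _ _)
  choose a ha using hsq
  have horth : ∀ i j, i ≠ j → B (e i) (e j) = 0 := by
    intro i j hij
    have : B (v i) (v j) = 0 := hv hij
    rw [Module.Basis.isUnitSMul_apply, Module.Basis.isUnitSMul_apply, map_smul, map_smul,
      LinearMap.smul_apply, this, smul_zero, smul_zero]
  refine ⟨e, a, ?_, fun i => ⟨x i, he i⟩, ?_⟩
  · intro i hi
    have h0 : ∀ y, B (e i) y = 0 := by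
      have : B (e i) = 0 := by
        apply e.ext
        intro j
        by_cases hij : i = j
        · subst hij
          rw [hB, ha, hi]; simp
        · rw [horth i j hij]; rfl
      intro y; rw [this]; rfl
    have := (traceForm_nondegenerate ℚ K).1 (ω * e i) h0
    rcases mul_eq_zero.mp this with h | h
    · exact hω h
    · exact e.ne_zero i h
  · intro i j
    split_ifs with h
    · subst h; exact ha i
    · exact horth i j h

lemma mean_int_eq (g : ℤ → ℂ) (m : ℕ) (hm : 0 < m) (hg : ∀ k l : ℤ, g (k + m * l) = g k) :
    ∃ F : ZMod m → ℂ, (∀ k : ℤ, g k = F k) ∧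
      letI : NeZero m := ⟨hm.ne'⟩
      ∑ z, F z = ∑ k ∈ Finset.range m, g k := by
  obtain ⟨m, rfl⟩ := Nat.exists_eq_succ_of_ne_zero hm.ne'
  refine ⟨fun z => g (z.val : ℤ), ?_, ?_⟩
  · intro k
    simp only [ZMod.val_intCast]
    conv_lhs => rw [← Int.emod_add_mul_ediv k ((m + 1 : ℕ) : ℤ)]
    exact hg _ _
  · exact Fin.sum_univ_eq_sum_range (fun k => g (k : ℤ)) (m + 1)

/-- The sign factor `1 ± i`. -/
def phase (p : Prop) : ℂ := if p then 1 + Complex.I else 1 - Complex.I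

lemma phase_ne_zero (p : Prop) : phase p ≠ 0 := by
  rw [phase]
  split_ifs <;> · intro h; simpa using congrArg Complex.re h

lemma gauss_int (a : ℤ) (N : ℕ) (hN : 0 < N) (haN : a = N ∨ a = -N) :
    ∃ (F : ZMod (2 * N) → ℂ),
      (∀ k : ℤ, eexp ((k : ℝ) ^ 2 / (4 * a)) = F k) ∧
      letI : NeZero (2 * N) := ⟨by omega⟩
      ∃ c : ℝ, 0 < c ∧ ∑ z, F z = c * phase (0 < a) := by
  have hN' : (N : ℝ) ≠ 0 := by exact_mod_cast hN.ne'
  obtain ⟨F, hF, hsum⟩ := mean_int_eq (fun k => eexp ((k : ℝ) ^ 2 / (4 * a))) (2 * N)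
    (by omega) (by
      intro k l
      obtain ⟨s, hs⟩ : ∃ s : ℤ, ((k + (2 * N : ℕ) * l : ℤ) : ℝ) ^ 2 / (4 * a) =
          (k : ℝ) ^ 2 / (4 * a) + (s : ℝ) := by
        rcases haN with h | h
        · refine ⟨k * l + N * l ^ 2, ?_⟩
          rw [h]; push_cast; field_simp; ring
        · refine ⟨-(k * l + N * l ^ 2), ?_⟩
          rw [h]; push_cast; field_simp; ring
      rw [hs, eexp_add_int])
  refine ⟨F, hF, ?_⟩
  obtain ⟨c, hc, hgs⟩ := gaussOne_phase N hN
  refine ⟨c, hc, ?_⟩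
  rw [hsum, phase]
  rcases haN with h | h
  · rw [if_pos (by omega), ← hgs, gaussOne]
    apply Finset.sum_congr rfl
    intro k _
    rw [h]; push_cast; rfl
  · rw [if_neg (by omega)]
    have h1 : (c : ℂ) * (1 - Complex.I) = (starRingEnd ℂ) (c * (1 + Complex.I)) := by
      simp [sub_eq_add_neg]
    rw [h1, ← hgs, gaussOne, map_sum]
    apply Finset.sum_congr rfl
    intro k _
    rw [conj_eexp, h]; congr 1; push_cast; ring

/-- The coordinates of the dual lattice `⊕ ℤ e_i / (2 a_i)`. -/
def latHom {ι : Type*} [Fintype ι] (e : ι → K) (a : ι → ℤ) : (ι → ℤ) →+ K where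
  toFun k := ∑ i, ((k i : ℚ) / (2 * a i)) • e i
  map_zero' := by simp
  map_add' k l := by
    rw [← Finset.sum_add_distrib]
    refine Finset.sum_congr rfl fun i _ => ?_
    rw [← add_smul]; congr 1; push_cast [Pi.add_apply]; ring

/-- The quadratic Gauss mean attached to `ω`. -/
def gaussMean (ω : K) : ℂ := mean (fun y : dualGrp (2 * ω) => trChar (ω * (y : K) ^ 2))

lemma gaussMean_eq {ω : K} (hint : ∀ x y : 𝓞 K, trChar (ω * x * (y : K)) = 1)
    {ι : Type} [Fintype ι] [DecidableEq ι] (e : Module.Basis ι ℚ K) (a : ι → ℤ)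
    (ha : ∀ i, a i ≠ 0) (he : ∀ i, ∃ x : 𝓞 K, e i = x)
    (hB : ∀ i j, Algebra.trace ℚ K (ω * e i * e j) = if i = j then (a i : ℚ) else 0) :
    FinPeriodic (fun y : dualGrp (2 * ω) => trChar (ω * (y : K) ^ 2)) ∧
    ∃ c : ℝ, 0 < c ∧ gaussMean ω = c * ∏ i, phase (0 < a i) := by
  have haQ : ∀ i, (a i : ℚ) ≠ 0 := fun i => by exact_mod_cast ha i
  have hN : ∀ i, 0 < (a i).natAbs := fun i => Int.natAbs_pos.mpr (ha i)
  choose F hF c hc hFc using fun i => gauss_int (a i) _ (hN i) (Int.natAbs_eq (a i))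
  have hnz : ∀ i, NeZero (2 * (a i).natAbs) := fun i => ⟨by have := hN i; omega⟩
  set Φ := latHom (fun i => e i) a with hΦ
  have hΦapp : ∀ k, Φ k = ∑ i, ((k i : ℚ) / (2 * a i)) • e i := fun k => rfl
  have htr : ∀ k j, Algebra.trace ℚ K (ω * Φ k * e j) = (k j : ℚ) / 2 := by
    intro k j
    rw [hΦapp, Finset.mul_sum, Finset.sum_mul, map_sum]
    rw [Finset.sum_eq_single j]
    · rw [mul_smul_comm, smul_mul_assoc, map_smul, hB, if_pos rfl, smul_eq_mul]
      field_simp [haQ j]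
    · intro i _ hij
      rw [mul_smul_comm, smul_mul_assoc, map_smul, hB, if_neg hij, smul_zero]
    · simp
  have hsq : ∀ k, Algebra.trace ℚ K (ω * Φ k ^ 2) = ∑ i, (k i : ℚ) ^ 2 / (4 * a i) := by
    intro k
    have : ω * Φ k ^ 2 = ∑ i, ((k i : ℚ) / (2 * a i)) • (ω * Φ k * e i) := by
      rw [sq, ← mul_assoc]
      conv_lhs => enter [2]; rw [hΦapp k]
      rw [Finset.mul_sum]
      exact Finset.sum_congr rfl fun i _ => mul_smul_comm _ _ _
    rw [this, map_sum]
    refine Finset.sum_congr rfl fun i _ => ?_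
    rw [map_smul, htr, smul_eq_mul]
    field_simp [haQ i]
    ring
  set f : (ι → ℤ) → ℂ := fun k => trChar (ω * Φ k ^ 2) with hf
  have hfprod : ∀ k, f k = ∏ i, F i (k i : ZMod _) := by
    intro k
    rw [hf]; simp only
    rw [trChar_apply, hsq]
    have hsum : ∀ s : Finset ι, eexp ((∑ i ∈ s, (k i : ℚ) ^ 2 / (4 * a i) : ℚ) : ℝ) =
        ∏ i ∈ s, eexp ((k i : ℝ) ^ 2 / (4 * a i)) := by
      intro s
      induction s using Finset.induction_on with
      | empty => simp
      | insert i s hi ih =>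
        rw [Finset.sum_insert hi, Finset.prod_insert hi, Rat.cast_add, eexp_add, ih]
        congr 2; push_cast; rfl
    rw [hsum]
    exact Finset.prod_congr rfl fun i _ => hF i (k i)
  let π : (ι → ℤ) →+ (∀ i, ZMod (2 * (a i).natAbs)) :=
    { toFun := fun k i => (k i : ZMod _)
      map_zero' := by ext; simp
      map_add' := by intros; ext; simp }
  have hπ : Function.Surjective π := by
    intro z
    refine ⟨fun i => (z i).cast, ?_⟩
    ext i
    change (((z i).cast : ℤ) : ZMod _) = z i
    exact ZMod.intCast_zmod_cast _
  have hmean : ∃ c : ℝ, 0 < c ∧ mean f = c * ∏ i, phase (0 < a i) := by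
    refine ⟨(Fintype.card (∀ i, ZMod (2 * (a i).natAbs)) : ℝ)⁻¹ * ∏ i, c i, ?_, ?_⟩
    · exact mul_pos (inv_pos.mpr (by exact_mod_cast Fintype.card_pos))
        (Finset.prod_pos fun i _ => hc i)
    · rw [mean_eq_of_hom π hπ (fun z => ∏ i, F i (z i)) f hfprod]
      push_cast
      rw [mul_assoc, ← Finset.prod_mul_distrib]
      congr 1
      rw [← Finset.prod_congr rfl (fun i _ => hFc i), Finset.prod_univ_sum, Fintype.piFinset_univ]
  have hfp : FinPeriodic f := by
    refine ⟨π.ker, ?_, ?_⟩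
    · have : Finite ((ι → ℤ) ⧸ π.ker) :=
          Finite.of_injective _ (QuotientAddGroup.kerLift_injective π)
      exact AddSubgroup.finiteIndex_of_finite_quotient
    · intro k l hl
      have hl' : π l = 0 := hl
      have h2 : ∀ i, ((l i : ℤ) : ZMod (2 * (a i).natAbs)) = 0 := fun i => congrFun hl' i
      rw [hfprod, hfprod]
      refine Finset.prod_congr rfl fun i _ => ?_
      rw [Pi.add_apply, Int.cast_add, h2, add_zero]
  have hO : ∀ x : 𝓞 K, (x : K) ∈ dualGrp (2 * ω) := by
    intro x z
    rw [show 2 * ω * (x : K) * z = ω * x * z + ω * x * z by ring, AddChar.map_add_eq_mul, hint,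
      mul_one]
  have hlat : ∀ y ∈ dualGrp (2 * ω), ∃ k, Φ k = y := by
    intro y hy
    have h1 : ∀ i, ∃ m : ℤ, Algebra.trace ℚ K (2 * ω * y * e i) = m := by
      intro i
      obtain ⟨x, hx⟩ := he i
      rw [hx]
      exact trChar_eq_one_iff.mp (hy x)
    choose k hk using h1
    refine ⟨k, ?_⟩
    rw [hΦapp]
    conv_rhs => rw [← e.sum_repr y]
    refine Finset.sum_congr rfl fun i _ => ?_
    congr 1
    have h2 : Algebra.trace ℚ K (2 * ω * y * e i) = 2 * a i * e.repr y i := by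
      conv_lhs => rw [← e.sum_repr y]
      rw [Finset.mul_sum, Finset.sum_mul, map_sum, Finset.sum_eq_single i]
      · rw [mul_smul_comm, smul_mul_assoc, map_smul,
          show 2 * ω * e i * e i = (2 : ℚ) • (ω * e i * e i) by rw [Algebra.smul_def]; simp; ring,
          map_smul, hB, if_pos rfl, smul_eq_mul, smul_eq_mul]
        ring
      · intro j _ hj
        rw [mul_smul_comm, smul_mul_assoc, map_smul,
          show 2 * ω * e j * e i = (2 : ℚ) • (ω * e j * e i) by rw [Algebra.smul_def]; simp; ring,
          map_smul, hB, if_neg hj, smul_zero, smul_zero]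
      · simp
    rw [hk] at h2
    rw [h2]
    field_simp [haQ i]
  have hker : π.ker ≤ (dualGrp (2 * ω)).comap Φ := by
    intro k hk
    have hk' : π k = 0 := hk
    have h1 : ∀ i, ∃ m : ℤ, k i = 2 * a i * m := by
      intro i
      have h2 : ((k i : ℤ) : ZMod (2 * (a i).natAbs)) = 0 := congrFun hk' i
      rw [ZMod.intCast_zmod_eq_zero_iff_dvd] at h2
      have h3 : (2 * a i) ∣ k i := by
        rw [← Int.natAbs_dvd, Int.natAbs_mul]; exact h2
      exact h3
    choose m hm using h1
    choose x hx using he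
    have : Φ k = ((∑ i, (m i : 𝓞 K) * x i : 𝓞 K) : K) := by
      rw [hΦapp, RingOfIntegers.coe_eq_algebraMap, map_sum]
      refine Finset.sum_congr rfl fun i _ => ?_
      rw [hm, hx, Algebra.smul_def]
      have : (((2 * a i * m i : ℤ) : ℚ) / (2 * a i)) = m i := by
        push_cast; field_simp [haQ i]
      rw [this]; simp
    rw [AddSubgroup.mem_comap, this]
    exact hO _
  let T : AddSubgroup (ι → ℤ) := (dualGrp (2 * ω)).comap Φ
  let S : AddSubgroup (ι → ℤ) := (algebraMap (𝓞 K) K).toAddMonoidHom.range.comap Φ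
  have hTfin : T.FiniteIndex := by
    have : Finite ((ι → ℤ) ⧸ π.ker) := Finite.of_injective _ (QuotientAddGroup.kerLift_injective π)
    have : π.ker.FiniteIndex := AddSubgroup.finiteIndex_of_finite_quotient
    exact AddSubgroup.finiteIndex_of_le hker
  have hexp : ∀ (y : K) (x : 𝓞 K), trChar (ω * (y + x) ^ 2) =
      trChar (ω * y ^ 2) * trChar (2 * ω * y * x) := by
    intro y x
    rw [show ω * (y + x) ^ 2 = ω * y ^ 2 + 2 * ω * y * x + ω * x * x by ring,
      AddChar.map_add_eq_mul, AddChar.map_add_eq_mul, hint, mul_one]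
  have hres := mean_restrict hfp S T hTfin (by
      rintro k hk l ⟨x, hx⟩
      have hx' : Φ l = (x : K) := hx.symm
      simp only [hf]
      rw [map_add, hx', hexp, (show Φ k ∈ dualGrp (2 * ω) from hk) x, mul_one]) (by
      intro k hk
      have hk' : ¬ (Φ k ∈ dualGrp (2 * ω)) := hk
      rw [mem_dualGrp] at hk'
      push Not at hk'
      obtain ⟨x, hx⟩ := hk'
      obtain ⟨l, hl⟩ := hlat _ (hO x)
      refine ⟨l, ⟨x, hl.symm⟩, _, hx, ?_⟩
      rintro j ⟨z, hz⟩
      have hz' : Φ j = (z : K) := hz.symm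
      simp only [hf]
      rw [map_add Φ (k + j), hl, hexp, map_add, hz', mul_comm, mul_add, add_mul,
        AddChar.map_add_eq_mul _ (2 * ω * Φ k * x), hO z x, mul_one])
  let ΦT : T →+ dualGrp (2 * ω) :=
    (Φ.comp T.subtype).codRestrict (dualGrp (2 * ω)) (fun k => k.2)
  have hsurjT : Function.Surjective ΦT := by
    rintro ⟨y, hy⟩
    obtain ⟨k, rfl⟩ := hlat y hy
    exact ⟨⟨k, hy⟩, rfl⟩
  have hinj : Function.Injective Φ := by
    rw [injective_iff_map_eq_zero]
    intro k hk
    ext j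
    have := htr k j
    rw [hk, mul_zero, zero_mul, map_zero] at this
    have h2 : (k j : ℚ) = 0 := by linarith
    exact_mod_cast h2
  have hinjT : Function.Injective ΦT := by
    intro x y hxy
    exact Subtype.ext (hinj (congrArg Subtype.val hxy))
  let eT := AddEquiv.ofBijective ΦT ⟨hinjT, hsurjT⟩
  have hfpJ : FinPeriodic (fun y : dualGrp (2 * ω) => trChar (ω * (y : K) ^ 2)) := by
    have h1 := hfp.comp (T.subtype.comp eT.symm.toAddMonoidHom)
    convert h1 using 1
    funext y
    have h2 : ΦT (eT.symm y) = y := eT.apply_symm_apply y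
    have h3 : Φ (eT.symm y : ι → ℤ) = y := congrArg Subtype.val h2
    change _ = trChar (ω * Φ (eT.symm y : ι → ℤ) ^ 2)
    rw [h3]
  refine ⟨hfpJ, ?_⟩
  obtain ⟨c', hc', hcm⟩ := hmean
  have hcomp : mean (fun y : T => f y) = gaussMean ω := mean_comp_surj hfpJ ΦT hsurjT
  rw [hcomp, hcm] at hres
  have hTi : T.index ≠ 0 := hTfin.index_ne_zero
  refine ⟨T.index * c', mul_pos (by exact_mod_cast Nat.pos_of_ne_zero hTi) hc', ?_⟩
  have hTi' : (T.index : ℂ) ≠ 0 := by exact_mod_cast hTi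
  push_cast
  rw [mul_assoc, hres, mul_inv_cancel_left₀ hTi']

/-- The sign of `y ↦ Tr(ω y²)` is determined by the signs of the conjugates of `ω`. -/
lemma card_pos_eq [IsGalois ℚ K] (ι : K →+* ℝ) {ω : K}
    {κ : Type} [Fintype κ] [DecidableEq κ] (e : Module.Basis κ ℚ K) (a : κ → ℤ) (ha : ∀ i, a i ≠ 0)
    (hB : ∀ i j, Algebra.trace ℚ K (ω * e i * e j) = if i = j then (a i : ℚ) else 0) :
    {i | 0 < a i}.ncard = {τ : K ≃ₐ[ℚ] K | 0 < ι (τ ω)}.ncard := by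
  have htr : ∀ x : K, ∑ τ : K ≃ₐ[ℚ] K, ι (τ x) = (Algebra.trace ℚ K x : ℚ) := by
    intro x
    rw [← map_sum, ← trace_eq_sum_automorphisms, eq_ratCast, map_ratCast]
  let L : (κ → ℝ) →ₗ[ℝ] ((K ≃ₐ[ℚ] K) → ℝ) :=
    { toFun := fun c τ => ∑ i, c i * ι (τ (e i))
      map_add' := by intro x y; ext τ; simp [add_mul, Finset.sum_add_distrib]
      map_smul' := by intro r x; ext τ; simp [Finset.mul_sum, mul_assoc] }
  have hL : ∀ c τ, L c τ = ∑ i, c i * ι (τ (e i)) := fun c τ => rfl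
  have hform : ∀ c j, ∑ τ, ι (τ (ω * e j)) * L c τ = c j * a j := by
    intro c j
    simp only [hL, Finset.mul_sum]
    rw [Finset.sum_comm, Finset.sum_eq_single j]
    · have := htr (ω * e j * e j)
      rw [hB, if_pos rfl] at this
      rw [Rat.cast_intCast] at this
      rw [← this, Finset.mul_sum]
      refine Finset.sum_congr rfl fun τ _ => ?_
      rw [map_mul τ (ω * e j), map_mul ι (τ (ω * e j))]; ring
    · intro i _ hij
      have := htr (ω * e j * e i)
      rw [hB, if_neg hij.symm, Rat.cast_zero] at this
      rw [← mul_zero (c i), ← this, Finset.mul_sum]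
      refine Finset.sum_congr rfl fun τ _ => ?_
      rw [map_mul τ (ω * e j), map_mul ι (τ (ω * e j))]; ring
    · simp
  have hinj : Function.Injective L := by
    rw [injective_iff_map_eq_zero]
    intro c hc
    ext j
    have := hform c j
    rw [hc] at this
    simp only [Pi.zero_apply, mul_zero, Finset.sum_const_zero] at this
    rcases mul_eq_zero.mp this.symm with h | h
    · exact h
    · exact absurd (by exact_mod_cast h) (ha j)
  have hdim : Module.finrank ℝ (κ → ℝ) = Module.finrank ℝ ((K ≃ₐ[ℚ] K) → ℝ) := by
    rw [Module.finrank_fintype_fun_eq_card, Module.finrank_fintype_fun_eq_card,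
      ← Module.finrank_eq_card_basis e, ← IsGalois.card_aut_eq_finrank ℚ K,
          Nat.card_eq_fintype_card]
  let L' : (κ → ℝ) ≃ₗ[ℝ] ((K ≃ₐ[ℚ] K) → ℝ) := LinearEquiv.ofInjectiveOfFinrankEq L hinj hdim
  have hL' : ∀ c, L' c = L c := fun c => rfl
  have hequiv : QuadraticMap.Equivalent
      (QuadraticMap.weightedSumSquares ℝ (fun i => (a i : ℝ)))
      (QuadraticMap.weightedSumSquares ℝ (fun τ : K ≃ₐ[ℚ] K => ι (τ ω))) := by
    refine ⟨⟨L', ?_⟩⟩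
    intro c
    change QuadraticMap.weightedSumSquares ℝ (fun τ : K ≃ₐ[ℚ] K => ι (τ ω)) (L c) = _
    rw [QuadraticMap.weightedSumSquares_apply, QuadraticMap.weightedSumSquares_apply]
    simp only [smul_eq_mul]
    have h1 : ∀ τ, ι (τ ω) * (L c τ * L c τ) = ∑ j, c j * (ι (τ (ω * e j)) * L c τ) := by
      intro τ
      rw [← mul_assoc]
      conv_lhs => enter [1]; rw [hL c τ, Finset.mul_sum]
      rw [Finset.sum_mul]
      refine Finset.sum_congr rfl fun j _ => ?_
      rw [map_mul τ, map_mul ι]; ring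
    rw [Finset.sum_congr rfl (fun τ _ => h1 τ), Finset.sum_comm]
    refine Finset.sum_congr rfl fun j _ => ?_
    rw [← Finset.mul_sum, hform]; ring
  have h := QuadraticForm.sigPos_of_equiv_weightedSumSquares hequiv
  rw [QuadraticForm.sigPos_weightedSumSquares] at h
  rw [← h]
  congr 1
  ext i
  simp

/-- Gauss means of elements with the same signs are positive multiples of each other. -/
theorem gaussMean_ratio [IsGalois ℚ K] (ι : K →+* ℝ) {ω ω' : K} (hω : ω ≠ 0) (hω' : ω' ≠ 0)
    (hint : ∀ x y : 𝓞 K, trChar (ω * x * (y : K)) = 1)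
    (hint' : ∀ x y : 𝓞 K, trChar (ω' * x * (y : K)) = 1)
    (hsign : ∀ τ : K ≃ₐ[ℚ] K, 0 < ι (τ ω) ↔ 0 < ι (τ ω')) :
    gaussMean ω' ≠ 0 ∧ ∃ c : ℝ, 0 < c ∧ gaussMean ω = c * gaussMean ω' := by
  obtain ⟨e, a, ha, he, hB⟩ := exists_orthogonal_integral_basis hω hint
  obtain ⟨e', a', ha', he', hB'⟩ := exists_orthogonal_integral_basis hω' hint'
  obtain ⟨-, c, hc, h⟩ := gaussMean_eq hint e a ha he hB
  obtain ⟨-, c', hc', h'⟩ := gaussMean_eq hint' e' a' ha' he' hB'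
  have hcard : {i | 0 < a i}.ncard = {i | 0 < a' i}.ncard := by
    rw [card_pos_eq ι e a ha hB, card_pos_eq ι e' a' ha' hB']
    simp only [hsign]
  have hprod : ∀ a : Fin (Module.finrank ℚ K) → ℤ, ∏ i, phase (0 < a i) =
      (1 + Complex.I) ^ {i | 0 < a i}.ncard *
      (1 - Complex.I) ^ (Module.finrank ℚ K - {i | 0 < a i}.ncard) := by
    intro a
    have h1 : (Finset.univ.filter (fun i => 0 < a i)).card = {i | 0 < a i}.ncard := by
      rw [Set.ncard_eq_toFinset_card']; congr 1; ext; simp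
    have h2 := Finset.card_filter_add_card_filter_not
      (s := (Finset.univ : Finset (Fin (Module.finrank ℚ K)))) (fun i => 0 < a i)
    rw [Finset.card_univ, Fintype.card_fin] at h2
    have h3 : ∏ i ∈ Finset.univ.filter (fun i => 0 < a i), phase (0 < a i) =
        (1 + Complex.I) ^ {i | 0 < a i}.ncard := by
      rw [← h1, ← Finset.prod_const]
      exact Finset.prod_congr rfl fun i hi => if_pos (Finset.mem_filter.mp hi).2
    have h4 : ∏ i ∈ Finset.univ.filter (fun i => ¬ 0 < a i), phase (0 < a i) =
        (1 - Complex.I) ^ (Module.finrank ℚ K - {i | 0 < a i}.ncard) := by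
      rw [show Module.finrank ℚ K - {i | 0 < a i}.ncard =
        (Finset.univ.filter (fun i => ¬ 0 < a i)).card by omega, ← Finset.prod_const]
      exact Finset.prod_congr rfl fun i hi => if_neg (Finset.mem_filter.mp hi).2
    rw [← Finset.prod_filter_mul_prod_filter_not Finset.univ (fun i => 0 < a i), h3, h4]
  have hne : ∏ i, phase (0 < a' i) ≠ 0 := Finset.prod_ne_zero_iff.mpr fun i _ => phase_ne_zero _
  have hcC : (c' : ℂ) ≠ 0 := by exact_mod_cast hc'.ne'
  refine ⟨by rw [h']; exact mul_ne_zero hcC hne, c / c', div_pos hc hc', ?_⟩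
  rw [h, h', hprod a, hprod a', hcard]
  push_cast
  field_simp

end WeilPhase

lemma div_mul_integral_iff {p q : 𝓞 K} (hq : q ≠ 0) {I : Ideal (𝓞 K)} :
    (∀ z ∈ I, ∃ w : 𝓞 K, ((p : K) / q) * z = w) ↔ Ideal.span {q} ∣ Ideal.span {p} * I := by
  have hq' : (q : K) ≠ 0 := by simpa using hq
  have key : ∀ z w : 𝓞 K, ((p : K) / q) * z = w ↔ p * z = q * w := by
    intro z w
    rw [div_mul_eq_mul_div, div_eq_iff hq', mul_comm (w : K)]
    exact_mod_cast Iff.rfl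
  rw [Ideal.dvd_iff_le, Ideal.span_singleton_mul_le_iff]
  refine forall₂_congr fun z _ => ?_
  rw [Ideal.mem_span_singleton]
  exact exists_congr fun w => key z w

lemma exists_div_integral (y : K) : ∃ p q : 𝓞 K, q ≠ 0 ∧ y = (p : K) / q := by
  obtain ⟨p, q, hq, h⟩ := IsFractionRing.div_surjective (A := 𝓞 K) y
  exact ⟨p, q, nonZeroDivisors.ne_zero hq, h.symm⟩

lemma exists_different : ∃ 𝔇 : Ideal (𝓞 K), 𝔇 ≠ ⊥ ∧ ∀ y : K,
    (∀ x : 𝓞 K, trChar (y * (x : K)) = 1) ↔ ∀ z ∈ 𝔇, ∃ w : 𝓞 K, y * z = w := by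
  refine ⟨differentIdeal ℤ (𝓞 K), differentIdeal_ne_bot, fun y => ?_⟩
  have h1 : y ∈ FractionalIdeal.dual ℤ ℚ (1 : FractionalIdeal (nonZeroDivisors (𝓞 K)) K) ↔
      ∀ x : 𝓞 K, trChar (y * (x : K)) = 1 := by
    rw [FractionalIdeal.mem_dual (one_ne_zero (α := FractionalIdeal (nonZeroDivisors (𝓞 K)) K))]
    constructor
    · intro h x
      obtain ⟨m, hm⟩ := h (x : K) (FractionalIdeal.mem_one_iff _ |>.mpr ⟨x, rfl⟩)
      exact trChar_eq_one_iff.mpr ⟨m, by rw [← Algebra.traceForm_apply, ← hm]; simp⟩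
    · rintro h a ha
      obtain ⟨x, rfl⟩ := (FractionalIdeal.mem_one_iff _).mp ha
      obtain ⟨m, hm⟩ := trChar_eq_one_iff.mp (h x)
      exact ⟨m, by rw [Algebra.traceForm_apply]; simpa using hm.symm⟩
  have hne : ((differentIdeal ℤ (𝓞 K) : Ideal (𝓞 K)) :
      FractionalIdeal (nonZeroDivisors (𝓞 K)) K) ≠ 0 := by
    rw [Ne, FractionalIdeal.coeIdeal_eq_zero]
    exact differentIdeal_ne_bot
  rw [← h1, ← inv_inv (FractionalIdeal.dual ℤ ℚ 1), ← coeIdeal_differentIdeal ℤ ℚ K (𝓞 K),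
    FractionalIdeal.mem_inv_iff hne]
  constructor
  · intro h z hz
    obtain ⟨w, hw⟩ := (FractionalIdeal.mem_one_iff _).mp
      (h (z : K) ((FractionalIdeal.mem_coeIdeal _).mpr ⟨z, hz, rfl⟩))
    exact ⟨w, hw.symm⟩
  · rintro h a ha
    obtain ⟨z, hz, rfl⟩ := (FractionalIdeal.mem_coeIdeal _).mp ha
    obtain ⟨w, hw⟩ := h z hz
    exact (FractionalIdeal.mem_one_iff _).mpr ⟨w, hw.symm⟩

lemma exists_isTraceGen {N : 𝓞 K} (hN : N ≠ 0) (hu : ¬ IsUnit N) :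
    ∃ (t : K) (𝔢 : Ideal (𝓞 K)), t ≠ 0 ∧ 𝔢 ≠ ⊥ ∧ IsCoprime 𝔢 (Ideal.span {N}) ∧
      ∀ y : K, (∀ x : 𝓞 K, trChar (t * y * (x : K)) = 1) ↔ ∀ z ∈ 𝔢, ∃ w : 𝓞 K, y * z = w := by
  obtain ⟨𝔇, h𝔇, hD⟩ := exists_different (K := K)
  obtain ⟨d, hd, hd0⟩ := Submodule.exists_mem_ne_zero_of_ne_bot h𝔇
  obtain ⟨𝔞, h𝔞⟩ := Ideal.dvd_span_singleton.mpr hd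
  have hd1 : Ideal.span {d} ≠ ⊥ := by simpa using hd0
  have h𝔞0 : 𝔞 ≠ ⊥ := by rintro rfl; simp [h𝔞] at hd1
  have hN1 : Ideal.span {N} ≠ ⊥ := by simpa using hN
  obtain ⟨s, hs⟩ := IsDedekindDomain.exists_sup_span_eq (I := Ideal.span {N} * 𝔞) (J := 𝔞)
    Ideal.mul_le_right (mul_ne_zero hN1 h𝔞0)
  have hsle : Ideal.span {s} ≤ 𝔞 := by rw [← hs]; exact le_sup_right
  obtain ⟨𝔢, h𝔢⟩ := Ideal.dvd_iff_le.mpr hsle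
  have hcop : Ideal.span {N} ⊔ 𝔢 = ⊤ := by
    have : 𝔞 * (Ideal.span {N} ⊔ 𝔢) = 𝔞 * ⊤ := by
      rw [Ideal.mul_sup, ← h𝔢, mul_comm 𝔞, hs, Ideal.mul_top]
    exact mul_left_cancel₀ h𝔞0 this
  have hs0 : s ≠ 0 := by
    rintro rfl
    have : 𝔢 = ⊥ := by
      have h0 : 𝔞 * 𝔢 = 0 := by rw [← h𝔢]; simp
      exact (mul_eq_zero.mp h0).resolve_left h𝔞0
    rw [this, sup_bot_eq, Ideal.span_singleton_eq_top] at hcop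
    exact hu hcop
  have hs' : Ideal.span {s} ≠ ⊥ := by simpa using hs0
  refine ⟨(s : K) / d, 𝔢, div_ne_zero (by simpa using hs0) (by simpa using hd0), ?_, ?_, ?_⟩
  · rintro rfl; simp [h𝔢] at hs'
  · rw [Ideal.isCoprime_iff_sup_eq, sup_comm]; exact hcop
  · intro y
    rw [hD]
    obtain ⟨p, q, hq, rfl⟩ := exists_div_integral y
    have hq1 : Ideal.span {q} ≠ ⊥ := by simpa using hq
    have e : (s : K) / d * ((p : K) / q) = ((s * p : 𝓞 K) : K) / ((d * q : 𝓞 K) : K) := by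
      push_cast; rw [div_mul_div_comm]
    rw [e, div_mul_integral_iff (mul_ne_zero hd0 hq), div_mul_integral_iff hq,
      ← Ideal.span_singleton_mul_span_singleton, ← Ideal.span_singleton_mul_span_singleton,
      h𝔢, h𝔞]
    have e2 : 𝔞 * 𝔢 * Ideal.span {p} * 𝔇 = 𝔇 * 𝔞 * (Ideal.span {p} * 𝔢) := by ring
    rw [e2, mul_assoc, mul_assoc, mul_dvd_mul_iff_left h𝔇, mul_dvd_mul_iff_left h𝔞0]

lemma exists_sq_approx {𝔟 : Ideal (𝓞 K)} {α α' e : 𝓞 K}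
    (hα : IsCoprime 𝔟 (Ideal.span {α})) (he : e ∈ 𝔟.radical) (hd : α' - α = 4 * e) (k : ℕ) :
    ∃ u f : 𝓞 K, u - 1 ∈ 𝔟.radical ∧ f ∈ 𝔟.radical ^ (k + 1) ∧ α' - α * u ^ 2 = 4 * f := by
  obtain ⟨b, hb, c, hc, hbc⟩ := Ideal.isCoprime_iff_exists.mp hα
  obtain ⟨β, rfl⟩ := Ideal.mem_span_singleton.mp hc
  have hb' : b ∈ 𝔟.radical := Ideal.le_radical hb
  induction k with
  | zero => exact ⟨1, e, by simp, by simpa using he, by rw [← hd]; ring⟩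
  | succ k ih =>
    obtain ⟨u, f, hu, hf, h⟩ := ih
    have hf1 : f ∈ 𝔟.radical := Ideal.pow_le_self (Nat.succ_ne_zero k) hf
    refine ⟨u + 2 * (β * f), f - α * u * (β * f) - α * (β * f) ^ 2, ?_, ?_, ?_⟩
    · have : u + 2 * (β * f) - 1 = (u - 1) + (2 * β) * f := by ring
      rw [this]
      exact add_mem hu (Ideal.mul_mem_left _ _ hf1)
    · have : f - α * u * (β * f) - α * (β * f) ^ 2 =
          f * (b - α * β * (u - 1) - (α * β ^ 2) * f) := by linear_combination (-f) * hbc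
      rw [this, pow_succ]
      exact Ideal.mul_mem_mul hf (sub_mem (sub_mem hb' (Ideal.mul_mem_left _ _ hu))
        (Ideal.mul_mem_left _ _ hf1))
    · linear_combination h

lemma mean_quad_congr (ψ : AddChar (𝓞 K) ℂ) {𝔤 : Ideal (𝓞 K)} (h𝔤 : 𝔤 ≠ ⊥)
    (hψ : ∀ z ∈ Ideal.span {2} * (Ideal.span {2} * 𝔤), ψ z = 1) {α α' e : 𝓞 K}
    (hα : IsCoprime (Ideal.span {2} * 𝔤) (Ideal.span {α}))
    (he : e ∈ (Ideal.span {2} * 𝔤).radical) (hd : α' - α = 4 * e) :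
    mean (fun y : 𝓞 K => ψ (α' * y ^ 2)) = mean (fun y : 𝓞 K => ψ (α * y ^ 2)) := by
  set 𝔟 : Ideal (𝓞 K) := Ideal.span {2} * 𝔤 with h𝔟
  have h2 : Ideal.span {(2 : 𝓞 K)} ≠ ⊥ := by simp
  have h𝔟0 : 𝔟 ≠ ⊥ := mul_ne_zero h2 h𝔤
  have hB0 : Ideal.span {2} * 𝔟 ≠ ⊥ := mul_ne_zero h2 h𝔟0
  obtain ⟨k, hk⟩ := Ideal.exists_radical_pow_le_of_fg 𝔟 (IsNoetherian.noetherian _)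
  obtain ⟨u, f, hu, hf, hfu⟩ := exists_sq_approx hα he hd k
  have hf' : f ∈ 𝔟 := hk (Ideal.pow_le_pow_right (Nat.le_succ k) hf)
  have h4 : ∀ z ∈ 𝔟, ∀ w, ψ (2 * (z * w)) = 1 := fun z hz w => hψ _
    (Ideal.mul_mem_mul (Ideal.mem_span_singleton_self _) (Ideal.mul_mem_right _ _ hz))
  have e1 : (fun y : 𝓞 K => ψ (α' * y ^ 2)) = fun y => ψ (α * (u * y) ^ 2) := by
    funext y
    have : α' * y ^ 2 = α * (u * y) ^ 2 + 2 * (f * (2 * y ^ 2)) := by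
      linear_combination y ^ 2 * hfu
    rw [this, AddChar.map_add_eq_mul, h4 f hf', mul_one]
  have hcop : IsCoprime (Ideal.span {u}) (Ideal.span {2} * 𝔟) := by
    have hr : IsCoprime (Ideal.span {u}) 𝔟.radical := by
      rw [Ideal.isCoprime_iff_exists]
      exact ⟨u, Ideal.mem_span_singleton_self _, 1 - u, by
        rw [← neg_sub]; exact neg_mem hu, by ring⟩
    have hb : IsCoprime (Ideal.span {u}) 𝔟 := by
      have := IsCoprime.pow_right (n := k) hr
      rw [Ideal.isCoprime_iff_sup_eq] at this ⊢
      exact top_le_iff.mp (this.symm.le.trans (sup_le_sup_left hk _))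
    refine IsCoprime.mul_right ?_ hb
    rw [Ideal.isCoprime_iff_sup_eq] at hb ⊢
    exact top_le_iff.mp (hb.symm.le.trans (sup_le_sup_left Ideal.mul_le_left _))
  obtain ⟨c, hc, b, hb, hcb⟩ := Ideal.isCoprime_iff_exists.mp hcop
  obtain ⟨v, rfl⟩ := Ideal.mem_span_singleton.mp hc
  rw [e1]
  symm
  refine (mean_add (finPeriodic_quad hB0 hψ α) (AddMonoidHom.mulLeft u)
    (Submodule.toAddSubgroup (Ideal.span {2} * 𝔟)).subtype ?_
    (f₁ := fun y => ψ (α * (u * y) ^ 2)) (f₂ := fun _ => 1) ?_ ?_ ?_).trans ?_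
  · intro g
    exact ⟨v * g, ⟨b * g, Ideal.mul_mem_right _ _ hb⟩, by
      simp only [AddMonoidHom.coe_mulLeft, AddSubgroup.subtype_apply]
      linear_combination g * hcb⟩
  · simp
  · rfl
  · rintro y ⟨z, hz⟩
    have hz' : z ∈ Ideal.span {2} * 𝔟 := hz
    simp only [AddMonoidHom.coe_mulLeft, AddSubgroup.subtype_apply, mul_one]
    have : α * (u * y + z) ^ 2 = α * (u * y) ^ 2 + z * (α * (2 * u * y + z)) := by ring
    rw [this, AddChar.map_add_eq_mul, hψ _ (Ideal.mul_mem_right _ _ hz'), mul_one]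
  · rw [mean_one, mul_one]

lemma mean_quad_tail (ψ : AddChar (𝓞 K) ℂ) {𝔞 𝔤 : Ideal (𝓞 K)} (h𝔞 : 𝔞 ≠ ⊥) (h𝔤 : 𝔤 ≠ ⊥)
    (hodd : OddIdeal 𝔞) (hcop : IsCoprime 𝔞 (Ideal.span {2} * 𝔤))
    (hψ : HasConductor (ψ.mulShift 2) (𝔞 * (Ideal.span {2} * 𝔤))) (α : 𝓞 K)
    (hα : IsCoprime (Ideal.span {2} * 𝔤) (Ideal.span {α})) :
    ∃ C : ℂ, ∀ κ e : 𝓞 K, e ∈ (Ideal.span {2} * 𝔤).radical → κ - α = 4 * e →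
      IsCoprime 𝔞 (Ideal.span {κ}) →
      mean (fun y : 𝓞 K => ψ (κ * y ^ 2)) = quadSym 𝔞 κ * C := by
  set 𝔟 : Ideal (𝓞 K) := Ideal.span {2} * 𝔤 with h𝔟
  have h2 : Ideal.span {(2 : 𝓞 K)} ≠ ⊥ := by simp
  have h𝔟0 : 𝔟 ≠ ⊥ := mul_ne_zero h2 h𝔤
  have h1 : ∀ z ∈ 𝔞 * 𝔟, ∀ w, ψ (2 * z * w) = 1 := by
    intro z hz w
    have := hψ.eq_one (Ideal.mul_mem_right w _ hz)
    rwa [AddChar.mulShift_apply, ← mul_assoc] at this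
  have hB : ∀ z ∈ Ideal.span {2} * (𝔞 * 𝔟), ψ z = 1 := by
    intro z hz
    obtain ⟨w, hw, rfl⟩ := Ideal.mem_span_singleton_mul.mp hz
    have := h1 w hw 1
    rwa [mul_one] at this
  obtain ⟨e₂, he₂, e₁, he₁, he⟩ := Ideal.isCoprime_iff_exists.mp hcop
  rw [add_comm] at he
  refine ⟨mean (fun y => ψ.mulShift (e₁ ^ 2) (y ^ 2)) *
    mean (fun y => ψ.mulShift (e₂ ^ 2) (α * y ^ 2)), ?_⟩
  intro κ e hee hd hκ
  rw [mean_quad_split ψ (mul_ne_zero h2 (mul_ne_zero h𝔞 h𝔟0)) hB he (by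
    intro z
    have := h1 (e₂ * e₁) (Ideal.mul_mem_mul he₂ he₁) z
    rwa [mul_comm e₂, ← mul_assoc] at this) κ]
  rw [mean_quad_eq h𝔞 hodd (ψ.mulShift (e₁ ^ 2)) ?_ κ hκ,
    mean_quad_congr (ψ.mulShift (e₂ ^ 2)) h𝔤 ?_ hα hee hd, mul_assoc]
  · intro z hz
    obtain ⟨w, hw, rfl⟩ := Ideal.mem_span_singleton_mul.mp hz
    have := h1 (e₂ * w) (Ideal.mul_mem_mul he₂ hw) e₂
    rw [AddChar.mulShift_apply]
    convert this using 2; ring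
  · intro z
    constructor
    · intro hz x
      obtain ⟨w, hw, rfl⟩ := Ideal.mem_span_singleton_mul.mp he₁
      have := h1 (z * (2 * w)) (Ideal.mul_mem_mul hz he₁) (w * x)
      rw [AddChar.mulShift_apply]
      convert this using 2; ring
    · intro h
      refine (hψ.mulShift_sq he he₁ he₂ z).mpr fun x => ?_
      have := h (2 * x)
      rw [AddChar.mulShift_apply] at this
      rw [AddChar.mulShift_apply, AddChar.mulShift_apply]
      convert this using 2; ring

lemma co_mul (a b : 𝓞 K) : ((a * b : 𝓞 K) : K) = a * b := rfl
lemma co_add (a b : 𝓞 K) : ((a + b : 𝓞 K) : K) = a + b := rfl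
lemma co_sub (a b : 𝓞 K) : ((a - b : 𝓞 K) : K) = a - b := rfl
lemma co_pow (a : 𝓞 K) (n : ℕ) : ((a ^ n : 𝓞 K) : K) = (a : K) ^ n := rfl
lemma co_two : ((2 : 𝓞 K) : K) = 2 := map_ofNat (algebraMap (𝓞 K) K) 2

/-- `t` generates the codifferent up to the integral ideal `𝔢`. -/
def IsTraceGen (t : K) (𝔢 : Ideal (𝓞 K)) : Prop :=
  ∀ y : K, (∀ x : 𝓞 K, trChar (t * y * (x : K)) = 1) ↔ ∀ z ∈ 𝔢, ∃ w : 𝓞 K, y * z = w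

lemma IsTraceGen.hint {t : K} {𝔢 : Ideal (𝓞 K)} (ht : IsTraceGen t 𝔢) (κ x y : 𝓞 K) :
    trChar ((κ : K) * t * x * (y : K)) = 1 := by
  have := (ht ((κ * x : 𝓞 K) : K)).mpr (fun z _ => ⟨κ * x * z, by simp only [co_mul, co_add,
      co_sub, co_pow, co_two]⟩) y
  rw [← this]; simp only [co_mul, co_add, co_sub, co_pow, co_two]; ring_nf

lemma dvd_mul_iff_of_coprime {𝔞 𝔟 𝔠 : Ideal (𝓞 K)} (h : IsCoprime 𝔞 𝔟) :
    𝔞 ∣ 𝔟 * 𝔠 ↔ 𝔞 ∣ 𝔠 :=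
  ⟨h.dvd_of_dvd_mul_left, fun h' => h'.mul_left _⟩

lemma exists_gauss_split {t : K} {𝔢 : Ideal (𝓞 K)} (ht0 : t ≠ 0) (h𝔢 : 𝔢 ≠ ⊥)
    (ht : IsTraceGen t 𝔢) {γ : 𝓞 K} (hγ : γ ≠ 0) :
    ∃ ψ : AddChar (𝓞 K) ℂ, HasConductor (ψ.mulShift 2) (Ideal.span {2 * γ} * 𝔢) ∧
      ∀ κ : 𝓞 K, κ ≠ 0 → OddIdeal (Ideal.span {κ}) → IsCoprime (Ideal.span {κ}) (Ideal.span {γ}) →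
        IsCoprime (Ideal.span {κ}) 𝔢 →
        gaussMean ((κ : K) * γ * t) = quadSym (Ideal.span {κ}) γ *
          mean (fun u : 𝓞 K => trChar (t * ((u : K) ^ 2 / κ))) *
          mean (fun y : 𝓞 K => ψ (κ * y ^ 2)) := by
  set 𝔫 : Ideal (𝓞 K) := Ideal.span {2 * γ} * 𝔢 with h𝔫
  have hγ' : (γ : K) ≠ 0 := by simpa using hγ
  have h2γ : (2 * γ : 𝓞 K) ≠ 0 := mul_ne_zero two_ne_zero hγ
  have h𝔫0 : 𝔫 ≠ ⊥ := mul_ne_zero (by simpa using hγ) h𝔢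
  have hdual : ∀ y : K, (∀ x : 𝓞 K, trChar (2 * γ * t * y * (x : K)) = 1) ↔
      ∀ z ∈ 𝔫, ∃ w : 𝓞 K, y * z = w := by
    intro y
    have e : ∀ x : 𝓞 K, 2 * (γ : K) * t * y * x = t * (2 * γ * y) * x := fun x => by ring
    simp only [e]
    rw [ht]
    constructor
    · intro h z hz
      obtain ⟨z', hz', rfl⟩ := Ideal.mem_span_singleton_mul.mp hz
      obtain ⟨w, hw⟩ := h z' hz'
      exact ⟨w, by rw [← hw]; simp only [co_mul, co_add, co_sub, co_pow, co_two]; ring⟩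
    · intro h z hz
      obtain ⟨w, hw⟩ := h (2 * γ * z) (Ideal.mul_mem_mul (Ideal.mem_span_singleton_self _) hz)
      exact ⟨w, by rw [← hw]; simp only [co_mul, co_add, co_sub, co_pow, co_two]; ring⟩
  obtain ⟨c, hc, hc0⟩ := Submodule.exists_mem_ne_zero_of_ne_bot h𝔫0
  have hc' : (c : K) ≠ 0 := by simpa using hc0
  have hc1 : Ideal.span {c} ≠ ⊥ := by simpa using hc0
  obtain ⟨𝔨, h𝔨⟩ := Ideal.dvd_span_singleton.mpr hc
  have h𝔨0 : 𝔨 ≠ ⊥ := by rintro rfl; simp [h𝔨] at hc1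
  obtain ⟨s, hs⟩ := IsDedekindDomain.exists_sup_span_eq (I := Ideal.span {c}) (J := 𝔨)
    (by rw [h𝔨]; exact Ideal.mul_le_right) hc1
  have hsle : Ideal.span {s} ≤ 𝔨 := by rw [← hs]; exact le_sup_right
  obtain ⟨𝔩, h𝔩⟩ := Ideal.dvd_iff_le.mpr hsle
  have hcop : IsCoprime 𝔫 𝔩 := by
    rw [Ideal.isCoprime_iff_sup_eq]
    have : 𝔨 * (𝔫 ⊔ 𝔩) = 𝔨 * ⊤ := by
      rw [Ideal.mul_sup, ← h𝔩, mul_comm 𝔨 𝔫, ← h𝔨, hs, Ideal.mul_top]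
    exact mul_left_cancel₀ h𝔨0 this
  set j : K := (s : K) / c with hj
  have hjint : ∀ z ∈ 𝔫, ∃ w : 𝓞 K, j * z = w := by
    rw [hj, div_mul_integral_iff hc0, h𝔨, h𝔩]
    exact ⟨𝔩, by ring⟩
  have hgen : ∀ y : K, (∀ z ∈ 𝔫, ∃ w : 𝓞 K, y * z = w) → ∃ u z : 𝓞 K, y = u + j * z := by
    intro y
    obtain ⟨p, q, hq, rfl⟩ := exists_div_integral y
    intro h
    have hq' : (q : K) ≠ 0 := by simpa using hq
    have hq1 : Ideal.span {q} ≠ ⊥ := by simpa using hq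
    obtain ⟨w, hw⟩ := h c hc
    have hpc : p * c = q * w := by
      have : (p : K) * c = q * w := by rw [← hw]; field_simp
      exact_mod_cast this
    obtain ⟨X, hX⟩ := (div_mul_integral_iff hq).mp h
    have hwX : Ideal.span {w} = X * 𝔨 := by
      refine mul_left_cancel₀ hq1 ?_
      rw [Ideal.span_singleton_mul_span_singleton, ← hpc, ← Ideal.span_singleton_mul_span_singleton,
        h𝔨, ← mul_assoc, hX, mul_assoc]
    have hwk : w ∈ 𝔨 := by
      rw [← Ideal.span_singleton_le_iff_mem, hwX]; exact Ideal.mul_le_right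
    rw [← hs] at hwk
    obtain ⟨a, ha, b, hb, hab⟩ := Submodule.mem_sup.mp hwk
    obtain ⟨u, rfl⟩ := Ideal.mem_span_singleton.mp ha
    obtain ⟨z, rfl⟩ := Ideal.mem_span_singleton.mp hb
    refine ⟨u, z, ?_⟩
    have hK : (p : K) / q * c = c * u + s * z := by rw [hw]; exact_mod_cast hab.symm
    rw [hj]
    field_simp
    field_simp at hK
    linear_combination hK
  let ψ : AddChar (𝓞 K) ℂ :=
    { toFun := fun z => trChar (γ * t * j ^ 2 * (z : K))
      map_zero_eq_one' := by simp
      map_add_eq_mul' := fun x y => by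
        rw [← AddChar.map_add_eq_mul]; simp only [co_mul, co_add, co_sub, co_pow, co_two]; rw [mul_add] }
  have hψ : ∀ z, ψ z = trChar (γ * t * j ^ 2 * (z : K)) := fun z => rfl
  refine ⟨ψ, ?_, ?_⟩
  · intro z
    have e : ∀ x : 𝓞 K, ψ.mulShift 2 (z * x) = trChar (2 * γ * t * (j ^ 2 * z) * (x : K)) := by
      intro x
      rw [AddChar.mulShift_apply, hψ]; simp only [co_mul, co_add, co_sub, co_pow, co_two]; congr 1; ring
    simp only [e]
    rw [hdual]
    have e2 : j ^ 2 * z = ((s ^ 2 * z : 𝓞 K) : K) / ((c ^ 2 : 𝓞 K) : K) := by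
      rw [hj]; simp only [co_mul, co_add, co_sub, co_pow, co_two]; rw [div_pow, div_mul_eq_mul_div]
    rw [e2, div_mul_integral_iff (pow_ne_zero 2 hc0), ← Ideal.span_singleton_mul_span_singleton,
      ← Ideal.span_singleton_pow, ← Ideal.span_singleton_pow, h𝔨, h𝔩]
    have e3 : (𝔨 * 𝔩) ^ 2 * Ideal.span {z} * 𝔫 = (𝔨 ^ 2 * 𝔫) * (𝔩 ^ 2 * Ideal.span {z}) := by ring
    have e4 : (𝔫 * 𝔨) ^ 2 = (𝔨 ^ 2 * 𝔫) * 𝔫 := by ring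
    rw [e3, e4, mul_dvd_mul_iff_left (mul_ne_zero (pow_ne_zero 2 h𝔨0) h𝔫0),
      dvd_mul_iff_of_coprime hcop.pow_right, Ideal.dvd_span_singleton]
  · intro κ hκ hodd hκγ hκe
    have hκ' : (κ : K) ≠ 0 := by simpa using hκ
    have hκ1 : Ideal.span {κ} ≠ ⊥ := by simpa using hκ
    have hω : (κ : K) * γ * t ≠ 0 := mul_ne_zero (mul_ne_zero hκ' hγ') ht0
    have hint : ∀ x y : 𝓞 K, trChar ((κ : K) * γ * t * x * (y : K)) = 1 := by
      intro x y
      have := ht.hint (κ * γ) x y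
      simp only [co_mul, co_add, co_sub, co_pow, co_two] at this; exact this
    have hfp : FinPeriodic (fun y : dualGrp (2 * ((κ : K) * γ * t)) =>
        trChar ((κ : K) * γ * t * (y : K) ^ 2)) := by
      obtain ⟨e, a, ha, he, hB⟩ := exists_orthogonal_integral_basis hω hint
      exact (gaussMean_eq hint e a ha he hB).1
    have hmem : ∀ y : K, y ∈ dualGrp (2 * ((κ : K) * γ * t)) ↔
        ∀ z ∈ 𝔫, ∃ w : 𝓞 K, (κ * y) * z = w := by
      intro y
      rw [← hdual, mem_dualGrp]
      refine forall_congr' fun x => ?_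
      have : 2 * ((κ : K) * γ * t) * y * x = 2 * γ * t * (κ * y) * x := by ring
      rw [this]
    have m1 : ∀ u : 𝓞 K, (u : K) / κ ∈ dualGrp (2 * ((κ : K) * γ * t)) := fun u =>
      (hmem _).mpr fun z _ => ⟨u * z, by simp only [co_mul, co_add, co_sub, co_pow, co_two]; field_simp⟩
    have m2 : ∀ z : 𝓞 K, j * (z : K) ∈ dualGrp (2 * ((κ : K) * γ * t)) := fun z =>
      (hmem _).mpr fun z' hz' => by
        obtain ⟨w, hw⟩ := hjint z' hz'
        exact ⟨κ * z * w, by simp only [co_mul, co_add, co_sub, co_pow, co_two]; rw [← hw]; ring⟩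
    let φ₁ : 𝓞 K →+ dualGrp (2 * ((κ : K) * γ * t)) :=
      { toFun := fun u => ⟨(u : K) / κ, m1 u⟩
        map_zero' := by ext; simp
        map_add' := fun x y => by ext; simp only [co_mul, co_add, co_sub, co_pow, co_two]; simp [add_div] }
    let φ₂ : 𝓞 K →+ dualGrp (2 * ((κ : K) * γ * t)) :=
      { toFun := fun z => ⟨j * (z : K), m2 z⟩
        map_zero' := by ext; simp
        map_add' := fun x y => by ext; simp only [co_mul, co_add, co_sub, co_pow, co_two]; simp [mul_add] }
    have hκ𝔫 : IsCoprime (Ideal.span {κ}) 𝔫 := by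
      rw [h𝔫, ← Ideal.span_singleton_mul_span_singleton]
      exact IsCoprime.mul_right (IsCoprime.mul_right hodd hκγ) hκe
    obtain ⟨l, hl, ν, hν, hlν⟩ := Ideal.isCoprime_iff_exists.mp hκ𝔫
    obtain ⟨l, rfl⟩ := Ideal.mem_span_singleton.mp hl
    rw [gaussMean]
    refine (mean_add hfp φ₁ φ₂ ?_ (f₁ := fun u => trChar (γ * t * ((u : K) ^ 2 / κ)))
      (f₂ := fun z => ψ (κ * z ^ 2)) ?_ ?_ ?_).trans ?_
    · rintro ⟨y, hy⟩
      have hy' := (hmem y).mp hy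
      obtain ⟨u, z, huz⟩ := hgen _ hy'
      obtain ⟨w, hw⟩ := hy' ν hν
      refine ⟨κ * l * u + w, l * z, ?_⟩
      ext
      change ((κ * l * u + w : 𝓞 K) : K) / κ + j * ((l * z : 𝓞 K) : K) = y
      have hK : (κ : K) * l + ν = 1 := by exact_mod_cast hlν
      simp only [co_mul, co_add, co_sub, co_pow, co_two]
      rw [← hw]
      field_simp
      linear_combination (-(l : K)) * huz + y * hK
    · simp
    · simp
    · intro u z
      have e : ((φ₁ u + φ₂ z : dualGrp (2 * ((κ : K) * γ * t))) : K) = (u : K) / κ + j * z := rfl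
      rw [e]
      have hcross : trChar (2 * γ * t * (j * u) * (z : K)) = 1 :=
        (hdual _).mpr (fun z' hz' => by
          obtain ⟨w, hw⟩ := hjint z' hz'
          exact ⟨u * w, by simp only [co_mul, co_add, co_sub, co_pow, co_two]; rw [← hw]; ring⟩) z
      have e2 : (κ : K) * γ * t * ((u : K) / κ + j * z) ^ 2 =
          γ * t * ((u : K) ^ 2 / κ) + 2 * γ * t * (j * u) * (z : K) +
            γ * t * j ^ 2 * ((κ * z ^ 2 : 𝓞 K) : K) := by
        simp only [co_mul, co_add, co_sub, co_pow, co_two]; field_simp; ring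
      rw [e2, AddChar.map_add_eq_mul, AddChar.map_add_eq_mul, hcross, mul_one, ← hψ]
    · congr 1
      let χ : AddChar (𝓞 K) ℂ :=
        { toFun := fun z => trChar (t * ((z : K) / κ))
          map_zero_eq_one' := by simp
          map_add_eq_mul' := fun x y => by
            rw [← AddChar.map_add_eq_mul]; simp only [co_mul, co_add, co_sub, co_pow, co_two]; rw [add_div, mul_add] }
      have hχ : ∀ z, χ z = trChar (t * ((z : K) / κ)) := fun z => rfl
      have hcond : HasConductor χ (Ideal.span {κ}) := by
        intro z
        have e : ∀ x : 𝓞 K, χ (z * x) = trChar (t * ((z : K) / κ) * (x : K)) := by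
          intro x
          rw [hχ]; simp only [co_mul, co_add, co_sub, co_pow, co_two]; congr 1; ring
        simp only [e]
        rw [ht, div_mul_integral_iff hκ, mul_comm, dvd_mul_iff_of_coprime hκe,
            Ideal.dvd_span_singleton]
      have := mean_quad_eq hκ1 hodd χ hcond γ hκγ
      have e1 : (fun u : 𝓞 K => trChar (γ * t * ((u : K) ^ 2 / κ))) = fun y => χ (γ * y ^ 2) := by
        funext u; rw [hχ]; simp only [co_mul, co_add, co_sub, co_pow, co_two]; congr 1; ring
      have e2 : (fun u : 𝓞 K => trChar (t * ((u : K) ^ 2 / κ))) = fun y => χ (y ^ 2) := by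
        funext u; rw [hχ]; simp only [co_mul, co_add, co_sub, co_pow, co_two]
      rw [e1, e2, this]

lemma gaussMean_eq_quadSym {t : K} {𝔢 : Ideal (𝓞 K)} (ht0 : t ≠ 0) (h𝔢 : 𝔢 ≠ ⊥)
    (ht : IsTraceGen t 𝔢) {γ : 𝓞 K} (hγ : γ ≠ 0) {𝔠 𝔤 : Ideal (𝓞 K)}
    (hfac : Ideal.span {γ} = 𝔠 * 𝔤) (hodd : OddIdeal 𝔠) (hoddE : OddIdeal 𝔢)
    (hcop : IsCoprime 𝔠 𝔤) (hcopE : IsCoprime 𝔢 (Ideal.span {γ})) {α : 𝓞 K}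
    (hα2 : OddIdeal (Ideal.span {α})) (hαγ : IsCoprime (Ideal.span {α}) (Ideal.span {γ})) :
    ∃ C : ℂ, ∀ κ e : 𝓞 K, e ∈ (Ideal.span {2} * 𝔤).radical → κ - α = 4 * e → κ ≠ 0 →
      OddIdeal (Ideal.span {κ}) → IsCoprime (Ideal.span {κ}) (Ideal.span {γ}) →
      IsCoprime (Ideal.span {κ}) 𝔢 →
      gaussMean ((κ : K) * γ * t) = quadSym (Ideal.span {κ}) γ * quadSym 𝔠 κ *
        (quadSym 𝔢 κ * mean (fun u : 𝓞 K => trChar (t * ((u : K) ^ 2 / κ)))) * C := by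
  have hγ1 : Ideal.span {γ} ≠ ⊥ := by simpa using hγ
  have h𝔠 : 𝔠 ≠ ⊥ := by rintro rfl; simp [hfac] at hγ1
  have h𝔤 : 𝔤 ≠ ⊥ := by rintro rfl; simp [hfac] at hγ1
  obtain ⟨ψ, hψ, hmean⟩ := exists_gauss_split ht0 h𝔢 ht hγ
  rw [hfac] at hcopE hαγ
  obtain ⟨C, hC⟩ := mean_quad_tail ψ (𝔞 := 𝔠 * 𝔢) (𝔤 := 𝔤) (mul_ne_zero h𝔠 h𝔢) h𝔤
    (IsCoprime.mul_left hodd hoddE)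
    (IsCoprime.mul_left (IsCoprime.mul_right hodd hcop)
      (IsCoprime.mul_right hoddE hcopE.of_mul_right_right))
    (by
      have : 𝔠 * 𝔢 * (Ideal.span {2} * 𝔤) = Ideal.span {2 * γ} * 𝔢 := by
        rw [← Ideal.span_singleton_mul_span_singleton, hfac]; ring
      rwa [this]) α
    (IsCoprime.mul_left hα2.symm hαγ.of_mul_right_right.symm)
  refine ⟨C, fun κ e he hd hκ h2 hκγ hκe => ?_⟩
  rw [hmean κ hκ h2 hκγ hκe, hC κ e he hd, quadSym_mul_ideal h𝔠 h𝔢]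
  · push_cast; ring
  · rw [hfac] at hκγ
    exact IsCoprime.mul_left hκγ.of_mul_right_left.symm hκe.symm

lemma quadSym_eq_one_or {𝔟 : Ideal (𝓞 K)} (hb : 𝔟 ≠ ⊥) {α : 𝓞 K}
    (h : IsCoprime 𝔟 (Ideal.span {α})) : quadSym 𝔟 α = 1 ∨ quadSym 𝔟 α = -1 :=
  (quadSym_trichotomy 𝔟 α).resolve_left ((quadSym_ne_zero_iff hb).mpr h)

lemma isCoprime_top_left (I : Ideal (𝓞 K)) : IsCoprime ⊤ I := by
  rw [← Ideal.one_eq_top]; exact isCoprime_one_left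

lemma isCoprime_span_one (I : Ideal (𝓞 K)) : IsCoprime I (Ideal.span {(1 : 𝓞 K)}) := by
  rw [Ideal.span_singleton_one]; exact (isCoprime_top_left I).symm

theorem reciprocity [IsGalois ℚ K] (ι : K →+* ℝ) {γ : 𝓞 K} (hγ : γ ≠ 0) {𝔠 𝔤 : Ideal (𝓞 K)}
    (hfac : Ideal.span {γ} = 𝔠 * 𝔤) (hodd : OddIdeal 𝔠) (hcop : IsCoprime 𝔠 𝔤) {α α' e : 𝓞 K}
    (hα : TotPos α) (hα' : TotPos α')
    (hα2 : OddIdeal (Ideal.span {α})) (hα2' : OddIdeal (Ideal.span {α'}))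
    (hαγ : IsCoprime (Ideal.span {α}) (Ideal.span {γ}))
    (hαγ' : IsCoprime (Ideal.span {α'}) (Ideal.span {γ}))
    (he : e ∈ (Ideal.span {2} * 𝔤).radical) (hd : α' - α = 4 * e) :
    quadSym (Ideal.span {α}) γ * quadSym 𝔠 α = quadSym (Ideal.span {α'}) γ * quadSym 𝔠 α' := by
  have hne : ∀ {β : 𝓞 K}, TotPos β → β ≠ 0 := by
    rintro β hβ rfl; simpa using hβ ι
  have hα0 := hne hα
  have hα0' := hne hα'
  have h2u : ¬ IsUnit (2 : 𝓞 K) := by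
    intro h
    have := h.map (Algebra.norm ℤ)
    rw [show (2 : 𝓞 K) = algebraMap ℤ (𝓞 K) 2 by simp, Algebra.norm_algebraMap,
      isUnit_pow_iff Module.finrank_pos.ne'] at this
    exact absurd this (by decide)
  obtain ⟨t, 𝔢, ht0, h𝔢, hcopN, ht⟩ := exists_isTraceGen (N := 2 * α * α' * γ)
    (mul_ne_zero (mul_ne_zero (mul_ne_zero two_ne_zero hα0) hα0') hγ)
    (fun h => h2u (isUnit_of_mul_isUnit_left (isUnit_of_mul_isUnit_left
      (isUnit_of_mul_isUnit_left h))))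
  have ht : IsTraceGen t 𝔢 := ht
  simp only [← Ideal.span_singleton_mul_span_singleton] at hcopN
  have hEγ := hcopN.of_mul_right_right
  have hEα' := hcopN.of_mul_right_left.of_mul_right_right
  have hEα := hcopN.of_mul_right_left.of_mul_right_left.of_mul_right_right
  have hE2 : OddIdeal 𝔢 := hcopN.of_mul_right_left.of_mul_right_left.of_mul_right_left
  have hγ1 : Ideal.span {γ} ≠ ⊥ := by simpa using hγ
  have h𝔠 : 𝔠 ≠ ⊥ := by rintro rfl; simp [hfac] at hγ1
  obtain ⟨C, hC⟩ := gaussMean_eq_quadSym ht0 h𝔢 ht hγ hfac hodd hE2 hcop hEγ hα2 hαγ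
  have hs1 : Ideal.span {(1 : 𝓞 K)} = ⊤ := Ideal.span_singleton_one
  obtain ⟨C', hC'⟩ := gaussMean_eq_quadSym ht0 h𝔢 ht (γ := 1) one_ne_zero (𝔠 := ⊤) (𝔤 := ⊤)
    (by rw [hs1, Ideal.mul_top]) (isCoprime_top_left _) hE2 (isCoprime_top_left _)
    (isCoprime_span_one _) hα2 (isCoprime_span_one _)
  have he' : e ∈ (Ideal.span {2} * (⊤ : Ideal (𝓞 K))).radical :=
    Ideal.radical_mono (Ideal.mul_mono_right le_top) he
  have g1 := hC α 0 (zero_mem _) (by simp) hα0 hα2 hαγ hEα.symm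
  have g2 := hC α' e he hd hα0' hα2' hαγ' hEα'.symm
  have g3 := hC' α 0 (zero_mem _) (by simp) hα0 hα2 (isCoprime_span_one _)
    hEα.symm
  have g4 := hC' α' e he' hd hα0' hα2' (isCoprime_span_one _) hEα'.symm
  rw [quadSym_one, quadSym_top] at g3 g4
  have hcoe : ∀ {β : 𝓞 K}, β ≠ 0 → (β : K) ≠ 0 := fun h => by simpa using h
  have hpos : ∀ {β : 𝓞 K}, TotPos β → ∀ τ : K ≃ₐ[ℚ] K, 0 < ι (τ (β : K)) := fun h τ =>
    h (ι.comp (τ : K →+* K))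
  have hsign : ∀ (δ : 𝓞 K) (τ : K ≃ₐ[ℚ] K),
      0 < ι (τ ((α : K) * δ * t)) ↔ 0 < ι (τ ((α' : K) * δ * t)) := by
    intro δ τ
    rw [mul_assoc, mul_assoc, map_mul τ, map_mul τ (α' : K), map_mul ι, map_mul ι,
      mul_pos_iff_of_pos_left (hpos hα τ), mul_pos_iff_of_pos_left (hpos hα' τ)]
  have hintg : ∀ κ δ : 𝓞 K, ∀ x y : 𝓞 K, trChar ((κ : K) * δ * t * x * (y : K)) = 1 :=
    fun κ δ x y => by
      have := ht.hint (κ * δ) x y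
      simpa only [co_mul] using this
  obtain ⟨hn1, c, hc, r1⟩ := gaussMean_ratio ι
    (mul_ne_zero (mul_ne_zero (hcoe hα0) (hcoe hγ)) ht0)
    (mul_ne_zero (mul_ne_zero (hcoe hα0') (hcoe hγ)) ht0) (hintg α γ) (hintg α' γ) (hsign γ)
  obtain ⟨hn2, c', hc', r2⟩ := gaussMean_ratio ι
    (mul_ne_zero (mul_ne_zero (hcoe hα0) (hcoe one_ne_zero)) ht0)
    (mul_ne_zero (mul_ne_zero (hcoe hα0') (hcoe one_ne_zero)) ht0) (hintg α 1) (hintg α' 1)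
        (hsign 1)
  have k1 : IsCoprime 𝔠 (Ideal.span {α}) := by
    rw [hfac] at hαγ; exact hαγ.of_mul_right_left.symm
  have k2 : IsCoprime 𝔠 (Ideal.span {α'}) := by
    rw [hfac] at hαγ'; exact hαγ'.of_mul_right_left.symm
  have sα : Ideal.span {α} ≠ ⊥ := by simpa using hα0
  have sα' : Ideal.span {α'} ≠ ⊥ := by simpa using hα0'
  set X : ℤ := quadSym (Ideal.span {α}) γ * quadSym 𝔠 α with hX
  set X' : ℤ := quadSym (Ideal.span {α'}) γ * quadSym 𝔠 α' with hX'
  have X1 : X = 1 ∨ X = -1 := by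
    rcases quadSym_eq_one_or sα hαγ with h | h <;> rcases quadSym_eq_one_or h𝔠 k1 with h' | h' <;>
      simp [hX, h, h']
  have X1' : X' = 1 ∨ X' = -1 := by
    rcases quadSym_eq_one_or sα' hαγ' with h | h <;> rcases quadSym_eq_one_or h𝔠 k2 with h' | h' <;>
      simp [hX', h, h']
  rw [← Int.cast_mul, ← hX, r1] at g1
  rw [← Int.cast_mul, ← hX'] at g2
  rw [r2] at g3
  set P := gaussMean ((α' : K) * γ * t)
  set Q := gaussMean ((α' : K) * ((1 : 𝓞 K) : K) * t)
  simp only [Int.cast_one, one_mul] at g3 g4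
  have hcC : (c' : ℂ) ≠ 0 := by exact_mod_cast hc'.ne'
  have hCne : C ≠ 0 := by rintro rfl; exact hn1 (by rw [g2, mul_zero])
  have e1 : (c : ℂ) * P * C' = X * (c' * Q) * C := by rw [g1, g3]; ring
  have e2 : P * C' = X' * Q * C := by rw [g2, g4]; ring
  have e3 : (c : ℂ) * X' = X * c' := by
    have : (Q * C) * ((c : ℂ) * X' - X * c') = 0 := by linear_combination e1 - c * e2
    exact sub_eq_zero.mp ((mul_eq_zero.mp this).resolve_left (mul_ne_zero hn2 hCne))
  have e4 : c * X' = X * c' := by exact_mod_cast e3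
  rcases X1 with h | h <;> rcases X1' with h' | h' <;> rw [h, h'] at e4 ⊢ <;>
    · push_cast at e4; linarith

open UniqueFactorizationMonoid in
lemma finite_ideal_divisors {I : Ideal (𝓞 K)} (hI : I ≠ 0) : {J : Ideal (𝓞 K) | J ∣ I}.Finite := by
  have := UniqueFactorizationMonoid.fintypeSubtypeDvd I hI
  exact Set.finite_coe_iff.1 (Finite.of_fintype {J : Ideal (𝓞 K) // J ∣ I})

lemma ncard_ideal_divisors_mul_le {I J : Ideal (𝓞 K)} (hI : I ≠ 0) (hJ : J ≠ 0) :
    {A : Ideal (𝓞 K) | A ∣ I * J}.ncard ≤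
      {A : Ideal (𝓞 K) | A ∣ I}.ncard * {A : Ideal (𝓞 K) | A ∣ J}.ncard := by
  have h1 := finite_ideal_divisors hI
  have h2 := finite_ideal_divisors hJ
  rw [← Set.ncard_prod]
  have hsub : {A : Ideal (𝓞 K) | A ∣ I * J} ⊆
      (fun p : Ideal (𝓞 K) × Ideal (𝓞 K) => p.1 * p.2) ''
        ({A : Ideal (𝓞 K) | A ∣ I} ×ˢ {A : Ideal (𝓞 K) | A ∣ J}) := by
    intro A hA
    obtain ⟨a, b, ha, hb, rfl⟩ := exists_dvd_and_dvd_of_dvd_mul (show A ∣ I * J from hA)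
    exact ⟨(a, b), ⟨ha, hb⟩, rfl⟩
  exact (Set.ncard_le_ncard hsub ((h1.prod h2).image _)).trans (Set.ncard_image_le (h1.prod h2))

lemma ncard_ideal_divisors_prime_pow_le {P : Ideal (𝓞 K)} (hP : Prime P) (i : ℕ) :
    {A : Ideal (𝓞 K) | A ∣ P ^ i}.ncard ≤ i + 1 := by
  have : {A : Ideal (𝓞 K) | A ∣ P ^ i} ⊆ (fun k => P ^ k) '' (Finset.range (i + 1) : Set ℕ) := by
    intro A hA
    obtain ⟨k, hk, h⟩ := (dvd_prime_pow hP i).1 hA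
    exact ⟨k, by simpa [Nat.lt_succ_iff] using hk, (associated_iff_eq.1 h).symm⟩
  refine (Set.ncard_le_ncard this (Set.toFinite _)).trans
      ((Set.ncard_image_le (Set.toFinite _)).trans ?_)
  simp

lemma exists_succ_le_mul_rpow {ε : ℝ} (hε : 0 < ε) :
    ∃ C : ℝ, 1 ≤ C ∧ ∀ i : ℕ, ((i : ℝ) + 1) ≤ C * (2 : ℝ) ^ ((i : ℝ) * ε) := by
  have hl : 0 < Real.log 2 := Real.log_pos (by norm_num)
  refine ⟨1 + 1 / (ε * Real.log 2), by have : 0 < 1 / (ε * Real.log 2) := by positivity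
                                       linarith, fun i => ?_⟩
  have h1 : (i : ℝ) * (ε * Real.log 2) + 1 ≤ (2 : ℝ) ^ ((i : ℝ) * ε) := by
    rw [Real.rpow_def_of_pos (by norm_num)]
    have := Real.add_one_le_exp (Real.log 2 * ((i : ℝ) * ε))
    linarith [this, mul_comm (Real.log 2) ((i : ℝ) * ε), mul_assoc (i : ℝ) ε (Real.log 2)]
  have h2 : (1 : ℝ) ≤ (2 : ℝ) ^ ((i : ℝ) * ε) := by
    have : (0 : ℝ) ≤ (i : ℝ) * (ε * Real.log 2) := by positivity
    linarith
  have hc : 0 < ε * Real.log 2 := by positivity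
  have h3 : (i : ℝ) ≤ 1 / (ε * Real.log 2) * (2 : ℝ) ^ ((i : ℝ) * ε) := by
    rw [div_mul_eq_mul_div, one_mul, le_div_iff₀ hc]
    linarith
  linarith

/-- The number of divisors of an ideal is bounded by any positive power of its norm. -/
lemma exists_ncard_ideal_divisors_le (K : Type*) [Field K] [NumberField K] {ε : ℝ} (hε : 0 < ε) :
    ∃ C : ℝ, 1 ≤ C ∧ ∀ I : Ideal (𝓞 K), I ≠ 0 →
      ({A : Ideal (𝓞 K) | A ∣ I}.ncard : ℝ) ≤ C * (Ideal.absNorm I : ℝ) ^ ε := by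
  obtain ⟨C, hC1, hC⟩ := exists_succ_le_mul_rpow hε
  set S := (Ideal.finite_setOfPred_absNorm_le (S := 𝓞 K) ⌈(2 : ℝ) ^ (1 / ε)⌉₊).toFinset with hS
  have hprime_two : ∀ P : Ideal (𝓞 K), Prime P → (2 : ℝ) ≤ (Ideal.absNorm P : ℝ) := by
    intro P hP
    have h0 : Ideal.absNorm P ≠ 0 := fun h => hP.ne_zero (Ideal.absNorm_eq_zero_iff.1 h)
    have h1 : Ideal.absNorm P ≠ 1 := fun h => hP.not_isUnit (by
      rw [Ideal.absNorm_eq_one_iff.1 h, ← Ideal.one_eq_top]; exact isUnit_one)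
    exact_mod_cast (show 2 ≤ Ideal.absNorm P by omega)
  have key : ∀ I : Ideal (𝓞 K), I ≠ 0 → ({A : Ideal (𝓞 K) | A ∣ I}.ncard : ℝ) ≤
      C ^ (S.filter (fun P => Prime P ∧ P ∣ I)).card * (Ideal.absNorm I : ℝ) ^ ε := by
    intro I
    induction I using UniqueFactorizationMonoid.induction_on_coprime with
    | @h0 => exact fun h => (h rfl).elim
    | @h1 u hu =>
      intro _
      obtain rfl : u = 1 := isUnit_iff_eq_one.1 hu
      have : {A : Ideal (𝓞 K) | A ∣ 1} = {1} := by
        ext A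
        exact ⟨fun h => isUnit_iff_eq_one.1 (isUnit_of_dvd_one h), fun h => by
          rw [show A = 1 from h]; exact dvd_refl _⟩
      rw [this, Set.ncard_singleton, map_one]
      simp only [Nat.cast_one, Real.one_rpow, mul_one]
      exact one_le_pow₀ hC1
    | @hpr P i hP =>
      intro _
      have h2 := hprime_two P hP
      refine (Nat.cast_le.2 (ncard_ideal_divisors_prime_pow_le hP i)).trans ?_
      rw [map_pow]
      push_cast
      rw [← Real.rpow_natCast (Ideal.absNorm P : ℝ) i, ← Real.rpow_mul (by positivity)]
      rcases Nat.eq_zero_or_pos i with rfl | hi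
      · simp only [Nat.cast_zero, zero_mul, Real.rpow_zero, zero_add, mul_one]
        exact one_le_pow₀ hC1
      by_cases hPS : P ∈ S
      · have h1 : 1 ≤ (S.filter (fun Q => Prime Q ∧ Q ∣ P ^ i)).card :=
          Finset.card_pos.2 ⟨P, Finset.mem_filter.2 ⟨hPS, hP, dvd_pow_self _ hi.ne'⟩⟩
        calc ((i : ℝ) + 1) ≤ C * (2 : ℝ) ^ ((i : ℝ) * ε) := hC i
          _ ≤ _ := by
            gcongr
            exact le_self_pow₀ hC1 (by omega)
      · have hbig : (2 : ℝ) ^ (1 / ε) ≤ (Ideal.absNorm P : ℝ) := by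
          simp only [hS, Set.Finite.mem_toFinset, Set.mem_ofPred_eq, not_le] at hPS
          exact (Nat.le_ceil _).trans (by exact_mod_cast hPS.le)
        have h3 : (2 : ℝ) ^ (i : ℝ) ≤ (Ideal.absNorm P : ℝ) ^ ((i : ℝ) * ε) := by
          calc (2 : ℝ) ^ (i : ℝ) = ((2 : ℝ) ^ (1 / ε)) ^ ((i : ℝ) * ε) := by
                rw [← Real.rpow_mul (by norm_num)]
                congr 1
                field_simp
            _ ≤ _ := by
              apply Real.rpow_le_rpow (by positivity) hbig (by positivity)
        have h4 : ((i : ℝ) + 1) ≤ (2 : ℝ) ^ (i : ℝ) := by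
          rw [Real.rpow_natCast]
          exact_mod_cast Nat.lt_two_pow_self
        calc ((i : ℝ) + 1) ≤ 1 * (Ideal.absNorm P : ℝ) ^ ((i : ℝ) * ε) := by linarith
          _ ≤ _ := by gcongr; exact one_le_pow₀ hC1
    | @hcp I J hrel hI hJ =>
      intro hIJ
      have hI0 : I ≠ 0 := left_ne_zero_of_mul hIJ
      have hJ0 : J ≠ 0 := right_ne_zero_of_mul hIJ
      have hcard : (S.filter (fun P => Prime P ∧ P ∣ I)).card +
          (S.filter (fun P => Prime P ∧ P ∣ J)).card ≤
          (S.filter (fun P => Prime P ∧ P ∣ I * J)).card := by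
        rw [← Finset.card_union_of_disjoint]
        · apply Finset.card_le_card
          intro P hP
          simp only [Finset.mem_union, Finset.mem_filter] at hP ⊢
          rcases hP with ⟨h, hp, hd⟩ | ⟨h, hp, hd⟩
          · exact ⟨h, hp, hd.mul_right _⟩
          · exact ⟨h, hp, hd.mul_left _⟩
        · rw [Finset.disjoint_left]
          intro P hP hP'
          simp only [Finset.mem_filter] at hP hP'
          exact hP.2.1.not_isUnit (hrel hP.2.2 hP'.2.2)
      calc (({A : Ideal (𝓞 K) | A ∣ I * J}.ncard : ℕ) : ℝ)
          ≤ ({A : Ideal (𝓞 K) | A ∣ I}.ncard : ℝ) * ({A : Ideal (𝓞 K) | A ∣ J}.ncard : ℝ) := by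
            exact_mod_cast ncard_ideal_divisors_mul_le hI0 hJ0
        _ ≤ (C ^ (S.filter (fun P => Prime P ∧ P ∣ I)).card * (Ideal.absNorm I : ℝ) ^ ε) *
            (C ^ (S.filter (fun P => Prime P ∧ P ∣ J)).card * (Ideal.absNorm J : ℝ) ^ ε) := by
            gcongr
            · exact hI hI0
            · exact hJ hJ0
        _ = C ^ ((S.filter (fun P => Prime P ∧ P ∣ I)).card +
              (S.filter (fun P => Prime P ∧ P ∣ J)).card) *
              (Ideal.absNorm (I * J) : ℝ) ^ ε := by
            rw [map_mul]
            push_cast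
            rw [Real.mul_rpow (by positivity) (by positivity), pow_add]
            ring
        _ ≤ _ := by
            gcongr
  refine ⟨C ^ S.card, one_le_pow₀ hC1, fun I hI => (key I hI).trans ?_⟩
  gcongr
  exact Finset.filter_subset _ _

/-- The harmonic sum up to `Y` is bounded by any positive power of `Y`. -/
lemma exists_sum_inv_le {ε : ℝ} (hε : 0 < ε) :
    ∃ C : ℝ, 1 ≤ C ∧ ∀ Y : ℕ, 1 ≤ Y → ∑ d ∈ Finset.Icc 1 Y, (1 : ℝ) / d ≤ C * (Y : ℝ) ^ ε := by
  refine ⟨1 + 1 / ε, by have : 0 < 1 / ε := by positivity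
                        linarith, fun Y hY => ?_⟩
  have hY' : (1 : ℝ) ≤ Y := by exact_mod_cast hY
  have h1 := harmonic_le_one_add_log Y
  have h2 : ((harmonic Y : ℚ) : ℝ) = ∑ d ∈ Finset.Icc 1 Y, (1 : ℝ) / d := by
    rw [harmonic_eq_sum_Icc]
    push_cast
    simp
  have h3 : Real.log Y ≤ (Y : ℝ) ^ ε / ε := Real.log_le_rpow_div (by positivity) hε
  have h4 : (1 : ℝ) ≤ (Y : ℝ) ^ ε := Real.one_le_rpow hY' hε.le
  rw [← h2]
  calc ((harmonic Y : ℚ) : ℝ) ≤ 1 + Real.log Y := h1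
    _ ≤ (Y : ℝ) ^ ε + (Y : ℝ) ^ ε / ε := by linarith
    _ = _ := by ring

lemma exists_log_add_pow_le {ε : ℝ} (hε : 0 < ε) (a : ℝ) (ha : 0 ≤ a) (k : ℕ) :
    ∃ C : ℝ, 1 ≤ C ∧ ∀ Y : ℝ, 1 ≤ Y → (a * Real.log Y + a) ^ k ≤ C * Y ^ ε := by
  set η := ε / (k + 1) with hη
  have hη0 : 0 < η := by positivity
  refine ⟨(a * (1 / η) + a + 1) ^ k, one_le_pow₀ (by
    have : 0 < 1 / η := by positivity
    nlinarith), fun Y hY => ?_⟩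
  have h3 : Real.log Y ≤ Y ^ η / η := Real.log_le_rpow_div (by positivity) hη0
  have h4 : (1 : ℝ) ≤ Y ^ η := Real.one_le_rpow hY hη0.le
  have h5 : 0 ≤ Real.log Y := Real.log_nonneg hY
  have h6 : a * Real.log Y + a ≤ (a * (1 / η) + a + 1) * Y ^ η := by
    have : a * Real.log Y ≤ a * (Y ^ η / η) := by gcongr
    have e : a * (Y ^ η / η) = a * (1 / η) * Y ^ η := by ring
    nlinarith
  calc (a * Real.log Y + a) ^ k ≤ ((a * (1 / η) + a + 1) * Y ^ η) ^ k := by gcongr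
    _ = (a * (1 / η) + a + 1) ^ k * Y ^ (η * k) := by
      rw [mul_pow, ← Real.rpow_natCast (Y ^ η), ← Real.rpow_mul (by positivity)]
    _ ≤ _ := by
      have hle : η * k ≤ ε := by
        rw [hη, div_mul_eq_mul_div, div_le_iff₀ (by positivity)]
        nlinarith
      have := Real.rpow_le_rpow_of_exponent_le hY hle
      gcongr

lemma exists_eq_mul_of_powerful {m k : ℕ} (hk : 0 < k)
    (h : ∀ p : ℕ, p.Prime → ¬ p ∣ m → p ∣ k → p ^ 2 ∣ k) :
    ∃ s b a : ℕ, s ∣ m ∧ 0 < b ∧ 0 < a ∧ k = s * (b ^ 3 * a ^ 2) := by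
  obtain ⟨c, e, hke, hc⟩ := Nat.sq_mul_squarefree k
  have hc0 : 0 < c := Nat.pos_of_ne_zero (by rintro rfl; simp at hke; omega)
  have he0 : 0 < e := Nat.pos_of_ne_zero (by rintro rfl; simp at hke; omega)
  obtain ⟨b, hb⟩ := Nat.gcd_dvd_left c m
  set s := Nat.gcd c m with hs
  have hb0 : 0 < b := Nat.pos_of_ne_zero (by rintro rfl; simp at hb; omega)
  have hbsq : Squarefree b := hc.squarefree_of_dvd ⟨s, by rw [hb, mul_comm]⟩
  have hbe : b ∣ e := by
    rw [← Nat.prod_primeFactors_of_squarefree hbsq]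
    refine Finset.prod_primes_dvd _ (fun p hp => (Nat.prime_of_mem_primeFactors hp).prime) ?_
    intro p hp
    have hpp := Nat.prime_of_mem_primeFactors hp
    have hpb := Nat.dvd_of_mem_primeFactors hp
    have hpc : p ∣ c := hb ▸ hpb.mul_left s
    have hpm : ¬ p ∣ m := by
      intro hpm
      have hps : p ∣ s := Nat.dvd_gcd hpc hpm
      have : p * p ∣ c := hb ▸ mul_dvd_mul hps hpb
      exact hpp.one_lt.ne' (Nat.isUnit_iff.1 (hc p this))
    have h2 := h p hpp hpm (hke ▸ hpc.mul_left _)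
    by_contra hpe
    have hcop : Nat.Coprime (p ^ 2) (e ^ 2) :=
      Nat.Coprime.pow 2 2 ((Nat.Prime.coprime_iff_not_dvd hpp).2 hpe)
    have h3 : p ^ 2 ∣ c := by
      rw [← hke] at h2
      exact hcop.dvd_of_dvd_mul_left h2
    exact hpp.one_lt.ne' (Nat.isUnit_iff.1 (hc p (by rwa [sq] at h3)))
  obtain ⟨a, rfl⟩ := hbe
  refine ⟨s, b, a, Nat.gcd_dvd_right c m, hb0, Nat.pos_of_mul_pos_left he0, ?_⟩
  rw [← hke, hb]
  ring

/-- Integers up to `Y` which are powerful away from `m` are rare. -/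
lemma card_powerful_le {m Y : ℕ} (hm : m ≠ 0) (T : Finset ℕ)
    (hT : ∀ k ∈ T, 0 < k ∧ k ≤ Y ∧ ∀ p : ℕ, p.Prime → ¬ p ∣ m → p ∣ k → p ^ 2 ∣ k) :
    (T.card : ℝ) ≤ m.divisors.card * (√Y * ∑ b ∈ Finset.Icc 1 Y, (1 : ℝ) / b) := by
  set U : Finset (ℕ × (Σ _ : ℕ, ℕ)) := m.divisors ×ˢ
    ((Finset.Icc 1 Y).sigma fun b => Finset.Icc 1 (Nat.sqrt Y / b)) with hU
  have hsub : T ⊆ U.image fun p => p.1 * (p.2.1 ^ 3 * p.2.2 ^ 2) := by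
    intro k hk
    obtain ⟨hk0, hkY, hp⟩ := hT k hk
    obtain ⟨s, b, a, hsm, hb, ha, hke⟩ := exists_eq_mul_of_powerful hk0 hp
    have hs : 0 < s := Nat.pos_of_ne_zero (by rintro rfl; simp at hke; omega)
    have h1 : b ^ 3 * a ^ 2 ≤ Y := by
      refine le_trans ?_ hkY
      rw [hke]
      exact Nat.le_mul_of_pos_left _ hs
    have h2 : (a * b) * (a * b) ≤ b ^ 3 * a ^ 2 := by
      calc (a * b) * (a * b) = b ^ 2 * a ^ 2 := by ring
        _ ≤ b ^ 3 * a ^ 2 := by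
          exact Nat.mul_le_mul_right _ (Nat.pow_le_pow_right hb (by norm_num))
    have h3 : b ≤ Y := by
      refine le_trans ?_ h1
      calc b = b ^ 1 * 1 := by ring
        _ ≤ b ^ 3 * a ^ 2 := by
          apply Nat.mul_le_mul
          · exact Nat.pow_le_pow_right hb (by norm_num)
          · exact Nat.one_le_pow _ _ ha
    refine Finset.mem_image.2 ⟨(s, ⟨b, a⟩), ?_, hke.symm⟩
    simp only [hU, Finset.mem_product, Nat.mem_divisors, Finset.mem_sigma, Finset.mem_Icc]
    refine ⟨⟨hsm, hm⟩, ⟨hb, h3⟩, ha, ?_⟩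
    rw [Nat.le_div_iff_mul_le hb]
    exact Nat.le_sqrt.2 (h2.trans h1)
  have hcard : T.card ≤ m.divisors.card * ∑ b ∈ Finset.Icc 1 Y, (Nat.sqrt Y / b) := by
    refine (Finset.card_le_card hsub).trans (Finset.card_image_le.trans ?_)
    rw [hU, Finset.card_product, Finset.card_sigma]
    simp
  calc (T.card : ℝ) ≤ ((m.divisors.card * ∑ b ∈ Finset.Icc 1 Y, (Nat.sqrt Y / b) : ℕ) : ℝ) := by
        exact_mod_cast hcard
    _ = m.divisors.card * ∑ b ∈ Finset.Icc 1 Y, ((Nat.sqrt Y / b : ℕ) : ℝ) := by push_cast; rfl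
    _ ≤ _ := by
      gcongr
      rw [Finset.mul_sum]
      refine Finset.sum_le_sum fun b hb => ?_
      refine Nat.cast_div_le.trans ?_
      rw [mul_one_div]
      gcongr
      exact Real.nat_sqrt_le_real_sqrt

lemma card_divisors_le_ncard (K : Type*) [Field K] [NumberField K] {m : ℕ} (hm : m ≠ 0) :
    m.divisors.card ≤ {A : Ideal (𝓞 K) | A ∣ Ideal.span {(m : 𝓞 K)}}.ncard := by
  have hne : Ideal.span {(m : 𝓞 K)} ≠ 0 := by
    rw [Ideal.zero_eq_bot, Ne, Ideal.span_singleton_eq_bot]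
    exact_mod_cast hm
  rw [← Set.ncard_coe_finset]
  refine Set.ncard_le_ncard_of_injOn (fun s => Ideal.span {(s : 𝓞 K)}) ?_ ?_
    (finite_ideal_divisors hne)
  · intro s hs
    have hs' : s ∣ m := Nat.dvd_of_mem_divisors (Finset.mem_coe.1 hs)
    simp only [Set.mem_ofPred_eq, Ideal.dvd_iff_le, Ideal.span_singleton_le_span_singleton]
    exact_mod_cast Nat.cast_dvd_cast hs'
  · intro s _ t _ h
    have := congrArg Ideal.absNorm h
    simp only [Ideal.absNorm_span_natCast] at this
    exact Nat.pow_left_injective Module.finrank_pos.ne' this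

section Coordinates

/-- The conjugate `ι (τ α)` of an algebraic integer. -/
def cnj (ι : K →+* ℝ) (τ : K ≃ₐ[ℚ] K) (α : 𝓞 K) : ℝ := ι (τ (α : K))

variable (ι : K →+* ℝ) (τ : K ≃ₐ[ℚ] K)

lemma cnj_add (α β : 𝓞 K) : cnj ι τ (α + β) = cnj ι τ α + cnj ι τ β := by
  simp only [cnj, co_add, map_add]

lemma cnj_sub (α β : 𝓞 K) : cnj ι τ (α - β) = cnj ι τ α - cnj ι τ β := by
  simp only [cnj, co_sub, map_sub]

lemma cnj_mul (α β : 𝓞 K) : cnj ι τ (α * β) = cnj ι τ α * cnj ι τ β := by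
  simp only [cnj, co_mul, map_mul]

lemma cnj_pow (α : 𝓞 K) (k : ℕ) : cnj ι τ (α ^ k) = cnj ι τ α ^ k := by
  simp only [cnj, co_pow, map_pow]

lemma cnj_intCast (a : ℤ) : cnj ι τ (a : 𝓞 K) = a := by
  have : (((a : 𝓞 K)) : K) = (a : K) := map_intCast (algebraMap (𝓞 K) K) a
  simp only [cnj, this, map_intCast]

lemma cnj_zero : cnj ι τ (0 : 𝓞 K) = 0 := by
  have := cnj_intCast ι τ 0
  simpa using this

lemma cnj_injective : Function.Injective (cnj ι τ) := fun _ _ h =>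
  RingOfIntegers.ext (τ.injective (ι.injective h))

lemma cnj_ne_zero {α : 𝓞 K} (h : α ≠ 0) : cnj ι τ α ≠ 0 := fun h0 =>
  h (cnj_injective ι τ (h0.trans (cnj_zero ι τ).symm))

lemma TotPos.cnj_pos {α : 𝓞 K} (h : TotPos α) : 0 < cnj ι τ α :=
  h (ι.comp (τ : K →+* K))

/-- The action of the Galois group on the ring of integers. -/
def galInt (σ : K ≃ₐ[ℚ] K) : 𝓞 K →+* 𝓞 K := RingOfIntegers.mapRingHom (σ : K →+* K)

lemma coe_galInt (σ : K ≃ₐ[ℚ] K) (α : 𝓞 K) : ((galInt σ α : 𝓞 K) : K) = σ (α : K) := rfl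

lemma cnj_galInt (σ : K ≃ₐ[ℚ] K) (α : 𝓞 K) : cnj ι τ (galInt σ α) = cnj ι (τ * σ) α := rfl

lemma galMap_span (σ : K ≃ₐ[ℚ] K) (α : 𝓞 K) :
    galMap σ (Ideal.span {α}) = Ideal.span {galInt σ α} := by
  rw [galMap, Ideal.map_span, Set.image_singleton]
  rfl

lemma TotPos.galInt {α : 𝓞 K} (h : TotPos α) (σ : K ≃ₐ[ℚ] K) : TotPos (galInt σ α) :=
  fun v => h (v.comp (σ : K →+* K))

lemma absNorm_span_eq_prod [IsGalois ℚ K] (α : 𝓞 K) :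
    (Ideal.absNorm (Ideal.span {α}) : ℝ) = ∏ τ : K ≃ₐ[ℚ] K, |cnj ι τ α| := by
  rw [Ideal.absNorm_span_singleton, ← Finset.abs_prod]
  have h1 : ((Algebra.norm ℤ α : ℤ) : K) = ∏ τ : K ≃ₐ[ℚ] K, τ (α : K) := by
    rw [← Algebra.norm_eq_prod_automorphisms, RingOfIntegers.coe_eq_algebraMap,
      ← Algebra.coe_norm_int]
    simp
  have h2 : ((Algebra.norm ℤ α : ℤ) : ℝ) = ∏ τ : K ≃ₐ[ℚ] K, cnj ι τ α := by
    have := congrArg ι h1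
    rwa [map_intCast, map_prod] at this
  rw [← h2, Nat.cast_natAbs]
  push_cast
  rfl

lemma one_le_absNorm_span {α : 𝓞 K} (h : α ≠ 0) : 1 ≤ Ideal.absNorm (Ideal.span {α}) := by
  rw [Nat.one_le_iff_ne_zero, Ne, Ideal.absNorm_eq_zero_iff, Ideal.span_singleton_eq_bot]
  exact h

lemma absNorm_dvd_of_mem {I : Ideal (𝓞 K)} {α : 𝓞 K} (h : α ∈ I) :
    Ideal.absNorm I ∣ Ideal.absNorm (Ideal.span {α}) :=
  Ideal.absNorm_dvd_absNorm_of_le ((Ideal.span_singleton_le_iff_mem _).2 h)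

lemma finite_cnj_le [IsGalois ℚ K] (B : ℝ) : {α : 𝓞 K | ∀ τ, |cnj ι τ α| ≤ B}.Finite := by
  refine Set.Finite.of_injOn (f := fun α => fun τ : K ≃ₐ[ℚ] K => ⌊cnj ι τ α⌋)
    (t := Set.pi Set.univ fun _ => Set.Icc ⌊-B⌋ ⌊B⌋) ?_ ?_
    (Set.Finite.pi fun _ => Set.finite_Icc _ _)
  · intro α hα τ _
    have := abs_le.1 (hα τ)
    exact ⟨Int.floor_le_floor this.1, Int.floor_le_floor this.2⟩
  · intro α _ β _ h
    by_contra hne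
    have h1 := one_le_absNorm_span (sub_ne_zero.2 hne)
    have h2 : (Ideal.absNorm (Ideal.span {α - β}) : ℝ) < 1 := by
      rw [absNorm_span_eq_prod ι]
      refine (Finset.prod_lt_prod_of_nonempty (g := fun _ => (1 : ℝ)) (fun τ _ => ?_)
        (fun τ _ => ?_) Finset.univ_nonempty).trans_eq (by simp)
      · exact abs_pos.2 (cnj_ne_zero ι τ (sub_ne_zero.2 hne))
      · rw [cnj_sub]
        exact Int.abs_sub_lt_one_of_floor_eq_floor (congrFun h τ)
    have : (1 : ℝ) ≤ (Ideal.absNorm (Ideal.span {α - β}) : ℝ) := by exact_mod_cast h1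
    linarith

lemma card_gal [IsGalois ℚ K] : Fintype.card (K ≃ₐ[ℚ] K) = Module.finrank ℚ K := by
  rw [← Nat.card_eq_fintype_card, IsGalois.card_aut_eq_finrank]

/-- A set of trace-zero algebraic integers in a box whose differences have large norm is small. -/
lemma card_le_of_separated [IsGalois ℚ K] {n : ℕ} (hn : Module.finrank ℚ K = n)
    {S : Finset (𝓞 K)} {B D : ℝ} (hD : 0 < D) (hB : 0 < B) (hDB : D ≤ B ^ n)
    (htr : ∀ α ∈ S, ∑ τ : K ≃ₐ[ℚ] K, cnj ι τ α = 0)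
    (hbox : ∀ α ∈ S, ∀ τ : K ≃ₐ[ℚ] K, |cnj ι τ α| ≤ B)
    (hsep : ∀ α ∈ S, ∀ β ∈ S, α ≠ β → D ≤ (Ideal.absNorm (Ideal.span {α - β}) : ℝ)) :
    (S.card : ℝ) ≤ (4 * n * B) ^ (n - 1) / D ^ (((n - 1 : ℕ) : ℝ) / n) := by
  have hn0 : 0 < n := hn ▸ Module.finrank_pos
  have hn1 : (1 : ℝ) ≤ n := by exact_mod_cast hn0
  set s := D ^ ((1 : ℝ) / n) / n with hs
  have hs0 : 0 < s := by positivity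
  have hns : (n * s) ^ n = D := by
    rw [hs, mul_div_cancel₀ _ (by positivity), ← Real.rpow_natCast, ← Real.rpow_mul hD.le]
    rw [one_div, inv_mul_cancel₀ (by positivity), Real.rpow_one]
  have hsB : s ≤ B := by
    have h1 : n * s ≤ B := by
      by_contra h
      push Not at h
      have := pow_lt_pow_left₀ h hB.le hn0.ne'
      linarith
    nlinarith
  set f : 𝓞 K → ({τ : K ≃ₐ[ℚ] K // τ ≠ 1} → ℤ) := fun α τ => ⌊cnj ι τ.1 α / s⌋ with hf
  have hinj : Set.InjOn f S := by
    intro α hα β hβ h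
    by_contra hne
    have h1 := hsep α hα β hβ hne
    have hτ : ∀ τ : K ≃ₐ[ℚ] K, τ ≠ 1 → |cnj ι τ (α - β)| ≤ s := by
      intro τ hτ
      have := Int.abs_sub_lt_one_of_floor_eq_floor (congrFun h ⟨τ, hτ⟩)
      rw [← sub_div, abs_div, abs_of_pos hs0, div_lt_one hs0] at this
      rw [cnj_sub]
      exact this.le
    have hcard : (Finset.univ.erase (1 : K ≃ₐ[ℚ] K)).card = n - 1 := by
      rw [Finset.card_erase_of_mem (Finset.mem_univ _), Finset.card_univ, card_gal, hn]
    have h2 : |cnj ι 1 (α - β)| ≤ (n - 1 : ℕ) * s := by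
      have hsum : ∑ τ : K ≃ₐ[ℚ] K, cnj ι τ (α - β) = 0 := by
        simp only [cnj_sub, Finset.sum_sub_distrib, htr α hα, htr β hβ, sub_zero]
      rw [← Finset.add_sum_erase _ _ (Finset.mem_univ (1 : K ≃ₐ[ℚ] K))] at hsum
      rw [eq_neg_of_add_eq_zero_left hsum, abs_neg]
      refine (Finset.abs_sum_le_sum_abs _ _).trans ?_
      refine (Finset.sum_le_card_nsmul _ _ s fun τ h => hτ τ (Finset.ne_of_mem_erase h)).trans ?_
      rw [hcard, nsmul_eq_mul]
    have h3 : (Ideal.absNorm (Ideal.span {α - β}) : ℝ) ≤ (n - 1 : ℕ) * s * s ^ (n - 1) := by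
      rw [absNorm_span_eq_prod ι, ← Finset.mul_prod_erase _ _ (Finset.mem_univ (1 : K ≃ₐ[ℚ] K))]
      refine mul_le_mul h2 ?_ (Finset.prod_nonneg fun _ _ => abs_nonneg _) (by positivity)
      refine (Finset.prod_le_prod (fun _ _ => abs_nonneg _)
        fun τ h => hτ τ (Finset.ne_of_mem_erase h)).trans_eq ?_
      rw [Finset.prod_const, hcard]
    have h4 : ((n - 1 : ℕ) : ℝ) * s * s ^ (n - 1) < (n * s) ^ n := by
      have e : s * s ^ (n - 1) = s ^ n := by
        rw [← pow_succ', Nat.sub_add_cancel hn0]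
      rw [mul_assoc, e, mul_pow]
      have h5 : ((n - 1 : ℕ) : ℝ) < (n : ℝ) ^ n := by
        have : n - 1 < n ^ n := lt_of_lt_of_le (by omega) (Nat.le_self_pow hn0.ne' n)
        exact_mod_cast this
      gcongr
    linarith
  have hmaps : S.image f ⊆ Fintype.piFinset fun _ => Finset.Icc ⌊-(B / s)⌋ ⌊B / s⌋ := by
    intro g hg
    obtain ⟨α, hα, rfl⟩ := Finset.mem_image.1 hg
    refine Fintype.mem_piFinset.2 fun τ => Finset.mem_Icc.2 ?_
    have := abs_le.1 (hbox α hα τ.1)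
    refine ⟨Int.floor_le_floor ?_, Int.floor_le_floor ?_⟩
    · rw [← neg_div]; gcongr; exact this.1
    · gcongr; exact this.2
  have hcard2 : Fintype.card {τ : K ≃ₐ[ℚ] K // τ ≠ 1} = n - 1 := by
    rw [Fintype.card_subtype_compl, Fintype.card_subtype_eq, card_gal, hn]
  have h1 : S.card ≤ (⌊B / s⌋ + 1 - ⌊-(B / s)⌋).toNat ^ (n - 1) := by
    rw [← Finset.card_image_of_injOn hinj]
    refine (Finset.card_le_card hmaps).trans ?_
    rw [Fintype.card_piFinset]
    simp [hcard2]
  have h2 : (((⌊B / s⌋ + 1 - ⌊-(B / s)⌋).toNat : ℕ) : ℝ) ≤ 4 * (B / s) := by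
    have hBs : 1 ≤ B / s := by rwa [one_le_div hs0]
    have hi : 0 ≤ ⌊B / s⌋ + 1 - ⌊-(B / s)⌋ := by
      have := Int.floor_le_floor (show -(B / s) ≤ B / s by linarith)
      omega
    have : (((⌊B / s⌋ + 1 - ⌊-(B / s)⌋).toNat : ℕ) : ℝ) = ((⌊B / s⌋ + 1 - ⌊-(B / s)⌋ : ℤ) : ℝ) := by
      exact_mod_cast congrArg (Int.cast : ℤ → ℝ) (Int.toNat_of_nonneg hi)
    rw [this]
    push_cast
    have a1 := Int.floor_le (B / s)
    have a2 := Int.lt_floor_add_one (-(B / s))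
    linarith
  calc (S.card : ℝ) ≤ (((⌊B / s⌋ + 1 - ⌊-(B / s)⌋).toNat : ℕ) : ℝ) ^ (n - 1) := by exact_mod_cast h1
    _ ≤ (4 * (B / s)) ^ (n - 1) := by gcongr
    _ = (4 * n * B) ^ (n - 1) / D ^ (((n - 1 : ℕ) : ℝ) / n) := by
      have : D ^ (((n - 1 : ℕ) : ℝ) / n) = (D ^ ((1 : ℝ) / n)) ^ (n - 1) := by
        rw [← Real.rpow_natCast, ← Real.rpow_mul hD.le]
        congr 1
        ring
      rw [this, ← div_pow, hs]
      congr 1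
      field_simp

end Coordinates

lemma dvd_span_absNorm (I : Ideal (𝓞 K)) : I ∣ Ideal.span {((Ideal.absNorm I : ℕ) : 𝓞 K)} := by
  rw [Ideal.dvd_iff_le, Ideal.span_singleton_le_iff_mem]
  exact Ideal.absNorm_mem I

lemma span_natCast_ne_zero {m : ℕ} (hm : m ≠ 0) : Ideal.span {(m : 𝓞 K)} ≠ 0 := by
  rw [Ideal.zero_eq_bot, Ne, Ideal.span_singleton_eq_bot]
  exact_mod_cast hm

/-- There are few algebraic integers of given norm in a box. -/
lemma exists_card_norm_eq_le [IsGalois ℚ K] (ι : K →+* ℝ) {ε : ℝ} (hε : 0 < ε) :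
    ∃ C : ℝ, 1 ≤ C ∧ ∀ B : ℝ, 1 ≤ B → ∀ k : ℕ, ∀ S : Finset (𝓞 K),
      (∀ α ∈ S, α ≠ 0 ∧ Ideal.absNorm (Ideal.span {α}) = k ∧
        ∀ τ : K ≃ₐ[ℚ] K, |cnj ι τ α| ≤ B) → (S.card : ℝ) ≤ C * B ^ ε := by
  set n := Module.finrank ℚ K with hn
  have hn0 : 0 < n := Module.finrank_pos
  have hn0' : (0 : ℝ) < n := by exact_mod_cast hn0
  obtain ⟨C1, hC1, hdiv⟩ := exists_ncard_ideal_divisors_le K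
    (show 0 < ε / (2 * n ^ 2) by positivity)
  obtain ⟨C2, hC2, hlog⟩ := exists_log_add_pow_le (show 0 < ε / 2 by positivity)
    (2 * n) (by positivity) n
  set M := (finite_cnj_le (K := K) ι 3).toFinset.card with hM
  have hM1 : 1 ≤ M := by
    rw [hM, Nat.one_le_iff_ne_zero, Finset.card_ne_zero]
    refine ⟨0, ?_⟩
    simp only [Set.Finite.mem_toFinset, Set.mem_ofPred_eq, cnj_zero, abs_zero]
    intro _; norm_num
  refine ⟨M * (C1 * C2), ?_, fun B hB k S hS => ?_⟩
  · have : (1 : ℝ) ≤ M := by exact_mod_cast hM1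
    exact one_le_mul_of_one_le_of_one_le this (one_le_mul_of_one_le_of_one_le hC1 hC2)
  rcases S.eq_empty_or_nonempty with rfl | ⟨α0, hα0⟩
  · simp; positivity
  have hk : 1 ≤ k := (hS α0 hα0).2.1 ▸ one_le_absNorm_span (hS α0 hα0).1
  have hkB : (k : ℝ) ≤ B ^ n := by
    rw [← (hS α0 hα0).2.1, absNorm_span_eq_prod ι]
    refine (Finset.prod_le_prod (fun _ _ => abs_nonneg _) fun τ _ =>
      (hS α0 hα0).2.2 τ).trans_eq ?_
    rw [Finset.prod_const, Finset.card_univ, card_gal]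
  set L := Real.log B with hL
  have hL0 : 0 ≤ L := Real.log_nonneg hB
  have hlogbd : ∀ α ∈ S, ∀ τ : K ≃ₐ[ℚ] K, |(Real.log |cnj ι τ α|)| ≤ n * L := by
    intro α hα τ
    obtain ⟨hne, hnk, hb⟩ := hS α hα
    have hpos := abs_pos.2 (cnj_ne_zero ι τ hne)
    have hup : Real.log |cnj ι τ α| ≤ L := Real.log_le_log hpos (hb τ)
    have hn1 : (1 : ℝ) ≤ n := by exact_mod_cast hn0
    have hlow : (1 : ℝ) ≤ |cnj ι τ α| * B ^ (n - 1) := by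
      have h1 : (1 : ℝ) ≤ (Ideal.absNorm (Ideal.span {α}) : ℝ) := by
        exact_mod_cast one_le_absNorm_span hne
      rw [absNorm_span_eq_prod ι, ← Finset.mul_prod_erase _ _ (Finset.mem_univ τ)] at h1
      refine h1.trans (mul_le_mul_of_nonneg_left ?_ hpos.le)
      refine (Finset.prod_le_prod (fun _ _ => abs_nonneg _) fun τ _ => hb τ).trans_eq ?_
      rw [Finset.prod_const, Finset.card_erase_of_mem (Finset.mem_univ _), Finset.card_univ,
        card_gal]
    have hlow2 : 0 ≤ Real.log |cnj ι τ α| + (n - 1 : ℕ) * L := by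
      have := Real.log_nonneg hlow
      rwa [Real.log_mul hpos.ne' (by positivity), Real.log_pow] at this
    have hcast : ((n - 1 : ℕ) : ℝ) ≤ n := by exact_mod_cast Nat.sub_le n 1
    rw [abs_le]
    constructor <;> nlinarith
  set D := (finite_ideal_divisors (K := K) (span_natCast_ne_zero (m := k) (by omega))).toFinset
    with hD
  set f : 𝓞 K → Ideal (𝓞 K) × ((K ≃ₐ[ℚ] K) → ℤ) :=
    fun α => (Ideal.span {α}, fun τ => ⌊Real.log |cnj ι τ α|⌋) with hf
  have himg : S.image f ⊆ D ×ˢ Fintype.piFinset fun _ => Finset.Icc ⌊-(n * L)⌋ ⌊n * L⌋ := by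
    intro g hg
    obtain ⟨α, hα, rfl⟩ := Finset.mem_image.1 hg
    refine Finset.mem_product.2 ⟨?_, Fintype.mem_piFinset.2 fun τ => Finset.mem_Icc.2 ?_⟩
    · simp only [hD, Set.Finite.mem_toFinset, Set.mem_ofPred_eq]
      rw [← (hS α hα).2.1]
      exact dvd_span_absNorm _
    · have := abs_le.1 (hlogbd α hα τ)
      exact ⟨Int.floor_le_floor this.1, Int.floor_le_floor this.2⟩
  have hfib : S.card ≤ M * (S.image f).card := by
    refine Finset.card_le_mul_card_image S M fun g hg => ?_
    obtain ⟨β, hβ, rfl⟩ := Finset.mem_image.1 hg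
    have hu : ∀ α ∈ S.filter fun α => f α = f β, ∃ u : 𝓞 K, α = β * u := by
      intro α hα
      obtain ⟨_, h⟩ := Finset.mem_filter.1 hα
      have h1 : Ideal.span {α} = Ideal.span {β} := congrArg Prod.fst h
      exact Ideal.span_singleton_le_span_singleton.1 h1.le
    choose! u hu using hu
    refine Finset.card_le_card_of_injOn u ?_ ?_
    · intro α hα
      have hα' := Finset.mem_filter.1 hα
      simp only [Set.Finite.coe_toFinset, Set.mem_ofPred_eq]
      intro τ
      have h2 := congrFun (congrArg Prod.snd hα'.2) τ
      have h3 := Int.abs_sub_lt_one_of_floor_eq_floor h2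
      have hαe := hu α hα
      have hune : u α ≠ 0 := by
        intro h0
        rw [h0, mul_zero] at hαe
        exact (hS α hα'.1).1 hαe
      have hβp := abs_pos.2 (cnj_ne_zero ι τ (hS β hβ).1)
      have hup := abs_pos.2 (cnj_ne_zero ι τ hune)
      rw [show cnj ι τ α = cnj ι τ β * cnj ι τ (u α) by rw [← cnj_mul, ← hαe], abs_mul,
        Real.log_mul hβp.ne' hup.ne', add_sub_cancel_left] at h3
      have h4 := (abs_lt.1 h3).2
      rw [Real.log_lt_iff_lt_exp hup] at h4
      have := Real.exp_one_lt_d9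
      linarith
    · intro α hα α' hα' h
      rw [hu α hα, hu α' hα', h]
  have hDcard : (D.card : ℝ) ≤ C1 * B ^ (ε / 2) := by
    have h1 := hdiv _ (span_natCast_ne_zero (K := K) (m := k) (by omega))
    rw [Set.ncard_eq_toFinset_card _ (finite_ideal_divisors (span_natCast_ne_zero (by omega))),
      Ideal.absNorm_span_natCast, RingOfIntegers.rank] at h1
    refine h1.trans ?_
    have h0 : ((k ^ n : ℕ) : ℝ) ≤ B ^ (n ^ 2) := by
      push_cast
      calc (k : ℝ) ^ n ≤ (B ^ n) ^ n := by gcongr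
        _ = B ^ (n ^ 2) := by rw [← pow_mul, sq]
    calc C1 * ((k ^ n : ℕ) : ℝ) ^ (ε / (2 * n ^ 2)) ≤ C1 * (B ^ (n ^ 2)) ^ (ε / (2 * n ^ 2)) := by
          gcongr
      _ = C1 * B ^ (ε / 2) := by
          rw [← Real.rpow_natCast, ← Real.rpow_mul (by positivity)]
          congr 2
          push_cast
          field_simp
  have hpi : ((Fintype.piFinset fun _ : K ≃ₐ[ℚ] K => Finset.Icc ⌊-(n * L)⌋ ⌊n * L⌋).card : ℝ) ≤
      C2 * B ^ (ε / 2) := by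
    rw [Fintype.card_piFinset, Finset.prod_const, Finset.card_univ, card_gal, Int.card_Icc]
    refine le_trans ?_ (hlog B hB)
    have hi : 0 ≤ ⌊n * L⌋ + 1 - ⌊-(n * L)⌋ := by
      have := Int.floor_le_floor (show -(n * L) ≤ n * L by nlinarith)
      omega
    have : (((⌊n * L⌋ + 1 - ⌊-(n * L)⌋).toNat : ℕ) : ℝ) = ((⌊n * L⌋ + 1 - ⌊-(n * L)⌋ : ℤ) : ℝ) := by
      exact_mod_cast congrArg (Int.cast : ℤ → ℝ) (Int.toNat_of_nonneg hi)
    push_cast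
    rw [this]
    have a1 := Int.floor_le (n * L)
    have a2 := Int.lt_floor_add_one (-(n * L))
    have hn1 : (1 : ℝ) ≤ n := by exact_mod_cast hn0
    refine pow_le_pow_left₀ (by exact_mod_cast hi) ?_ n
    push_cast
    linarith
  calc (S.card : ℝ) ≤ M * ((S.image f).card : ℝ) := by exact_mod_cast hfib
    _ ≤ M * ((D.card : ℝ) *
        ((Fintype.piFinset fun _ : K ≃ₐ[ℚ] K => Finset.Icc ⌊-(n * L)⌋ ⌊n * L⌋).card : ℝ)) := by
      gcongr
      rw [← Nat.cast_mul, ← Finset.card_product]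
      exact_mod_cast Finset.card_le_card himg
    _ ≤ M * ((C1 * B ^ (ε / 2)) * (C2 * B ^ (ε / 2))) := by gcongr
    _ = M * (C1 * C2) * (B ^ (ε / 2) * B ^ (ε / 2)) := by ring
    _ = _ := by
      rw [← Real.rpow_add (by positivity), add_halves]

lemma lex_affine_convex {f0 f1 g0 g1 a b c : ℝ} (hab : a < b) (hbc : b < c)
    (ha : 0 < f0 + a * f1 ∨ f0 + a * f1 = 0 ∧ 0 ≤ g0 + a * g1)
    (hc : 0 < f0 + c * f1 ∨ f0 + c * f1 = 0 ∧ 0 ≤ g0 + c * g1) :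
    0 < f0 + b * f1 ∨ f0 + b * f1 = 0 ∧ 0 ≤ g0 + b * g1 := by
  have e : ∀ x y : ℝ, (c - a) * (x + b * y) = (c - b) * (x + a * y) + (b - a) * (x + c * y) := by
    intro x y; ring
  have h1 : 0 < c - b := by linarith
  have h2 : 0 < b - a := by linarith
  have h3 : 0 < c - a := by linarith
  rcases ha with ha | ha <;> rcases hc with hc | hc
  · left
    have := e f0 f1
    exact pos_of_mul_pos_right (this ▸ by positivity) h3.le
  · left
    have := e f0 f1
    rw [hc.1, mul_zero, add_zero] at this
    exact pos_of_mul_pos_right (this ▸ by positivity) h3.le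
  · left
    have := e f0 f1
    rw [ha.1, mul_zero, zero_add] at this
    exact pos_of_mul_pos_right (this ▸ by positivity) h3.le
  · right
    have t1 := e f0 f1
    rw [ha.1, hc.1, mul_zero, mul_zero, add_zero] at t1
    have t2 := e g0 g1
    have p1 := mul_nonneg h1.le ha.2
    have p2 := mul_nonneg h2.le hc.2
    exact ⟨(mul_eq_zero.1 t1).resolve_left h3.ne', nonneg_of_mul_nonneg_right (by linarith) h3⟩

section Domain

variable (ι : K →+* ℝ)

lemma exists_place_eq (τ : K ≃ₐ[ℚ] K) :
    ∃ w : InfinitePlace K, ∀ α : 𝓞 K, w (α : K) = |cnj ι τ α| := by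
  refine ⟨InfinitePlace.mk (Complex.ofRealHom.comp (ι.comp (τ : K →+* K))), fun α => ?_⟩
  rw [InfinitePlace.apply]
  simp [cnj]

lemma exists_minkowski (K : Type*) [Field K] [NumberField K] :
    ∃ B : ℝ, 0 < B ∧ ∀ α : 𝓞 K, α ≠ 0 → ∃ β : 𝓞 K, β ≠ 0 ∧ ∀ w : InfinitePlace K,
      w (β : K) ^ 2 * w (α : K) ≤
        B ^ 2 * (Ideal.absNorm (Ideal.span {α}) : ℝ) ^ ((1 : ℝ) / Module.finrank ℚ K) := by
  set n := Module.finrank ℚ K with hn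
  have hn0 : 0 < n := Module.finrank_pos
  set m := mixedEmbedding.minkowskiBound K (1 : (FractionalIdeal (nonZeroDivisors (𝓞 K)) K)ˣ)
    with hm
  have hmtop : m < ⊤ := mixedEmbedding.minkowskiBound_lt_top K _
  set B : NNReal := m.toNNReal + 1 with hB
  have hB1 : 1 ≤ B := by simp [hB]
  refine ⟨B, by positivity, fun α hα => ?_⟩
  set N := (Ideal.absNorm (Ideal.span {α}) : ℝ) with hN
  have hN1 : 1 ≤ N := by
    rw [hN]; exact_mod_cast one_le_absNorm_span hα
  have hwα : ∀ w : InfinitePlace K, 0 < w (α : K) := fun w =>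
    InfinitePlace.pos_iff.2 (RingOfIntegers.coe_ne_zero_iff.2 hα)
  set Nn : NNReal := Real.toNNReal (N ^ ((1 : ℝ) / n)) with hNn
  set f : InfinitePlace K → NNReal := fun w =>
    B * NNReal.sqrt (Nn / Real.toNNReal (w (α : K))) with hf
  have hf2 : ∀ w, ((f w : NNReal) : ℝ) ^ 2 * w (α : K) = (B : ℝ) ^ 2 * N ^ ((1 : ℝ) / n) := by
    intro w
    have h1 : f w ^ 2 = B ^ 2 * (Nn / Real.toNNReal (w (α : K))) := by
      rw [hf, mul_pow, NNReal.sq_sqrt]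
    have h2 := congrArg (NNReal.toReal) h1
    push_cast at h2
    rw [h2, hNn, Real.coe_toNNReal _ (by positivity), Real.coe_toNNReal _ (hwα w).le]
    have := (hwα w).ne'
    field_simp
  have hprod : (∏ w, f w ^ w.mult : NNReal) = B ^ n := by
    have h1 : ((∏ w, f w ^ w.mult : NNReal) : ℝ) ^ 2 * N = ((B : ℝ) ^ n) ^ 2 * N := by
      have hNprod : N = ∏ w : InfinitePlace K, w (α : K) ^ w.mult := by
        rw [InfinitePlace.prod_eq_abs_norm, hN, Ideal.absNorm_span_singleton, Nat.cast_natAbs,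
          RingOfIntegers.coe_eq_algebraMap, ← Algebra.coe_norm_int]
        push_cast
        rfl
      calc ((∏ w, f w ^ w.mult : NNReal) : ℝ) ^ 2 * N
          = ∏ w, ((f w : ℝ) ^ 2 * w (α : K)) ^ w.mult := by
            conv_lhs => rw [hNprod]
            push_cast
            rw [← Finset.prod_pow, ← Finset.prod_mul_distrib]
            refine Finset.prod_congr rfl fun w _ => ?_
            ring
        _ = ((B : ℝ) ^ 2 * N ^ ((1 : ℝ) / n)) ^ n := by
            simp only [hf2]
            rw [Finset.prod_pow_eq_pow_sum, InfinitePlace.sum_mult_eq]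
        _ = _ := by
            rw [mul_pow, ← Real.rpow_natCast (N ^ ((1 : ℝ) / n)), ← Real.rpow_mul (by positivity),
              one_div, inv_mul_cancel₀ (by positivity), Real.rpow_one]
            ring
    have h2 := mul_right_cancel₀ (by positivity) h1
    have h3 := (pow_left_inj₀ (by positivity) (by positivity) two_ne_zero).1 h2
    exact_mod_cast h3
  have hvol : mixedEmbedding.minkowskiBound K (1 : (FractionalIdeal (nonZeroDivisors (𝓞 K)) K)ˣ) <
      MeasureTheory.volume (mixedEmbedding.convexBodyLT K f) := by
    rw [mixedEmbedding.convexBodyLT_volume]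
    have h1 : (∏ w, (f w : ENNReal) ^ w.mult) = ((B ^ n : NNReal) : ENNReal) := by
      rw [← hprod]; push_cast; rfl
    rw [← hm]
    have h2 : m < ((B ^ n : NNReal) : ENNReal) := by
      rw [← ENNReal.coe_toNNReal hmtop.ne]
      refine ENNReal.coe_lt_coe.2 (lt_of_lt_of_le (lt_add_one _) ?_)
      exact le_self_pow₀ hB1 hn0.ne'
    refine lt_of_lt_of_le h2 ?_
    have h3 : (1 : ENNReal) ≤ (mixedEmbedding.convexBodyLTFactor K : ENNReal) := by
      exact_mod_cast mixedEmbedding.one_le_convexBodyLTFactor K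
    calc ((B ^ n : NNReal) : ENNReal) = 1 * ((B ^ n : NNReal) : ENNReal) := (one_mul _).symm
      _ ≤ _ := by
        gcongr
        rw [← hprod]
  obtain ⟨β, hβ, h⟩ := mixedEmbedding.exists_ne_zero_mem_ringOfIntegers_lt K hvol
  refine ⟨β, hβ, fun w => ?_⟩
  rw [← hf2 w]
  have := (h w).le
  have h0 := (hwα w).le
  gcongr

/-- Modulo squares of units, the conjugates of an algebraic integer are balanced. -/
lemma exists_unit_cnj_le [IsGalois ℚ K] :
    ∃ C : ℝ, 1 ≤ C ∧ ∀ α : 𝓞 K, α ≠ 0 → ∃ u : (𝓞 K)ˣ, ∀ τ : K ≃ₐ[ℚ] K,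
      |cnj ι τ ((u : 𝓞 K) ^ 2 * α)| ≤
        C * (Ideal.absNorm (Ideal.span {α}) : ℝ) ^ ((1 : ℝ) / Module.finrank ℚ K) := by
  obtain ⟨B, hB0, hB⟩ := exists_minkowski K
  set n := Module.finrank ℚ K with hn
  have hn0 : 0 < n := Module.finrank_pos
  set S := (Ideal.finite_setOfPred_absNorm_le (S := 𝓞 K) ⌊B ^ n⌋₊).toFinset with hS
  set g : Ideal (𝓞 K) → 𝓞 K := fun I => if h : ∃ β : 𝓞 K, I = Ideal.span {β} then h.choose else 1
    with hg
  set c := ∑ I ∈ S, ∑ τ : K ≃ₐ[ℚ] K, 1 / |cnj ι τ (g I)| ^ 2 with hc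
  refine ⟨c * B ^ 2 + 1, ?_, fun α hα => ?_⟩
  · have : 0 ≤ c := Finset.sum_nonneg fun _ _ => Finset.sum_nonneg fun _ _ => by positivity
    nlinarith [mul_nonneg this (sq_nonneg B)]
  obtain ⟨β, hβ0, hβ⟩ := hB α hα
  set N := (Ideal.absNorm (Ideal.span {α}) : ℝ) with hN
  have hN1 : 1 ≤ N := by rw [hN]; exact_mod_cast one_le_absNorm_span hα
  have hτ : ∀ τ : K ≃ₐ[ℚ] K, |cnj ι τ β| ^ 2 * |cnj ι τ α| ≤ B ^ 2 * N ^ ((1 : ℝ) / n) := by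
    intro τ
    obtain ⟨w, hw⟩ := exists_place_eq ι τ
    rw [← hw, ← hw]
    exact hβ w
  have hmem : Ideal.span {β} ∈ S := by
    simp only [hS, Set.Finite.mem_toFinset, Set.mem_ofPred_eq]
    refine Nat.le_floor ?_
    have h1 : (Ideal.absNorm (Ideal.span {β}) : ℝ) ^ 2 * N ≤ (B ^ n) ^ 2 * N := by
      calc (Ideal.absNorm (Ideal.span {β}) : ℝ) ^ 2 * N
          = ∏ τ : K ≃ₐ[ℚ] K, (|cnj ι τ β| ^ 2 * |cnj ι τ α|) := by
            rw [hN, absNorm_span_eq_prod ι, absNorm_span_eq_prod ι, Finset.prod_mul_distrib,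
              Finset.prod_pow]
        _ ≤ ∏ _τ : K ≃ₐ[ℚ] K, (B ^ 2 * N ^ ((1 : ℝ) / n)) :=
            Finset.prod_le_prod (fun _ _ => by positivity) fun τ _ => hτ τ
        _ = _ := by
            rw [Finset.prod_const, Finset.card_univ, card_gal, ← hn, mul_pow,
              ← Real.rpow_natCast (N ^ ((1 : ℝ) / n)), ← Real.rpow_mul (by positivity),
              one_div, inv_mul_cancel₀ (by positivity), Real.rpow_one]
            ring
    have h2 := le_of_mul_le_mul_right h1 (by positivity)
    exact (pow_le_pow_iff_left₀ (by positivity) (by positivity) two_ne_zero).1 h2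
  have hgβ : Ideal.span {β} = Ideal.span {g (Ideal.span {β})} := by
    have h : ∃ β' : 𝓞 K, Ideal.span {β} = Ideal.span {β'} := ⟨β, rfl⟩
    simp only [hg]
    rw [dif_pos h]
    exact h.choose_spec
  set γ := g (Ideal.span {β}) with hγ
  obtain ⟨u, hu⟩ := Ideal.span_singleton_eq_span_singleton.1 hgβ.symm
  have hγ0 : γ ≠ 0 := by
    intro h
    rw [h, zero_mul] at hu
    exact hβ0 hu.symm
  refine ⟨u, fun τ => ?_⟩
  have hγτ := abs_pos.2 (cnj_ne_zero ι τ hγ0)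
  have h1 : |cnj ι τ ((u : 𝓞 K) ^ 2 * α)| =
      1 / |cnj ι τ γ| ^ 2 * (|cnj ι τ β| ^ 2 * |cnj ι τ α|) := by
    rw [← hu, cnj_mul, cnj_mul, cnj_pow, abs_mul, abs_mul, abs_pow]
    field_simp
  have h2 : 1 / |cnj ι τ γ| ^ 2 ≤ c := by
    have a1 : 1 / |cnj ι τ γ| ^ 2 ≤ ∑ τ : K ≃ₐ[ℚ] K, 1 / |cnj ι τ γ| ^ 2 :=
      Finset.single_le_sum (f := fun τ : K ≃ₐ[ℚ] K => 1 / |cnj ι τ γ| ^ 2)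
        (fun _ _ => by positivity) (Finset.mem_univ τ)
    refine a1.trans ?_
    exact Finset.single_le_sum (f := fun I => ∑ τ : K ≃ₐ[ℚ] K, 1 / |cnj ι τ (g I)| ^ 2)
        (fun _ _ => Finset.sum_nonneg fun _ _ => by positivity) hmem
  have hp : 0 ≤ N ^ ((1 : ℝ) / n) := by positivity
  rw [h1]
  calc 1 / |cnj ι τ γ| ^ 2 * (|cnj ι τ β| ^ 2 * |cnj ι τ α|)
      ≤ c * (B ^ 2 * N ^ ((1 : ℝ) / n)) := by
        exact mul_le_mul h2 (hτ τ) (by positivity) (le_trans (by positivity) h2)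
    _ ≤ _ := by nlinarith

/-- The sum of the conjugates. -/
def trc [IsGalois ℚ K] (α : 𝓞 K) : ℝ := ∑ τ : K ≃ₐ[ℚ] K, cnj ι τ α

/-- A convex fundamental domain for totally positive integers modulo squares of units:
the elements of lexicographically minimal (trace, first conjugate) in their orbit. -/
def InDom [IsGalois ℚ K] (α : 𝓞 K) : Prop :=
  TotPos α ∧ ∀ u : (𝓞 K)ˣ, trc ι α < trc ι ((u : 𝓞 K) ^ 2 * α) ∨
    trc ι α = trc ι ((u : 𝓞 K) ^ 2 * α) ∧ cnj ι 1 α ≤ cnj ι 1 ((u : 𝓞 K) ^ 2 * α)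

lemma TotPos.unit_sq_mul {α : 𝓞 K} (h : TotPos α) (u : (𝓞 K)ˣ) :
    TotPos ((u : 𝓞 K) ^ 2 * α) := fun v => by
  rw [co_mul, co_pow, map_mul, map_pow]
  have : v ((u : 𝓞 K) : K) ≠ 0 := by
    rw [map_ne_zero]
    exact RingOfIntegers.coe_ne_zero_iff.2 u.ne_zero
  have := h v
  positivity

variable [IsGalois ℚ K]

lemma TotPos.cnj_le_trc {α : 𝓞 K} (h : TotPos α) (τ : K ≃ₐ[ℚ] K) : |cnj ι τ α| ≤ trc ι α := by
  rw [abs_of_pos (h.cnj_pos ι τ)]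
  exact Finset.single_le_sum (f := fun τ : K ≃ₐ[ℚ] K => cnj ι τ α)
    (fun τ _ => (h.cnj_pos ι τ).le) (Finset.mem_univ τ)

lemma TotPos.ne_zero {α : 𝓞 K} (ι : K →+* ℝ) (h : TotPos α) : α ≠ 0 := by
  rintro rfl
  have := h ι
  simp at this

lemma TotPos.exists_inDom {α : 𝓞 K} (h : TotPos α) :
    ∃ u : (𝓞 K)ˣ, InDom ι ((u : 𝓞 K) ^ 2 * α) := by
  set s : Set (𝓞 K) := {β | (∃ u : (𝓞 K)ˣ, β = (u : 𝓞 K) ^ 2 * α) ∧ trc ι β ≤ trc ι α} with hs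
  have hfin : s.Finite := by
    refine (finite_cnj_le ι (trc ι α)).subset ?_
    rintro β ⟨⟨u, rfl⟩, hβ⟩ τ
    exact ((h.unit_sq_mul u).cnj_le_trc ι τ).trans hβ
  have hne : s.Nonempty := ⟨α, ⟨1, by simp⟩, le_rfl⟩
  obtain ⟨β, ⟨⟨u, rfl⟩, hβ⟩, hmin⟩ := Set.exists_min_image s
    (fun β => toLex (trc ι β, cnj ι 1 β)) hfin hne
  refine ⟨u, h.unit_sq_mul u, fun v => ?_⟩
  have e : (v : 𝓞 K) ^ 2 * ((u : 𝓞 K) ^ 2 * α) = ((v * u : (𝓞 K)ˣ) : 𝓞 K) ^ 2 * α := by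
    push_cast; ring
  by_cases hle : trc ι ((v : 𝓞 K) ^ 2 * ((u : 𝓞 K) ^ 2 * α)) ≤ trc ι α
  · have := hmin _ ⟨⟨v * u, e⟩, hle⟩
    simpa [Prod.Lex.le_iff] using this
  · left
    push Not at hle
    exact lt_of_le_of_lt hβ hle

lemma InDom.eq_of_unit_sq_mul {α : 𝓞 K} {u : (𝓞 K)ˣ} (h : InDom ι α)
    (h' : InDom ι ((u : 𝓞 K) ^ 2 * α)) : (u : 𝓞 K) ^ 2 * α = α := by
  have h1 := h.2 u
  have h2 := h'.2 u⁻¹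
  have e : ((u⁻¹ : (𝓞 K)ˣ) : 𝓞 K) ^ 2 * ((u : 𝓞 K) ^ 2 * α) = α := by
    rw [← mul_assoc, ← mul_pow, Units.inv_mul, one_pow, one_mul]
  rw [e] at h2
  apply cnj_injective ι 1
  rcases h1 with h1 | h1 <;> rcases h2 with h2 | h2
  · linarith
  · linarith [h2.1]
  · linarith [h1.1]
  · exact le_antisymm h2.2 h1.2

lemma trc_add (α β : 𝓞 K) : trc ι (α + β) = trc ι α + trc ι β := by
  simp only [trc, cnj_add, Finset.sum_add_distrib]

lemma trc_intCast_mul (a : ℤ) (α : 𝓞 K) : trc ι ((a : 𝓞 K) * α) = a * trc ι α := by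
  simp only [trc, cnj_mul, cnj_intCast, Finset.mul_sum]

lemma InDom.convex {α : 𝓞 K} {a b c : ℤ} (hab : a ≤ b) (hbc : b ≤ c)
    (ha : InDom ι (α + a)) (hc : InDom ι (α + c)) : InDom ι (α + b) := by
  rcases hab.eq_or_lt with rfl | hab'
  · exact ha
  rcases hbc.eq_or_lt with rfl | hbc'
  · exact hc
  refine ⟨fun v => ?_, fun u => ?_⟩
  · have h1 := ha.1 v
    have e : ∀ k : ℤ, v ((α + (k : 𝓞 K) : 𝓞 K) : K) = v (α : K) + k := by
      intro k
      rw [co_add, map_add]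
      congr 1
      have : (((k : 𝓞 K)) : K) = (k : K) := map_intCast (algebraMap (𝓞 K) K) k
      rw [this, map_intCast]
    rw [e] at h1 ⊢
    have : (a : ℝ) ≤ b := by exact_mod_cast hab
    linarith
  · have tr : ∀ k : ℤ, trc ι ((u : 𝓞 K) ^ 2 * (α + (k : 𝓞 K))) - trc ι (α + (k : 𝓞 K)) =
        (trc ι ((u : 𝓞 K) ^ 2 * α) - trc ι α) + k * (trc ι ((u : 𝓞 K) ^ 2) - trc ι 1) := by
      intro k
      have e1 : (u : 𝓞 K) ^ 2 * (α + (k : 𝓞 K)) = (u : 𝓞 K) ^ 2 * α + (k : 𝓞 K) * (u : 𝓞 K) ^ 2 :=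
          by
        ring
      have e2 : α + (k : 𝓞 K) = α + (k : 𝓞 K) * 1 := by ring
      rw [e1, trc_add, trc_intCast_mul, e2, trc_add, trc_intCast_mul]
      ring
    have cn : ∀ k : ℤ, cnj ι 1 ((u : 𝓞 K) ^ 2 * (α + (k : 𝓞 K))) - cnj ι 1 (α + (k : 𝓞 K)) =
        (cnj ι 1 ((u : 𝓞 K) ^ 2 * α) - cnj ι 1 α) + k * (cnj ι 1 ((u : 𝓞 K) ^ 2) - 1) := by
      intro k
      simp only [cnj_mul, cnj_add, cnj_intCast]
      ring
    have key : ∀ k : ℤ, (trc ι (α + (k : 𝓞 K)) < trc ι ((u : 𝓞 K) ^ 2 * (α + (k : 𝓞 K))) ∨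
        trc ι (α + (k : 𝓞 K)) = trc ι ((u : 𝓞 K) ^ 2 * (α + (k : 𝓞 K))) ∧
          cnj ι 1 (α + (k : 𝓞 K)) ≤ cnj ι 1 ((u : 𝓞 K) ^ 2 * (α + (k : 𝓞 K)))) ↔
        (0 < (trc ι ((u : 𝓞 K) ^ 2 * α) - trc ι α) + k * (trc ι ((u : 𝓞 K) ^ 2) - trc ι 1) ∨
        (trc ι ((u : 𝓞 K) ^ 2 * α) - trc ι α) + k * (trc ι ((u : 𝓞 K) ^ 2) - trc ι 1) = 0 ∧
        0 ≤ (cnj ι 1 ((u : 𝓞 K) ^ 2 * α) - cnj ι 1 α) + k * (cnj ι 1 ((u : 𝓞 K) ^ 2) - 1)) := by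
      intro k
      rw [← tr, ← cn, sub_pos, sub_eq_zero, sub_nonneg, eq_comm (a := trc ι (α + (k : 𝓞 K)))]
    rw [key]
    exact lex_affine_convex (by exact_mod_cast hab') (by exact_mod_cast hbc')
      ((key a).1 (ha.2 u)) ((key c).1 (hc.2 u))

lemma exists_inDom_bound : ∃ C : ℝ, 1 ≤ C ∧ ∀ α : 𝓞 K, InDom ι α → ∀ τ : K ≃ₐ[ℚ] K,
    |cnj ι τ α| ≤
      C * (Ideal.absNorm (Ideal.span {α}) : ℝ) ^ ((1 : ℝ) / Module.finrank ℚ K) := by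
  obtain ⟨C, hC1, hC⟩ := exists_unit_cnj_le ι
  have hn : (1 : ℝ) ≤ Module.finrank ℚ K := by
    exact_mod_cast (Module.finrank_pos : 0 < Module.finrank ℚ K)
  refine ⟨Module.finrank ℚ K * C, one_le_mul_of_one_le_of_one_le hn hC1, fun α hα τ => ?_⟩
  obtain ⟨u, hu⟩ := hC α (hα.1.ne_zero ι)
  have h1 : trc ι α ≤ trc ι ((u : 𝓞 K) ^ 2 * α) := by
    rcases hα.2 u with h | h
    · exact h.le
    · exact h.1.le
  refine (hα.1.cnj_le_trc ι τ).trans (h1.trans ?_)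
  refine (Finset.sum_le_card_nsmul _ _ _ fun τ _ => (le_abs_self _).trans (hu τ)).trans_eq ?_
  rw [Finset.card_univ, card_gal, nsmul_eq_mul, mul_assoc]

lemma TotPos.absNorm_le_add {α : 𝓞 K} (ι : K →+* ℝ) (h : TotPos α) {a : ℤ} (ha : 0 ≤ a) :
    Ideal.absNorm (Ideal.span {α}) ≤ Ideal.absNorm (Ideal.span {α + (a : 𝓞 K)}) := by
  have : (Ideal.absNorm (Ideal.span {α}) : ℝ) ≤ Ideal.absNorm (Ideal.span {α + (a : 𝓞 K)}) := by
    rw [absNorm_span_eq_prod ι, absNorm_span_eq_prod ι]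
    refine Finset.prod_le_prod (fun _ _ => abs_nonneg _) fun τ _ => ?_
    have h1 := h.cnj_pos ι τ
    have h2 : (0 : ℝ) ≤ a := by exact_mod_cast ha
    rw [cnj_add, cnj_intCast, abs_of_pos h1, abs_of_pos (by linarith)]
    linarith
  exact_mod_cast this

end Domain

lemma exists_coprime_part {I : Ideal (𝓞 K)} (hI : I ≠ 0) (r : 𝓞 K) :
    ∃ 𝔠 𝔤 : Ideal (𝓞 K), I = 𝔠 * 𝔤 ∧ IsCoprime 𝔠 (Ideal.span {r}) ∧ r ∈ 𝔤.radical := by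
  induction I using UniqueFactorizationMonoid.induction_on_prime with
  | h₁ => exact absurd rfl hI
  | h₂ x hx =>
    rw [Ideal.isUnit_iff] at hx
    exact ⟨⊤, ⊤, by rw [hx, Ideal.mul_top], isCoprime_top_left _, by rw [Ideal.radical_top]; trivial⟩
  | h₃ a p ha hp ih =>
    obtain ⟨𝔠, 𝔤, h1, h2, h3⟩ := ih ha
    have hpp := Ideal.isPrime_of_prime hp
    by_cases hr : r ∈ p
    · refine ⟨𝔠, p * 𝔤, by rw [h1]; ring, h2, ?_⟩
      rw [Ideal.radical_mul]
      exact ⟨Ideal.le_radical hr, h3⟩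
    · refine ⟨p * 𝔠, 𝔤, by rw [h1]; ring, IsCoprime.mul_left ?_ h2, h3⟩
      apply Ideal.coprime_of_no_prime_ge
      intro P hP1 hP2 hP
      have hmax : p.IsMaximal := hpp.isMaximal hp.ne_zero
      have := hmax.eq_of_le hP.ne_top hP1
      subst this
      exact hr (hP2 (Ideal.mem_span_singleton_self r))

lemma isCoprime_of_mem_radical {𝔠 𝔤 : Ideal (𝓞 K)} {r : 𝓞 K}
    (h : IsCoprime 𝔠 (Ideal.span {r})) (hr : r ∈ 𝔤.radical) : IsCoprime 𝔠 𝔤 := by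
  apply Ideal.coprime_of_no_prime_ge
  intro P h1 h2 hP
  exact not_mem_of_coprime h h1 hP.ne_top (hP.radical_le_iff.2 h2 hr)

lemma liesOver_of_mem {p : ℕ} (hp : p.Prime) {𝔭 : Ideal (𝓞 K)} (h𝔭 : 𝔭.IsPrime)
    (h : (p : 𝓞 K) ∈ 𝔭) : 𝔭.LiesOver (Ideal.span {(p : ℤ)}) := by
  have hp' : Prime (p : ℤ) := Nat.prime_iff_prime_int.1 hp
  have : (Ideal.span {(p : ℤ)}).IsMaximal :=
    ((Ideal.span_singleton_prime hp'.ne_zero).2 hp').isMaximal (by simpa using hp.ne_zero)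
  refine ⟨this.eq_of_le ?_ ?_⟩
  · exact (h𝔭.under ℤ).ne_top
  · rw [Ideal.span_singleton_le_iff_mem, Ideal.under, Ideal.mem_comap]
    simpa using h

lemma exists_absNorm_eq_pow {p : ℕ} (hp : p.Prime) {𝔭 : Ideal (𝓞 K)} (h𝔭 : 𝔭.IsPrime)
    (h : (p : 𝓞 K) ∈ 𝔭) : ∃ f : ℕ, 0 < f ∧ Ideal.absNorm 𝔭 = p ^ f := by
  have := liesOver_of_mem hp h𝔭 h
  refine ⟨_, Nat.pos_of_ne_zero ?_, Ideal.absNorm_eq_pow_inertiaDeg' 𝔭 hp⟩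
  intro h0
  have h1 := Ideal.absNorm_eq_pow_inertiaDeg' 𝔭 hp
  rw [h0, pow_zero, Ideal.absNorm_eq_one_iff] at h1
  exact h𝔭.ne_top h1

lemma exists_natPrime_mem {𝔭 : Ideal (𝓞 K)} (h𝔭 : 𝔭.IsPrime) (h0 : 𝔭 ≠ ⊥) :
    ∃ p : ℕ, p.Prime ∧ (p : 𝓞 K) ∈ 𝔭 := by
  have h1 := Ideal.absNorm_mem 𝔭
  have h2 : Ideal.absNorm 𝔭 ≠ 0 := by rwa [Ne, Ideal.absNorm_eq_zero_iff]
  rw [← Nat.prod_primeFactorsList h2] at h1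
  have : ∀ l : List ℕ, ((l.prod : ℕ) : 𝓞 K) ∈ 𝔭 → ∃ p ∈ l, (p : 𝓞 K) ∈ 𝔭 := by
    intro l
    induction l with
    | nil => intro h; simp at h; exact absurd ((Ideal.eq_top_iff_one _).2 h) h𝔭.ne_top
    | cons a l ih =>
      intro h
      rw [List.prod_cons, Nat.cast_mul] at h
      rcases h𝔭.mem_or_mem h with h | h
      · exact ⟨a, by simp, h⟩
      · obtain ⟨p, hp, hp'⟩ := ih h
        exact ⟨p, by simp [hp], hp'⟩
  obtain ⟨p, hp, hp'⟩ := this _ h1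
  exact ⟨p, Nat.prime_of_mem_primeFactorsList hp, hp'⟩

lemma natPrime_eq_of_mem {p q : ℕ} (hp : p.Prime) (hq : q.Prime) {𝔭 : Ideal (𝓞 K)}
    (h𝔭 : 𝔭 ≠ ⊤) (h : (p : 𝓞 K) ∈ 𝔭) (h' : (q : 𝓞 K) ∈ 𝔭) : p = q := by
  by_contra hne
  have := (Nat.isCoprime_iff_coprime.2 ((Nat.coprime_primes hp hq).2 hne))
  obtain ⟨a, b, hab⟩ := this
  apply h𝔭
  rw [Ideal.eq_top_iff_one]
  have h2 : ((a * p + b * q : ℤ) : 𝓞 K) ∈ 𝔭 := by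
    push_cast
    exact add_mem (Ideal.mul_mem_left _ _ h) (Ideal.mul_mem_left _ _ h')
  rw [hab] at h2
  simpa using h2

/-- The primes above `p` that contain `γ`. -/
def primesAt (γ : 𝓞 K) (p : ℕ) : Set (Ideal (𝓞 K)) := {𝔭 | 𝔭.IsPrime ∧ (p : 𝓞 K) ∈ 𝔭 ∧ γ ∈ 𝔭}

lemma finite_primesAt (γ : 𝓞 K) {p : ℕ} (hp : p.Prime) : (primesAt γ p).Finite :=
  (finite_ideal_divisors (span_natCast_ne_zero hp.ne_zero)).subset fun _ h =>
    Ideal.dvd_span_singleton.2 h.2.1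

/-- A prime `p` is bad for `γ` if the part of `γ` above `p` is not a power of a single prime of
degree one. -/
def IsBad (γ : 𝓞 K) (p : ℕ) : Prop :=
  p.Prime ∧ ∃ 𝔭 ∈ primesAt γ p, Ideal.absNorm 𝔭 ≠ p ∨ ∃ 𝔭' ∈ primesAt γ p, 𝔭' ≠ 𝔭

lemma ne_bot_of_natCast_mem {p : ℕ} (hp : p.Prime) {𝔭 : Ideal (𝓞 K)} (h : (p : 𝓞 K) ∈ 𝔭) :
    𝔭 ≠ ⊥ := by
  rintro rfl
  rw [Ideal.mem_bot, Nat.cast_eq_zero] at h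
  exact hp.ne_zero h

lemma dvd_absNorm_of_mem_primesAt {γ : 𝓞 K} {p : ℕ} (hp : p.Prime) {𝔭 : Ideal (𝓞 K)}
    (h : 𝔭 ∈ primesAt γ p) : p ∣ Ideal.absNorm (Ideal.span {γ}) := by
  obtain ⟨f, hf, h1⟩ := exists_absNorm_eq_pow hp h.1 h.2.1
  exact (dvd_pow_self p hf.ne').trans (h1 ▸ absNorm_dvd_of_mem h.2.2)

/-- The bad primes of `γ`. -/
def badSet (γ : 𝓞 K) : Finset ℕ :=
  (Ideal.absNorm (Ideal.span {γ})).primeFactors.filter (IsBad γ)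

lemma mem_badSet {γ : 𝓞 K} (hγ : γ ≠ 0) {p : ℕ} : p ∈ badSet γ ↔ IsBad γ p := by
  rw [badSet, Finset.mem_filter, Nat.mem_primeFactors]
  refine ⟨fun h => h.2, fun h => ⟨⟨h.1, ?_, ?_⟩, h⟩⟩
  · obtain ⟨𝔭, h𝔭, -⟩ := h.2
    exact dvd_absNorm_of_mem_primesAt h.1 h𝔭
  · rw [Ne, Ideal.absNorm_eq_zero_iff, Ideal.span_singleton_eq_bot]
    exact hγ

lemma prime_of_mem_badSet {γ : 𝓞 K} {p : ℕ} (h : p ∈ badSet γ) : p.Prime :=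
  (Nat.mem_primeFactors.1 (Finset.mem_filter.1 h).1).1

/-- The product of the bad primes of `γ`. -/
def badProd (γ : 𝓞 K) : ℕ := ∏ p ∈ badSet γ, p

lemma badProd_pos (γ : 𝓞 K) : 0 < badProd γ :=
  Finset.prod_pos fun _ h => (prime_of_mem_badSet h).pos

lemma badProd_dvd (γ : 𝓞 K) : badProd γ ∣ Ideal.absNorm (Ideal.span {γ}) :=
  Finset.prod_primes_dvd _ (fun _ h => (prime_of_mem_badSet h).prime)
    fun _ h => Nat.dvd_of_mem_primeFactors (Finset.mem_filter.1 h).1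

/-- The product of all primes containing `γ` and lying above a bad prime. -/
def badIdeal (γ : 𝓞 K) : Ideal (𝓞 K) :=
  ∏ p ∈ badSet γ, ∏ᶠ 𝔭 ∈ primesAt γ p, 𝔭

lemma finprod_primesAt (γ : 𝓞 K) {p : ℕ} (hp : p.Prime) :
    ∏ᶠ 𝔭 ∈ primesAt γ p, 𝔭 = ∏ 𝔭 ∈ (finite_primesAt γ hp).toFinset, 𝔭 :=
  finprod_mem_eq_finite_toFinset_prod _ _

lemma primesAt_dvd (γ : 𝓞 K) {p : ℕ} (hp : p.Prime) {β : 𝓞 K}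
    (h : ∀ 𝔭 ∈ primesAt γ p, β ∈ 𝔭) : ∏ᶠ 𝔭 ∈ primesAt γ p, 𝔭 ∣ Ideal.span {β} := by
  rw [finprod_primesAt γ hp]
  apply Finset.prod_primes_dvd
  · intro 𝔭 h𝔭
    rw [Set.Finite.mem_toFinset] at h𝔭
    exact Ideal.prime_of_isPrime (ne_bot_of_natCast_mem hp h𝔭.2.1) h𝔭.1
  · intro 𝔭 h𝔭
    rw [Set.Finite.mem_toFinset] at h𝔭
    exact Ideal.dvd_span_singleton.2 (h 𝔭 h𝔭)

lemma badIdeal_dvd_span_badProd (γ : 𝓞 K) :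
    badIdeal γ ∣ Ideal.span {(badProd γ : 𝓞 K)} := by
  have : Ideal.span {(badProd γ : 𝓞 K)} = ∏ p ∈ badSet γ, Ideal.span {(p : 𝓞 K)} := by
    rw [Ideal.prod_span_singleton, badProd, Nat.cast_prod]
  rw [this]
  exact Finset.prod_dvd_prod_of_dvd _ _ fun p hp =>
    primesAt_dvd γ (prime_of_mem_badSet hp) fun 𝔭 h => h.2.1

lemma mem_badIdeal (γ : 𝓞 K) : γ ∈ badIdeal γ := by
  rw [← Ideal.dvd_span_singleton]
  apply Finset.prod_dvd_of_coprime
  · intro p hp q hq hne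
    have hp := prime_of_mem_badSet hp
    have hq := prime_of_mem_badSet hq
    apply Ideal.coprime_of_no_prime_ge
    intro P h1 h2 hP
    have h3 := Ideal.dvd_span_singleton.1 (primesAt_dvd γ hp fun 𝔭 h => h.2.1)
    have h4 := Ideal.dvd_span_singleton.1 (primesAt_dvd γ hq fun 𝔭 h => h.2.1)
    exact hne (natPrime_eq_of_mem hp hq hP.ne_top (h1 h3) (h2 h4))
  · intro p hp
    exact primesAt_dvd γ (prime_of_mem_badSet hp) fun 𝔭 h => h.2.2

lemma badIdeal_ne_bot (γ : 𝓞 K) : badIdeal γ ≠ 0 :=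
  ne_zero_of_dvd_ne_zero (span_natCast_ne_zero (badProd_pos γ).ne') (badIdeal_dvd_span_badProd γ)

lemma absNorm_prod_le_finprod {γ : 𝓞 K} {p : ℕ} (hp : p.Prime) {s : Finset (Ideal (𝓞 K))}
    (hs : ∀ 𝔭 ∈ s, 𝔭 ∈ primesAt γ p) :
    ∏ 𝔭 ∈ s, Ideal.absNorm 𝔭 ≤ Ideal.absNorm (∏ᶠ 𝔭 ∈ primesAt γ p, 𝔭) := by
  rw [finprod_primesAt γ hp, map_prod]
  apply Finset.prod_le_prod_of_subset_of_one_le'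
  · intro 𝔭 h
    exact (Set.Finite.mem_toFinset _).2 (hs 𝔭 h)
  · intro 𝔭 h _
    rw [Set.Finite.mem_toFinset] at h
    exact Nat.pos_of_ne_zero fun h0 =>
      ne_bot_of_natCast_mem hp h.2.1 (Ideal.absNorm_eq_zero_iff.1 h0)

lemma sq_le_absNorm_finprod {γ : 𝓞 K} {p : ℕ} (h : IsBad γ p) :
    p ^ 2 ≤ Ideal.absNorm (∏ᶠ 𝔭 ∈ primesAt γ p, 𝔭) := by
  obtain ⟨hp, 𝔭, h𝔭, h⟩ := h
  obtain ⟨f, hf, h1⟩ := exists_absNorm_eq_pow hp h𝔭.1 h𝔭.2.1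
  rcases h with h | ⟨𝔭', h𝔭', hne⟩
  · have h2 := absNorm_prod_le_finprod hp (s := {𝔭}) (by simpa using h𝔭)
    rw [Finset.prod_singleton] at h2
    refine le_trans ?_ h2
    rw [h1]
    refine Nat.pow_le_pow_right hp.pos ?_
    by_contra hlt
    have : f = 1 := by omega
    rw [this, pow_one] at h1
    exact h h1
  · have h2 := absNorm_prod_le_finprod hp (s := {𝔭', 𝔭}) (by
      intro 𝔮 h𝔮
      rcases Finset.mem_insert.1 h𝔮 with rfl | h𝔮
      · exact h𝔭'
      · rwa [Finset.mem_singleton.1 h𝔮])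
    rw [Finset.prod_pair hne] at h2
    refine le_trans ?_ h2
    obtain ⟨f', hf', h1'⟩ := exists_absNorm_eq_pow hp h𝔭'.1 h𝔭'.2.1
    rw [h1, h1', ← pow_add]
    exact Nat.pow_le_pow_right hp.pos (by omega)

lemma smul_eq_galInt (τ : K ≃ₐ[ℚ] K) (α : 𝓞 K) : τ • α = galInt τ α := rfl

open Pointwise in
lemma cube_le_absNorm_finprod [IsGalois ℚ K] (hn : Module.finrank ℚ K = 3) {γ : 𝓞 K}
    (htr : ∑ τ : K ≃ₐ[ℚ] K, galInt τ γ = 0) {p : ℕ} (h : IsBad γ p) :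
    p ^ 3 ≤ Ideal.absNorm (∏ᶠ 𝔭 ∈ primesAt γ p, 𝔭) := by
  obtain ⟨hp, 𝔭, h𝔭, h⟩ := h
  have hcard : Nat.card (K ≃ₐ[ℚ] K) = 3 := by rw [Nat.card_eq_fintype_card, card_gal, hn]
  have hlies := liesOver_of_mem hp h𝔭.1 h𝔭.2.1
  have hp' : Prime (p : ℤ) := Nat.prime_iff_prime_int.1 hp
  have hPp : (Ideal.span {(p : ℤ)}).IsPrime := (Ideal.span_singleton_prime hp'.ne_zero).2 hp'
  have hPr := h𝔭.1
  obtain ⟨f, hf, h1⟩ := exists_absNorm_eq_pow hp h𝔭.1 h𝔭.2.1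
  by_cases hne : ∃ 𝔭' ∈ primesAt γ p, 𝔭' ≠ 𝔭
  · obtain ⟨𝔭', h𝔭', hne⟩ := hne
    have hlies' := liesOver_of_mem hp h𝔭'.1 h𝔭'.2.1
    have hPr' := h𝔭'.1
    obtain ⟨τ, hτ⟩ := Ideal.exists_smul_eq_of_isGaloisGroup (Ideal.span {(p : ℤ)}) 𝔭 𝔭'
      (K ≃ₐ[ℚ] K)
    have hτ1 : τ ≠ 1 := by
      rintro rfl
      rw [one_smul] at hτ
      exact hne hτ.symm
    have hfact : Fact (Nat.Prime 3) := ⟨Nat.prime_three⟩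
    have hord : orderOf τ = 3 := by
      have h3 := orderOf_dvd_natCard τ
      rw [hcard, Nat.dvd_prime Nat.prime_three, orderOf_eq_one_iff] at h3
      exact h3.resolve_left hτ1
    have hτ3 : τ ^ 3 = 1 := hord ▸ pow_orderOf_eq_one τ
    have hτ2 : τ ^ 2 ≠ 1 := fun h => by
      have := orderOf_dvd_of_pow_eq_one h
      rw [hord] at this
      norm_num at this
    have hne2 : τ ^ 2 ≠ τ := fun h => hτ1 (by
      rw [sq] at h
      exact mul_eq_left.1 h)
    have huniv : (Finset.univ : Finset (K ≃ₐ[ℚ] K)) = {1, τ, τ ^ 2} := by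
      symm
      apply Finset.eq_univ_of_card
      rw [← Nat.card_eq_fintype_card, hcard, Finset.card_eq_three]
      exact ⟨1, τ, τ ^ 2, hτ1.symm, hτ2.symm, hne2.symm, rfl⟩
    rw [huniv, Finset.sum_insert (by simp [hτ1.symm, hτ2.symm]),
      Finset.sum_pair hne2.symm] at htr
    have e1 : galInt (1 : K ≃ₐ[ℚ] K) γ = γ := rfl
    have hγ1 : galInt τ γ ∈ (τ ^ 2) • 𝔭 := by
      rw [sq, mul_smul, hτ, ← smul_eq_galInt, Ideal.smul_mem_pointwise_smul_iff]
      exact h𝔭'.2.2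
    have hγ2 : galInt (τ ^ 2) γ ∈ (τ ^ 2) • 𝔭 := by
      rw [← smul_eq_galInt, Ideal.smul_mem_pointwise_smul_iff]
      exact h𝔭.2.2
    have hγ3 : γ ∈ (τ ^ 2) • 𝔭 := by
      have : γ = -(galInt τ γ + galInt (τ ^ 2) γ) := by
        rw [← sub_eq_zero, sub_neg_eq_add, ← htr, e1]
      rw [this]
      exact neg_mem (add_mem hγ1 hγ2)
    have hp3 : (p : 𝓞 K) ∈ (τ ^ 2) • 𝔭 := by
      have : (p : 𝓞 K) = τ ^ 2 • (p : 𝓞 K) := by rw [smul_eq_galInt, map_natCast]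
      rw [this, Ideal.smul_mem_pointwise_smul_iff]
      exact h𝔭.2.1
    have hpr3 : ((τ ^ 2) • 𝔭).IsPrime := inferInstance
    have hd1 : (τ ^ 2) • 𝔭 ≠ 𝔭 := by
      intro h
      apply hne
      have := congrArg (fun I => τ • I) h
      simp only [smul_smul] at this
      rw [← pow_succ', hτ3, one_smul, hτ] at this
      exact this.symm
    have hd2 : (τ ^ 2) • 𝔭 ≠ 𝔭' := by
      intro h
      rw [← hτ, sq, mul_smul] at h
      rw [smul_left_cancel_iff, hτ] at h
      exact hne h
    have h2 := absNorm_prod_le_finprod (γ := γ) hp (s := {(τ ^ 2) • 𝔭, 𝔭', 𝔭}) (by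
      intro 𝔮 h𝔮
      rw [Finset.mem_insert, Finset.mem_insert, Finset.mem_singleton] at h𝔮
      rcases h𝔮 with rfl | rfl | rfl
      · exact ⟨hpr3, hp3, hγ3⟩
      · exact h𝔭'
      · exact h𝔭)
    rw [Finset.prod_insert (by simp [hd1, hd2]), Finset.prod_pair hne] at h2
    refine le_trans ?_ h2
    obtain ⟨f', hf', h1'⟩ := exists_absNorm_eq_pow hp h𝔭'.1 h𝔭'.2.1
    obtain ⟨f'', hf'', h1''⟩ := exists_absNorm_eq_pow hp hpr3 hp3
    rw [h1, h1', h1'', ← pow_add, ← pow_add]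
    exact Nat.pow_le_pow_right hp.pos (by omega)
  · have h2 := absNorm_prod_le_finprod (γ := γ) hp (s := {𝔭}) (by simpa using h𝔭)
    rw [Finset.prod_singleton] at h2
    refine le_trans ?_ h2
    have hdvd : f ∣ 3 := by
      have h3 := Ideal.ncard_primesOver_mul_ramificationIdxIn_mul_inertiaDegIn
        (Ideal.span {(p : ℤ)}) (𝓞 K) (K ≃ₐ[ℚ] K)
      rw [hcard, Ideal.inertiaDegIn_eq_inertiaDeg (Ideal.span {(p : ℤ)}) 𝔭 (K ≃ₐ[ℚ] K)] at h3
      have h4 := Ideal.absNorm_eq_pow_inertiaDeg' 𝔭 hp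
      have hmax : (Ideal.span {(p : ℤ)}).IsMaximal := hPp.isMaximal (by simpa using hp.ne_zero)
      have hmax' : 𝔭.IsMaximal := hPr.isMaximal (ne_bot_of_natCast_mem hp h𝔭.2.1)
      rw [Ideal.inertiaDeg'_eq_inertiaDeg, h1] at h4
      rw [Nat.pow_right_injective hp.two_le h4, ← h3]
      exact (Dvd.intro_left _ rfl).trans (Dvd.intro_left _ rfl)
    rw [Nat.dvd_prime Nat.prime_three] at hdvd
    rcases hdvd with rfl | rfl
    · exact (h.resolve_left (fun h => h (by rw [h1, pow_one]))).elim fun 𝔭' h' =>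
        absurd ⟨𝔭', h'⟩ hne
    · rw [h1]

lemma badProd_pow_le_absNorm_badIdeal {γ : 𝓞 K} (c : ℕ)
    (h : ∀ p ∈ badSet γ, p ^ c ≤ Ideal.absNorm (∏ᶠ 𝔭 ∈ primesAt γ p, 𝔭)) :
    badProd γ ^ c ≤ Ideal.absNorm (badIdeal γ) := by
  rw [badProd, badIdeal, map_prod, ← Finset.prod_pow]
  exact Finset.prod_le_prod' h

/-- The ideal `badIdeal γ` is large compared with `badProd γ`. -/
lemma badProd_rpow_le [IsGalois ℚ K] {n : ℕ} (hn3 : 3 ≤ n) (hn : Module.finrank ℚ K = n) {γ : 𝓞 K}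
    (hγ : γ ≠ 0) (htr : ∑ τ : K ≃ₐ[ℚ] K, galInt τ γ = 0) :
    (badProd γ : ℝ) ^ ((3 : ℝ) / 2) ≤
      (Ideal.absNorm (badIdeal γ) : ℝ) ^ (((n - 1 : ℕ) : ℝ) / n) := by
  have hd : (1 : ℝ) ≤ badProd γ := by exact_mod_cast badProd_pos γ
  have key : ∀ c : ℕ, (3 : ℝ) / 2 ≤ c * (((n - 1 : ℕ) : ℝ) / n) →
      badProd γ ^ c ≤ Ideal.absNorm (badIdeal γ) →
      (badProd γ : ℝ) ^ ((3 : ℝ) / 2) ≤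
        (Ideal.absNorm (badIdeal γ) : ℝ) ^ (((n - 1 : ℕ) : ℝ) / n) := by
    intro c hc h
    calc (badProd γ : ℝ) ^ ((3 : ℝ) / 2) ≤ (badProd γ : ℝ) ^ (c * (((n - 1 : ℕ) : ℝ) / n)) :=
          Real.rpow_le_rpow_of_exponent_le hd hc
      _ = ((badProd γ ^ c : ℕ) : ℝ) ^ (((n - 1 : ℕ) : ℝ) / n) := by
          rw [Real.rpow_mul (by linarith), Real.rpow_natCast]; push_cast; rfl
      _ ≤ _ := by
          apply Real.rpow_le_rpow (by positivity) (by exact_mod_cast h) (by positivity)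
  have hcast : ((n - 1 : ℕ) : ℝ) = n - 1 := by rw [Nat.cast_sub (by omega)]; simp
  rcases hn3.eq_or_lt with h3 | h4
  · refine key 3 ?_ (badProd_pow_le_absNorm_badIdeal 3 fun p hp =>
      cube_le_absNorm_finprod (hn.trans h3.symm) htr ((mem_badSet hγ).1 hp))
    rw [← h3]; norm_num
  · refine key 2 ?_ (badProd_pow_le_absNorm_badIdeal 2 fun p hp =>
      sq_le_absNorm_finprod ((mem_badSet hγ).1 hp))
    have h4' : (4 : ℝ) ≤ n := by exact_mod_cast h4
    rw [hcast, mul_div_assoc', div_le_div_iff₀ (by norm_num) (by linarith)]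
    push_cast
    linarith

lemma absNorm_le_pow [IsGalois ℚ K] (ι : K →+* ℝ) {n : ℕ} (hn : Module.finrank ℚ K = n)
    {γ : 𝓞 K} {B : ℝ} (h : ∀ τ, |cnj ι τ γ| ≤ B) :
    (Ideal.absNorm (Ideal.span {γ}) : ℝ) ≤ B ^ n := by
  rw [absNorm_span_eq_prod ι, ← hn, ← card_gal, ← Finset.card_univ, ← Finset.prod_const]
  exact Finset.prod_le_prod (fun τ _ => abs_nonneg _) fun τ _ => h τ

lemma card_badProd_eq_le [IsGalois ℚ K] (ι : K →+* ℝ) {n : ℕ} (hn3 : 3 ≤ n)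
    (hn : Module.finrank ℚ K = n) {B : ℝ} (hB : 1 ≤ B) {d N : ℕ} {S : Finset (𝓞 K)}
    (hN : {A : Ideal (𝓞 K) | A ∣ Ideal.span {(d : 𝓞 K)}}.ncard ≤ N)
    (hS : ∀ γ ∈ S, γ ≠ 0 ∧ ∑ τ : K ≃ₐ[ℚ] K, galInt τ γ = 0 ∧ (∀ τ, |cnj ι τ γ| ≤ B) ∧
      badProd γ = d) :
    (S.card : ℝ) ≤ N * ((4 * n * B) ^ (n - 1) / (d : ℝ) ^ ((3 : ℝ) / 2)) := by
  by_cases hd : d = 0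
  · have : S = ∅ := by
      rw [Finset.eq_empty_iff_forall_notMem]
      intro γ hγ
      have := badProd_pos γ
      have := (hS γ hγ).2.2.2
      omega
    rw [this, Finset.card_empty]
    push_cast
    positivity
  have hd' : (0 : ℝ) < d := by exact_mod_cast Nat.pos_of_ne_zero hd
  rw [Finset.card_eq_sum_card_image badIdeal S]
  push_cast
  have him : ((S.image badIdeal).card : ℝ) ≤ N := by
    refine le_trans ?_ (Nat.cast_le.2 hN)
    rw [Nat.cast_le, ← Set.ncard_coe_finset]
    refine Set.ncard_le_ncard ?_ (finite_ideal_divisors (span_natCast_ne_zero hd))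
    intro A hA
    rw [Finset.mem_coe, Finset.mem_image] at hA
    obtain ⟨γ, hγ, rfl⟩ := hA
    have := badIdeal_dvd_span_badProd γ
    rwa [(hS γ hγ).2.2.2] at this
  refine le_trans (Finset.sum_le_card_nsmul _ _ ((4 * n * B) ^ (n - 1) / (d : ℝ) ^ ((3 : ℝ) / 2))
    ?_) ?_
  · intro A hA
    obtain ⟨γ, hγ, rfl⟩ := Finset.mem_image.1 hA
    set D : ℝ := (Ideal.absNorm (badIdeal γ) : ℝ) with hDdef
    have hD : 0 < D := by
      rw [hDdef, Nat.cast_pos]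
      exact Nat.pos_of_ne_zero fun h0 => badIdeal_ne_bot γ (Ideal.absNorm_eq_zero_iff.1 h0)
    obtain ⟨hγ0, hγtr, hγB, hγd⟩ := hS γ hγ
    have hDB : D ≤ B ^ n := by
      have h1 : D ≤ (Ideal.absNorm (Ideal.span {γ}) : ℝ) := by
        rw [hDdef, Nat.cast_le]
        apply Nat.le_of_dvd
        · have := one_le_absNorm_span hγ0
          exact_mod_cast this
        · exact absNorm_dvd_of_mem (mem_badIdeal γ)
      refine h1.trans ?_
      exact absNorm_le_pow ι hn hγB
    refine (card_le_of_separated ι hn hD (by linarith) hDB ?_ ?_ ?_).trans ?_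
    · intro α hα
      have := (hS α (Finset.mem_filter.1 hα).1).2.1
      have h2 := congrArg (fun z => cnj ι 1 z) this
      simp only [cnj] at h2 ⊢
      simpa [coe_galInt] using h2
    · intro α hα
      exact (hS α (Finset.mem_filter.1 hα).1).2.2.1
    · intro α hα β hβ hne
      rw [hDdef, Nat.cast_le]
      apply Nat.le_of_dvd
      · have := one_le_absNorm_span (sub_ne_zero.2 hne)
        exact_mod_cast this
      · apply absNorm_dvd_of_mem
        rw [Finset.mem_filter] at hα hβ
        exact sub_mem (hα.2 ▸ mem_badIdeal α) (hβ.2 ▸ mem_badIdeal β)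
    · apply div_le_div_of_nonneg_left (by positivity) (by positivity)
      rw [← hγd]
      exact badProd_rpow_le hn3 hn hγ0 hγtr
  · rw [nsmul_eq_mul]
    gcongr

/-- The average of `√(badProd γ)` over trace zero elements in a box is bounded up to `B ^ ε`. -/
theorem exists_sum_sqrt_badProd_le [IsGalois ℚ K] (ι : K →+* ℝ) {n : ℕ} (hn3 : 3 ≤ n)
    (hn : Module.finrank ℚ K = n) {ε : ℝ} (hε : 0 < ε) :
    ∃ C : ℝ, 1 ≤ C ∧ ∀ B : ℝ, 1 ≤ B → ∀ S : Finset (𝓞 K),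
      (∀ γ ∈ S, γ ≠ 0 ∧ ∑ τ : K ≃ₐ[ℚ] K, galInt τ γ = 0 ∧ ∀ τ, |cnj ι τ γ| ≤ B) →
      ∑ γ ∈ S, √(badProd γ : ℝ) ≤ C * (B ^ (n - 1) * B ^ ε) := by
  have hn0 : (0 : ℝ) < n := by exact_mod_cast (by omega : 0 < n)
  obtain ⟨C1, hC1, h1⟩ := exists_ncard_ideal_divisors_le K
    (show 0 < ε / (2 * n ^ 2) by positivity)
  obtain ⟨C2, hC2, h2⟩ := exists_sum_inv_le (show 0 < ε / (2 * n) by positivity)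
  refine ⟨max 1 ((C1 + 1) * (4 * n) ^ (n - 1) * C2), le_max_left _ _, fun B hB S hS => ?_⟩
  have hB0 : 0 < B := by linarith
  set Y := ⌊B ^ n⌋₊ with hY
  have hY1 : 1 ≤ Y := Nat.le_floor (by exact_mod_cast one_le_pow₀ hB)
  have hYB : (Y : ℝ) ≤ B ^ n := Nat.floor_le (by positivity)
  have hmaps : ∀ γ ∈ S, badProd γ ∈ Finset.Icc 1 Y := by
    intro γ hγ
    obtain ⟨hγ0, hγtr, hγB⟩ := hS γ hγ
    rw [Finset.mem_Icc]
    refine ⟨badProd_pos γ, Nat.le_floor ?_⟩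
    have h1 : (badProd γ : ℝ) ≤ (Ideal.absNorm (Ideal.span {γ}) : ℝ) := by
      rw [Nat.cast_le]
      apply Nat.le_of_dvd
      · have := one_le_absNorm_span hγ0
        exact_mod_cast this
      · exact badProd_dvd γ
    refine h1.trans ?_
    exact absNorm_le_pow ι hn hγB
  rw [← Finset.sum_fiberwise_of_maps_to hmaps]
  have hterm : ∀ d ∈ Finset.Icc 1 Y, ∑ γ ∈ S with badProd γ = d, √(badProd γ : ℝ) ≤
      (C1 * B ^ (ε / 2) + 1) * (4 * n * B) ^ (n - 1) * (1 / (d : ℝ)) := by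
    intro d hd
    rw [Finset.mem_Icc] at hd
    have hd0 : (0 : ℝ) < d := by exact_mod_cast hd.1
    have hdne : d ≠ 0 := by omega
    have hdB : (d : ℝ) ≤ B ^ n := le_trans (by exact_mod_cast hd.2) hYB
    have hsum : ∑ γ ∈ S with badProd γ = d, √(badProd γ : ℝ) =
        ((S.filter fun γ => badProd γ = d).card : ℝ) * √(d : ℝ) := by
      rw [Finset.sum_congr rfl (g := fun _ => √(d : ℝ))]
      · rw [Finset.sum_const, nsmul_eq_mul]
      · intro γ hγ
        rw [(Finset.mem_filter.1 hγ).2]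
    rw [hsum]
    have hcard := card_badProd_eq_le ι hn3 hn hB (d := d) (S := S.filter fun γ => badProd γ = d)
      le_rfl (fun γ hγ => by
        rw [Finset.mem_filter] at hγ
        exact ⟨(hS γ hγ.1).1, (hS γ hγ.1).2.1, (hS γ hγ.1).2.2, hγ.2⟩)
    have hnum : ({A : Ideal (𝓞 K) | A ∣ Ideal.span {(d : 𝓞 K)}}.ncard : ℝ) ≤
        C1 * B ^ (ε / 2) + 1 := by
      refine (h1 _ (span_natCast_ne_zero hdne)).trans ?_
      have habs : (Ideal.absNorm (Ideal.span {(d : 𝓞 K)}) : ℝ) ≤ B ^ ((n : ℝ) ^ 2) := by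
        rw [Ideal.absNorm_span_natCast, RingOfIntegers.rank, hn]
        push_cast
        calc (d : ℝ) ^ n ≤ (B ^ n) ^ n := by gcongr
          _ = B ^ ((n : ℝ) ^ 2) := by
            rw [← pow_mul, ← Real.rpow_natCast]; push_cast; rw [sq]
      have h3 : (Ideal.absNorm (Ideal.span {(d : 𝓞 K)}) : ℝ) ^ (ε / (2 * n ^ 2)) ≤
          B ^ (ε / 2) := by
        calc _ ≤ (B ^ ((n : ℝ) ^ 2)) ^ (ε / (2 * n ^ 2)) := by gcongr
          _ = B ^ (ε / 2) := by
            rw [← Real.rpow_mul hB0.le]; congr 1; field_simp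
      nlinarith [mul_le_mul_of_nonneg_left h3 (by linarith : (0 : ℝ) ≤ C1)]
    calc ((S.filter fun γ => badProd γ = d).card : ℝ) * √(d : ℝ) ≤
        ((C1 * B ^ (ε / 2) + 1) * ((4 * n * B) ^ (n - 1) / (d : ℝ) ^ ((3 : ℝ) / 2))) *
          √(d : ℝ) := by
          gcongr
          refine hcard.trans ?_
          gcongr
      _ = (C1 * B ^ (ε / 2) + 1) * (4 * n * B) ^ (n - 1) *
          (√(d : ℝ) / (d : ℝ) ^ ((3 : ℝ) / 2)) := by ring
      _ = _ := by
          congr 1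
          rw [Real.sqrt_eq_rpow, ← Real.rpow_sub hd0, show (1 : ℝ) / 2 - 3 / 2 = -1 by norm_num,
            Real.rpow_neg_one, one_div]
  refine (Finset.sum_le_sum hterm).trans ?_
  rw [← Finset.mul_sum]
  have hYe : (Y : ℝ) ^ (ε / (2 * n)) ≤ B ^ (ε / 2) := by
    calc _ ≤ (B ^ n) ^ (ε / (2 * n)) := by gcongr
      _ = B ^ (ε / 2) := by
        rw [← Real.rpow_natCast, ← Real.rpow_mul hB0.le]; congr 1; field_simp
  have hBe : 1 ≤ B ^ (ε / 2) := Real.one_le_rpow hB (by positivity)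
  calc (C1 * B ^ (ε / 2) + 1) * (4 * n * B) ^ (n - 1) * ∑ d ∈ Finset.Icc 1 Y, (1 : ℝ) / d
      ≤ ((C1 + 1) * B ^ (ε / 2)) * (4 * n * B) ^ (n - 1) * (C2 * B ^ (ε / 2)) := by
        gcongr
        · linarith
        · refine (h2 Y hY1).trans ?_
          gcongr
    _ = ((C1 + 1) * (4 * n) ^ (n - 1) * C2) * (B ^ (n - 1) * (B ^ (ε / 2) * B ^ (ε / 2))) := by
        rw [mul_pow]; ring
    _ = ((C1 + 1) * (4 * n) ^ (n - 1) * C2) * (B ^ (n - 1) * B ^ ε) := by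
        rw [← Real.rpow_add hB0, add_halves]
    _ ≤ _ := by
        gcongr
        exact le_max_right _ _

/-- Few elements of a box have a norm which is powerful outside `m`. -/
theorem exists_card_powerful_norm_le [IsGalois ℚ K] (ι : K →+* ℝ) {n : ℕ} (hn0 : 0 < n)
    (hn : Module.finrank ℚ K = n) {ε : ℝ} (hε : 0 < ε) :
    ∃ C : ℝ, 1 ≤ C ∧ ∀ B : ℝ, 1 ≤ B → ∀ m : ℕ, m ≠ 0 → ∀ S : Finset (𝓞 K),
      (∀ γ ∈ S, γ ≠ 0 ∧ (∀ τ, |cnj ι τ γ| ≤ B) ∧ ∀ p : ℕ, p.Prime → ¬ p ∣ m →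
        p ∣ Ideal.absNorm (Ideal.span {γ}) → p ^ 2 ∣ Ideal.absNorm (Ideal.span {γ})) →
      (S.card : ℝ) ≤ C * ((m : ℝ) ^ ε * (B ^ ((n : ℝ) / 2) * B ^ ε)) := by
  have hn0' : (0 : ℝ) < n := by exact_mod_cast hn0
  obtain ⟨C1, hC1, h1⟩ := exists_ncard_ideal_divisors_le K (show 0 < ε / n by positivity)
  obtain ⟨C2, hC2, h2⟩ := exists_sum_inv_le (show 0 < ε / (2 * n) by positivity)
  obtain ⟨C3, hC3, h3⟩ := exists_card_norm_eq_le ι (show 0 < ε / 2 by positivity)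
  refine ⟨C1 * C2 * C3, ?_, fun B hB m hm S hS => ?_⟩
  · exact one_le_mul_of_one_le_of_one_le (one_le_mul_of_one_le_of_one_le hC1 hC2) hC3
  have hB0 : 0 < B := by linarith
  set Y := ⌊B ^ n⌋₊ with hY
  have hY1 : 1 ≤ Y := Nat.le_floor (by exact_mod_cast one_le_pow₀ hB)
  have hYB : (Y : ℝ) ≤ B ^ n := Nat.floor_le (by positivity)
  have hYe : (Y : ℝ) ^ (ε / (2 * n)) ≤ B ^ (ε / 2) := by
    calc _ ≤ (B ^ n) ^ (ε / (2 * n)) := by gcongr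
      _ = B ^ (ε / 2) := by
        rw [← Real.rpow_natCast, ← Real.rpow_mul hB0.le]; congr 1; field_simp
  have hYs : √(Y : ℝ) ≤ B ^ ((n : ℝ) / 2) := by
    rw [Real.sqrt_eq_rpow]
    calc _ ≤ (B ^ n) ^ ((1 : ℝ) / 2) := by gcongr
      _ = B ^ ((n : ℝ) / 2) := by
        rw [← Real.rpow_natCast, ← Real.rpow_mul hB0.le]; congr 1; ring
  have hdiv : (m.divisors.card : ℝ) ≤ C1 * (m : ℝ) ^ ε := by
    refine (Nat.cast_le.2 (card_divisors_le_ncard K hm)).trans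
      ((h1 _ (span_natCast_ne_zero hm)).trans (le_of_eq ?_))
    rw [Ideal.absNorm_span_natCast, RingOfIntegers.rank, hn]
    push_cast
    rw [← Real.rpow_natCast, ← Real.rpow_mul (by positivity)]
    congr 2
    field_simp
  set N : 𝓞 K → ℕ := fun γ => Ideal.absNorm (Ideal.span {γ}) with hN
  rw [Finset.card_eq_sum_card_image N S]
  push_cast
  have him : ((S.image N).card : ℝ) ≤
      C1 * (m : ℝ) ^ ε * (B ^ ((n : ℝ) / 2) * (C2 * B ^ (ε / 2))) := by
    refine (card_powerful_le (Y := Y) hm (S.image N) ?_).trans ?_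
    · intro k hk
      obtain ⟨γ, hγ, rfl⟩ := Finset.mem_image.1 hk
      obtain ⟨hγ0, hγB, hγp⟩ := hS γ hγ
      refine ⟨?_, Nat.le_floor (absNorm_le_pow ι hn hγB), hγp⟩
      have := one_le_absNorm_span hγ0
      exact_mod_cast this
    · gcongr
      exact (h2 Y hY1).trans (by gcongr)
  refine le_trans (Finset.sum_le_card_nsmul _ _ (C3 * B ^ (ε / 2)) ?_) ?_
  · intro k _
    refine h3 B hB k _ fun γ hγ => ?_
    rw [Finset.mem_filter] at hγ
    exact ⟨(hS γ hγ.1).1, hγ.2, (hS γ hγ.1).2.1⟩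
  · rw [nsmul_eq_mul]
    calc _ ≤ C1 * (m : ℝ) ^ ε * (B ^ ((n : ℝ) / 2) * (C2 * B ^ (ε / 2))) *
          (C3 * B ^ (ε / 2)) := by gcongr
      _ = C1 * C2 * C3 * ((m : ℝ) ^ ε * (B ^ ((n : ℝ) / 2) * (B ^ (ε / 2) * B ^ (ε / 2)))) := by
          ring
      _ = _ := by rw [← Real.rpow_add hB0, add_halves]

/-- An ideal whose prime divisors have distinct prime norms. -/
def IsSplitIdeal (𝔠 : Ideal (𝓞 K)) : Prop :=
  𝔠 ≠ ⊥ ∧ ∀ 𝔭 : Ideal (𝓞 K), 𝔭.IsPrime → 𝔠 ≤ 𝔭 → (Ideal.absNorm 𝔭).Prime ∧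
    ∀ 𝔭' : Ideal (𝓞 K), 𝔭'.IsPrime → 𝔠 ≤ 𝔭' → Ideal.absNorm 𝔭' = Ideal.absNorm 𝔭 → 𝔭' = 𝔭

/-- The prime divisors of an ideal. -/
def primesOf (𝔠 : Ideal (𝓞 K)) : Finset (Ideal (𝓞 K)) :=
  (UniqueFactorizationMonoid.normalizedFactors 𝔠).toFinset

lemma mem_primesOf {𝔠 𝔭 : Ideal (𝓞 K)} (h : 𝔠 ≠ ⊥) : 𝔭 ∈ primesOf 𝔠 ↔ 𝔭.IsPrime ∧ 𝔠 ≤ 𝔭 := by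
  rw [primesOf, Multiset.mem_toFinset, Ideal.mem_normalizedFactors_iff h]

/-- The product of the norms of the prime divisors. -/
def charMod (𝔠 : Ideal (𝓞 K)) : ℕ := ∏ 𝔭 ∈ primesOf 𝔠, Ideal.absNorm 𝔭

lemma IsSplitIdeal.charMod_pos {𝔠 : Ideal (𝓞 K)} (h : IsSplitIdeal 𝔠) : 0 < charMod 𝔠 :=
  Finset.prod_pos fun 𝔭 h𝔭 => (h.2 𝔭 ((mem_primesOf h.1).1 h𝔭).1 ((mem_primesOf h.1).1 h𝔭).2).1.pos

lemma charMod_dvd (𝔠 : Ideal (𝓞 K)) :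
    charMod 𝔠 ∣ Ideal.absNorm 𝔠 := by
  rw [charMod, ← map_prod]
  refine map_dvd Ideal.absNorm (Finset.prod_primes_dvd _ ?_ ?_)
  · intro 𝔭 h𝔭
    exact UniqueFactorizationMonoid.prime_of_normalized_factor _ (Multiset.mem_toFinset.1 h𝔭)
  · intro 𝔭 h𝔭
    exact UniqueFactorizationMonoid.dvd_of_mem_normalizedFactors (Multiset.mem_toFinset.1 h𝔭)

lemma IsSplitIdeal.charMod_mem {𝔠 : Ideal (𝓞 K)} (h : IsSplitIdeal 𝔠) {𝔭 : Ideal (𝓞 K)}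
    (hp : 𝔭.IsPrime) (hle : 𝔠 ≤ 𝔭) : (charMod 𝔠 : 𝓞 K) ∈ 𝔭 :=
  Ideal.mem_of_dvd _ (Nat.cast_dvd_cast (Finset.dvd_prod_of_mem _ ((mem_primesOf h.1).2 ⟨hp, hle⟩)))
    (Ideal.absNorm_mem 𝔭)

lemma quadSym_val {𝔠 : Ideal (𝓞 K)} (h : IsSplitIdeal 𝔠) (a : ℤ) :
    quadSym 𝔠 (((a : ZMod (charMod 𝔠)).val : ℕ) : 𝓞 K) = quadSym 𝔠 (a : 𝓞 K) := by
  apply quadSym_congr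
  intro 𝔭 hp hle
  have : NeZero (charMod 𝔠) := ⟨h.charMod_pos.ne'⟩
  have h1 : (charMod 𝔠 : ℤ) ∣ ((a : ZMod (charMod 𝔠)).val : ℤ) - a := by
    rw [← ZMod.intCast_eq_intCast_iff_dvd_sub]
    simp
  obtain ⟨c, hc⟩ := h1
  have h2 : (((a : ZMod (charMod 𝔠)).val : ℕ) : 𝓞 K) - (a : 𝓞 K) = (charMod 𝔠 : 𝓞 K) * (c : 𝓞 K) :=
      by
    have := congrArg (fun z : ℤ => (z : 𝓞 K)) hc
    push_cast at this
    exact this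
  rw [h2]
  exact Ideal.mul_mem_right _ _ (h.charMod_mem hp hle)

/-- The restriction of the quadratic residue symbol to the rational integers, as a Dirichlet
character. -/
def idealChar {𝔠 : Ideal (𝓞 K)} (h : IsSplitIdeal 𝔠) : DirichletCharacter ℤ (charMod 𝔠) where
  toFun a := quadSym 𝔠 ((a.val : ℕ) : 𝓞 K)
  map_one' := by
    have := quadSym_val h 1
    rw [Int.cast_one] at this
    rw [this, Int.cast_one, quadSym_one]
  map_mul' a b := by
    obtain ⟨a, rfl⟩ := ZMod.intCast_surjective a
    obtain ⟨b, rfl⟩ := ZMod.intCast_surjective b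
    rw [← Int.cast_mul, quadSym_val h, quadSym_val h, quadSym_val h, Int.cast_mul, quadSym_mul]
  map_nonunit' a ha := by
    have : NeZero (charMod 𝔠) := ⟨h.charMod_pos.ne'⟩
    change quadSym 𝔠 ((a.val : ℕ) : 𝓞 K) = 0
    by_contra h0
    rw [← Ne, quadSym_ne_zero_iff h.1] at h0
    apply ha
    rw [← ZMod.natCast_zmod_val a, ZMod.isUnit_iff_coprime]
    rw [Nat.coprime_iff_gcd_eq_one]
    by_contra hg
    obtain ⟨p, hp, hpg⟩ := Nat.exists_prime_and_dvd hg
    have hpq := hpg.trans (Nat.gcd_dvd_right _ _)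
    have hpa := hpg.trans (Nat.gcd_dvd_left _ _)
    obtain ⟨𝔭, h𝔭, hp'⟩ := hp.prime.exists_mem_finset_dvd hpq
    rw [mem_primesOf h.1] at h𝔭
    refine not_mem_of_coprime h0 h𝔭.2 h𝔭.1.ne_top ?_
    have h3 := (Nat.prime_dvd_prime_iff_eq hp (h.2 𝔭 h𝔭.1 h𝔭.2).1).1 hp'
    exact Ideal.mem_of_dvd _ (Nat.cast_dvd_cast (h3 ▸ hpa)) (Ideal.absNorm_mem 𝔭)

lemma idealChar_intCast {𝔠 : Ideal (𝓞 K)} (h : IsSplitIdeal 𝔠) (a : ℤ) :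
    idealChar h (a : ZMod (charMod 𝔠)) = quadSym 𝔠 (a : 𝓞 K) := quadSym_val h a

lemma exists_nat_sub_mem {𝔭 : Ideal (𝓞 K)} (hp : (Ideal.absNorm 𝔭).Prime) (β : 𝓞 K) :
    ∃ a : ℕ, β - a ∈ 𝔭 := by
  have : Fact (Ideal.absNorm 𝔭).Prime := ⟨hp⟩
  have hcard : Nat.card (𝓞 K ⧸ 𝔭) = Ideal.absNorm 𝔭 := rfl
  have h1 : Ideal.Quotient.mk 𝔭 1 ≠ 0 := by
    intro h
    rw [Ideal.Quotient.eq_zero_iff_mem, ← Ideal.eq_top_iff_one, ← Ideal.absNorm_eq_one_iff] at h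
    exact hp.ne_one h
  have : Finite (𝓞 K ⧸ 𝔭) := Nat.finite_of_card_ne_zero (by rw [hcard]; exact hp.ne_zero)
  have h2 : Ideal.Quotient.mk 𝔭 β ∈ AddSubmonoid.multiples (Ideal.Quotient.mk 𝔭 1) := by
    rw [mem_multiples_iff_mem_zmultiples]
    exact mem_zmultiples_of_prime_card hcard h1
  obtain ⟨a, ha⟩ := h2
  refine ⟨a, ?_⟩
  rw [← Ideal.Quotient.eq_zero_iff_mem, map_sub, ← ha]
  simp

lemma IsSplitIdeal.exists_int_sub_mem {𝔠 : Ideal (𝓞 K)} (h : IsSplitIdeal 𝔠) (β : 𝓞 K) :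
    ∃ b : ℤ, ∀ 𝔭 : Ideal (𝓞 K), 𝔭.IsPrime → 𝔠 ≤ 𝔭 → β - b ∈ 𝔭 := by
  have h1 : ∀ 𝔭 : Ideal (𝓞 K), ∃ a : ℕ, 𝔭 ∈ primesOf 𝔠 → β - a ∈ 𝔭 := by
    intro 𝔭
    by_cases hp : 𝔭 ∈ primesOf 𝔠
    · have := (mem_primesOf h.1).1 hp
      obtain ⟨a, ha⟩ := exists_nat_sub_mem (h.2 𝔭 this.1 this.2).1 β
      exact ⟨a, fun _ => ha⟩
    · exact ⟨0, fun h => absurd h hp⟩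
  choose a ha using h1
  obtain ⟨k, hk⟩ := Nat.chineseRemainderOfFinset a (fun 𝔭 => Ideal.absNorm 𝔭) (primesOf 𝔠)
    (fun 𝔭 hp => by
      have := (mem_primesOf h.1).1 hp
      exact (h.2 𝔭 this.1 this.2).1.ne_zero)
    (fun 𝔭 hp 𝔮 hq hne => by
      have h1 := (mem_primesOf h.1).1 hp
      have h2 := (mem_primesOf h.1).1 hq
      refine (Nat.coprime_primes (h.2 𝔭 h1.1 h1.2).1 (h.2 𝔮 h2.1 h2.2).1).2 fun he => ?_
      exact hne ((h.2 𝔮 h2.1 h2.2).2 𝔭 h1.1 h1.2 he))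
  refine ⟨k, fun 𝔭 hp hle => ?_⟩
  have hmem := (mem_primesOf h.1).2 ⟨hp, hle⟩
  have h2 := (Nat.modEq_iff_dvd.1 (hk 𝔭 hmem))
  obtain ⟨c, hc⟩ := h2
  have h3 : ((a 𝔭 : ℕ) : 𝓞 K) - (k : 𝓞 K) = (Ideal.absNorm 𝔭 : 𝓞 K) * (c : 𝓞 K) := by
    have := congrArg (fun z : ℤ => (z : 𝓞 K)) hc
    push_cast at this
    exact this
  have h4 : β - ((k : ℤ) : 𝓞 K) = (β - a 𝔭) + (Ideal.absNorm 𝔭 : 𝓞 K) * (c : 𝓞 K) := by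
    rw [← h3]; push_cast; ring
  rw [h4]
  exact add_mem (ha 𝔭 hmem) (Ideal.mul_mem_right _ _ (Ideal.absNorm_mem 𝔭))

lemma exists_legSym_eq_neg_one {𝔭 : Ideal (𝓞 K)} (hp : 𝔭.IsPrime) (h0 : 𝔭 ≠ ⊥)
    (h2 : (2 : 𝓞 K) ∉ 𝔭) : ∃ β, legSym 𝔭 β = -1 := by
  let _ := resField 𝔭 hp h0
  let _ : Fintype (𝓞 K ⧸ 𝔭) := @Fintype.ofFinite _ (finite_quot h0)
  have hchar : ringChar (𝓞 K ⧸ 𝔭) ≠ 2 := by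
    intro h
    apply h2
    rw [← Ideal.Quotient.eq_zero_iff_mem, map_ofNat]
    have := CharP.cast_eq_zero (𝓞 K ⧸ 𝔭) (ringChar (𝓞 K ⧸ 𝔭))
    rw [h] at this
    exact_mod_cast this
  obtain ⟨z, hz⟩ := FiniteField.exists_nonsquare hchar
  obtain ⟨β, rfl⟩ := Ideal.Quotient.mk_surjective z
  refine ⟨β, ?_⟩
  rw [legSym, if_neg, if_neg hz]
  intro h
  exact hz (by rw [h]; exact IsSquare.zero)

/-- If the character attached to an ideal is principal, the ideal is powerful. -/
lemma IsSplitIdeal.sq_dvd_of_idealChar_eq_one {𝔠 : Ideal (𝓞 K)} (h : IsSplitIdeal 𝔠)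
    (hodd : OddIdeal 𝔠) (hχ : idealChar h = 1) {𝔭 : Ideal (𝓞 K)} (hp : 𝔭.IsPrime)
    (hle : 𝔠 ≤ 𝔭) : 𝔭 ^ 2 ∣ 𝔠 := by
  by_contra hsq
  obtain ⟨𝔡, rfl⟩ := Ideal.dvd_iff_le.2 hle
  have h0 : 𝔭 ≠ ⊥ := by
    rintro rfl
    exact h.1 (by simp)
  have hd0 : 𝔡 ≠ ⊥ := by
    rintro rfl
    exact h.1 (by simp)
  have hmax : 𝔭.IsMaximal := hp.isMaximal h0
  have hcop : IsCoprime 𝔭 𝔡 := by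
    apply Ideal.coprime_of_no_prime_ge
    intro P h1 h2 hP
    have := hmax.eq_of_le hP.ne_top h1
    subst this
    apply hsq
    rw [sq]
    exact mul_dvd_mul_left _ (Ideal.dvd_iff_le.2 h2)
  obtain ⟨β, hβ⟩ := exists_legSym_eq_neg_one hp h0 (not_mem_of_odd hodd hle hp.ne_top)
  obtain ⟨i, hi, j, hj, hij⟩ := Ideal.isCoprime_iff_exists.1 hcop
  obtain ⟨b, hb⟩ := h.exists_int_sub_mem (β * j + i)
  have hbp : β - (b : 𝓞 K) ∈ 𝔭 := by
    have h1 := hb 𝔭 hp hle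
    have : β - (b : 𝓞 K) = (β * j + i - b) + (β - 1) * i := by
      rw [show j = 1 - i by rw [← hij]; ring]; ring
    rw [this]
    exact add_mem h1 (Ideal.mul_mem_left _ _ hi)
  have hq1 : quadSym 𝔡 (b : 𝓞 K) = 1 := by
    rw [← quadSym_one 𝔡]
    apply quadSym_congr
    intro 𝔮 hq hdq
    have h1 := hb 𝔮 hq (Ideal.mul_le_right.trans hdq)
    have : (b : 𝓞 K) - 1 = -(β * j + i - b) + (β - 1) * j := by
      rw [show i = 1 - j by rw [← hij]; ring]; ring
    rw [this]
    exact add_mem (neg_mem h1) (Ideal.mul_mem_left _ _ (hdq hj))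
  have hq2 : quadSym (𝔭 * 𝔡) (b : 𝓞 K) = -1 := by
    rw [quadSym_mul_ideal h0 hd0, hq1, quadSym_prime hp h0, ← legSym_congr hbp, hβ, mul_one]
  have h3 := idealChar_intCast h b
  rw [hq2, hχ] at h3
  by_cases hu : IsUnit (b : ZMod (charMod (𝔭 * 𝔡)))
  · rw [MulChar.one_apply hu] at h3
    norm_num at h3
  · rw [MulChar.map_nonunit _ hu] at h3
    norm_num at h3

lemma sum_range_char_le {q : ℕ} (hq : 0 < q) (χ : DirichletCharacter ℤ q) {L₀ X : ℝ}
    (h : ∀ M : ℝ, 0 ≤ M → ∀ N : ℝ, 1 ≤ N → N ≤ L₀ →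
      |∑ m ∈ Finset.Ioc ⌊M⌋₊ ⌊M + N⌋₊, ((χ (m : ZMod q) : ℤ) : ℝ)| ≤ X)
    (hX : 0 ≤ X) (u : ℤ) {L : ℕ} (hL : (L : ℝ) ≤ L₀) :
    |∑ j ∈ Finset.range L, ((χ ((u + j : ℤ) : ZMod q) : ℤ) : ℝ)| ≤ X := by
  rcases Nat.eq_zero_or_pos L with rfl | hLpos
  · simpa using hX
  set M : ℕ := ((u - 1) % q).toNat with hM
  have hMu : ((M : ℤ) : ZMod q) = ((u - 1 : ℤ) : ZMod q) := by
    rw [hM, Int.toNat_of_nonneg (Int.emod_nonneg _ (by omega)), ZMod.intCast_mod]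
  have := h M (by positivity) L (by exact_mod_cast hLpos) hL
  rw [← Nat.cast_add, Nat.floor_natCast, Nat.floor_natCast] at this
  convert this using 2
  rw [← Finset.Ico_add_one_add_one_eq_Ioc, Finset.sum_Ico_eq_sum_range]
  refine Finset.sum_congr (by congr 1; omega) fun j _ => ?_
  congr 3
  push_cast at hMu ⊢
  rw [hMu]
  ring

/-- Along a residue class the symbol is a multiple of the character attached to the split part. -/
lemma exists_quadSym_eq_mul_idealChar [IsGalois ℚ K] (ι : K →+* ℝ) {γ : 𝓞 K} (hγ : γ ≠ 0)
    {𝔠 𝔤 : Ideal (𝓞 K)} (hfac : Ideal.span {γ} = 𝔠 * 𝔤) {r : ℕ} (h2r : 2 ∣ r)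
    (hcr : IsCoprime 𝔠 (Ideal.span {(r : 𝓞 K)})) (hrg : (r : 𝓞 K) ∈ 𝔤.radical)
    (hs : IsSplitIdeal 𝔠) (β : 𝓞 K) {b : ℤ}
    (hb : ∀ 𝔭 : Ideal (𝓞 K), 𝔭.IsPrime → 𝔠 ≤ 𝔭 → β - b ∈ 𝔭) (T : Finset ℤ)
    (hT : ∀ a ∈ T, TotPos (β + (a : 𝓞 K)) ∧ OddIdeal (Ideal.span {β + (a : 𝓞 K)}))
    (hmod : ∀ a ∈ T, ∀ c ∈ T, (4 * r : ℤ) ∣ c - a) :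
    ∃ s : ℤ, |s| ≤ 1 ∧ ∀ a ∈ T, quadSym (Ideal.span {β + (a : 𝓞 K)}) γ =
      s * idealChar hs ((b + a : ℤ) : ZMod (charMod 𝔠)) := by
  have htri : ∀ (𝔟 : Ideal (𝓞 K)) (α : 𝓞 K), |quadSym 𝔟 α| ≤ 1 := by
    intro 𝔟 α
    rcases quadSym_trichotomy 𝔟 α with h | h | h <;> simp [h]
  have hχ : ∀ a : ℤ, idealChar hs ((b + a : ℤ) : ZMod (charMod 𝔠)) = quadSym 𝔠 (β + (a : 𝓞 K)) := by
    intro a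
    rw [idealChar_intCast]
    apply quadSym_congr
    intro 𝔭 hp hle
    have : (((b + a : ℤ)) : 𝓞 K) - (β + (a : 𝓞 K)) = -(β - b) := by push_cast; ring
    rw [this]
    exact neg_mem (hb 𝔭 hp hle)
  have hne : ∀ a ∈ T, Ideal.span {β + (a : 𝓞 K)} ≠ ⊥ := by
    intro a ha h
    rw [Ideal.span_singleton_eq_bot] at h
    exact (hT a ha).1.ne_zero ι h
  have hodd : OddIdeal 𝔠 := by
    apply Ideal.coprime_of_no_prime_ge
    intro P h1 h2 hP
    refine not_mem_of_coprime hcr h1 hP.ne_top ?_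
    exact Ideal.mem_of_dvd _ (by exact_mod_cast Nat.cast_dvd_cast (α := 𝓞 K) h2r)
      (h2 (Ideal.mem_span_singleton_self _))
  by_cases hall : ∀ a ∈ T, quadSym (Ideal.span {β + (a : 𝓞 K)}) γ = 0
  · exact ⟨0, by simp, fun a ha => by rw [hall a ha, zero_mul]⟩
  push Not at hall
  obtain ⟨a₂, ha₂, hq₂⟩ := hall
  have hcop₂ := (quadSym_ne_zero_iff (hne a₂ ha₂)).1 hq₂
  refine ⟨quadSym (Ideal.span {β + (a₂ : 𝓞 K)}) γ * quadSym 𝔠 (β + (a₂ : 𝓞 K)), ?_, ?_⟩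
  · rw [abs_mul]
    exact mul_le_one₀ (htri _ _) (abs_nonneg _) (htri _ _)
  intro a ha
  rw [hχ]
  obtain ⟨k, hk⟩ := hmod a₂ ha₂ a ha
  have hk' : (a : 𝓞 K) - (a₂ : 𝓞 K) = 4 * ((r : 𝓞 K) * (k : 𝓞 K)) := by
    have := congrArg (fun z : ℤ => (z : 𝓞 K)) hk
    push_cast at this
    rw [this]; ring
  by_cases hcop : IsCoprime (Ideal.span {β + (a : 𝓞 K)}) (Ideal.span {γ})
  · have hrec := reciprocity ι hγ hfac hodd (isCoprime_of_mem_radical hcr hrg)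
      (hT a₂ ha₂).1 (hT a ha).1 (hT a₂ ha₂).2 (hT a ha).2 hcop₂ hcop
      (e := (r : 𝓞 K) * (k : 𝓞 K)) (by
        apply Ideal.mul_mem_right
        rw [Ideal.radical_mul]
        refine ⟨Ideal.le_radical ?_, hrg⟩
        rw [Ideal.mem_span_singleton]
        exact_mod_cast Nat.cast_dvd_cast (α := 𝓞 K) h2r) (by rw [← hk']; ring)
    have hc𝔠 : IsCoprime 𝔠 (Ideal.span {β + (a : 𝓞 K)}) := by
      rw [hfac] at hcop
      exact hcop.of_mul_right_left.symm
    have hsq : quadSym 𝔠 (β + (a : 𝓞 K)) * quadSym 𝔠 (β + (a : 𝓞 K)) = 1 := by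
      have := (quadSym_ne_zero_iff hs.1).2 hc𝔠
      rcases quadSym_trichotomy 𝔠 (β + (a : 𝓞 K)) with h | h | h
      · exact absurd h this
      · rw [h]; norm_num
      · rw [h]; norm_num
    rw [hrec, mul_assoc, hsq, mul_one]
  · have h0 : quadSym (Ideal.span {β + (a : 𝓞 K)}) γ = 0 := by
      by_contra h
      exact hcop ((quadSym_ne_zero_iff (hne a ha)).1 h)
    rw [h0]
    symm
    apply mul_eq_zero_of_right
    by_contra h
    rw [← Ne, quadSym_ne_zero_iff hs.1] at h
    apply hcop
    apply Ideal.coprime_of_no_prime_ge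
    intro P h1 h2 hP
    have hα : β + (a : 𝓞 K) ∈ P := h1 (Ideal.mem_span_singleton_self _)
    rw [hfac, hP.mul_le] at h2
    rcases h2 with h2 | h2
    · exact not_mem_of_coprime h h2 hP.ne_top hα
    · have hrP : (r : 𝓞 K) ∈ P := hP.radical_le_iff.2 h2 hrg
      have hα₂ : β + (a₂ : 𝓞 K) ∈ P := by
        have : β + (a₂ : 𝓞 K) = (β + (a : 𝓞 K)) - (r : 𝓞 K) * (4 * (k : 𝓞 K)) := by
          linear_combination -hk'
        rw [this]
        exact sub_mem hα (Ideal.mul_mem_right _ _ hrP)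
      refine not_mem_of_coprime hcop₂ ?_ hP.ne_top ?_
      · rwa [Ideal.span_singleton_le_iff_mem]
      · have : γ ∈ 𝔠 * 𝔤 := hfac ▸ Ideal.mem_span_singleton_self γ
        exact h2 (Ideal.mul_le_right this)

lemma exists_eq_image_of_convex {T : Finset ℤ} (hT : T.Nonempty) {m : ℕ} (hm : 0 < m)
    (hmod : ∀ a ∈ T, ∀ c ∈ T, (m : ℤ) ∣ c - a)
    (hconv : ∀ a b c : ℤ, a ∈ T → c ∈ T → a ≤ b → b ≤ c → (m : ℤ) ∣ b - a → b ∈ T) :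
    ∃ (a₀ : ℤ) (L : ℕ), a₀ + m * (L : ℤ) ∈ T ∧ a₀ ∈ T ∧
      T = (Finset.range (L + 1)).image (fun j : ℕ => a₀ + m * (j : ℤ)) := by
  obtain ⟨k, hk⟩ := hmod _ (T.min'_mem hT) _ (T.max'_mem hT)
  have hle := T.min'_le _ (T.max'_mem hT)
  have hk0 : 0 ≤ k := by
    by_contra hneg
    push Not at hneg
    have : (m : ℤ) * k < 0 := mul_neg_of_pos_of_neg (by exact_mod_cast hm) hneg
    omega
  obtain ⟨L, rfl⟩ := Int.eq_ofNat_of_zero_le hk0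
  have hm' : (0 : ℤ) < m := by exact_mod_cast hm
  refine ⟨T.min' hT, L, ?_, T.min'_mem hT, ?_⟩
  · rw [← hk]
    simpa using T.max'_mem hT
  · ext a
    simp only [Finset.mem_image, Finset.mem_range]
    constructor
    · intro ha
      obtain ⟨j, hj⟩ := hmod _ (T.min'_mem hT) _ ha
      have h1 := T.min'_le _ ha
      have h2 := T.le_max' _ ha
      have hj0 : 0 ≤ j := by
        by_contra hneg
        push Not at hneg
        have : (m : ℤ) * j < 0 := mul_neg_of_pos_of_neg hm' hneg
        omega
      obtain ⟨i, rfl⟩ := Int.eq_ofNat_of_zero_le hj0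
      refine ⟨i, ?_, by omega⟩
      have : (m : ℤ) * i ≤ m * L := by omega
      have := le_of_mul_le_mul_left this hm'
      omega
    · rintro ⟨j, hj, rfl⟩
      refine hconv _ _ _ (T.min'_mem hT) (T.max'_mem hT) ?_ ?_ ⟨j, by ring⟩
      · have : 0 ≤ (m : ℤ) * j := by positivity
        omega
      · have : (m : ℤ) * j ≤ m * L := by
          apply mul_le_mul_of_nonneg_left _ hm'.le
          exact_mod_cast Nat.lt_succ_iff.1 hj
        omega

lemma isUnit_natCast_charMod {𝔠 : Ideal (𝓞 K)} (hs : IsSplitIdeal 𝔠) {r : ℕ}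
    (hcr : IsCoprime 𝔠 (Ideal.span {(r : 𝓞 K)})) : IsUnit (r : ZMod (charMod 𝔠)) := by
  rw [ZMod.isUnit_iff_coprime]
  by_contra hcop
  obtain ⟨p, hp, hpr, hpq⟩ := Nat.Prime.not_coprime_iff_dvd.1 hcop
  obtain ⟨𝔭, h𝔭, hp'⟩ := hp.prime.exists_mem_finset_dvd hpq
  rw [mem_primesOf hs.1] at h𝔭
  refine not_mem_of_coprime hcr h𝔭.2 h𝔭.1.ne_top ?_
  have h3 := (Nat.prime_dvd_prime_iff_eq hp (hs.2 𝔭 h𝔭.1 h𝔭.2).1).1 hp'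
  exact Ideal.mem_of_dvd _ (Nat.cast_dvd_cast (h3 ▸ hpr)) (Ideal.absNorm_mem 𝔭)

lemma progression_sum_le [IsGalois ℚ K] (ι : K →+* ℝ) {γ : 𝓞 K} (hγ : γ ≠ 0)
    {𝔠 𝔤 : Ideal (𝓞 K)} (hfac : Ideal.span {γ} = 𝔠 * 𝔤) {r : ℕ} (hr : 0 < r) (h2r : 2 ∣ r)
    (hcr : IsCoprime 𝔠 (Ideal.span {(r : 𝓞 K)})) (hrg : (r : 𝓞 K) ∈ 𝔤.radical)
    (hs : IsSplitIdeal 𝔠) {L₀ X : ℝ} (hX : 0 ≤ X)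
    (hsum : ∀ M : ℝ, 0 ≤ M → ∀ N : ℝ, 1 ≤ N → N ≤ L₀ →
      |∑ m ∈ Finset.Ioc ⌊M⌋₊ ⌊M + N⌋₊, ((idealChar hs (m : ZMod (charMod 𝔠)) : ℤ) : ℝ)| ≤ X)
    (β : 𝓞 K) (T : Finset ℤ)
    (hT : ∀ a ∈ T, TotPos (β + (a : 𝓞 K)) ∧ OddIdeal (Ideal.span {β + (a : 𝓞 K)}))
    (hmod : ∀ a ∈ T, ∀ c ∈ T, ((4 * r : ℕ) : ℤ) ∣ c - a)
    (hconv : ∀ a b c : ℤ, a ∈ T → c ∈ T → a ≤ b → b ≤ c → ((4 * r : ℕ) : ℤ) ∣ b - a → b ∈ T)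
    (hlen : ∀ a ∈ T, ∀ c ∈ T, ((c - a : ℤ) : ℝ) + 1 ≤ L₀) :
    |∑ a ∈ T, ((quadSym (Ideal.span {β + (a : 𝓞 K)}) γ : ℤ) : ℝ)| ≤ X := by
  rcases T.eq_empty_or_nonempty with rfl | hne
  · simpa using hX
  obtain ⟨b, hb⟩ := hs.exists_int_sub_mem β
  obtain ⟨s, hs1, hsT⟩ := exists_quadSym_eq_mul_idealChar ι hγ hfac h2r hcr hrg hs β hb T hT
    (by exact_mod_cast hmod)
  obtain ⟨a₀, L, h1, h0, himg⟩ := exists_eq_image_of_convex hne (by omega) hmod hconv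
  have hunit : IsUnit (((4 * r : ℕ) : ZMod (charMod 𝔠))) := by
    apply isUnit_natCast_charMod hs
    have h2 : IsCoprime 𝔠 (Ideal.span {(2 : 𝓞 K)}) := by
      obtain ⟨k, rfl⟩ := h2r
      rw [Nat.cast_mul, ← Ideal.span_singleton_mul_span_singleton] at hcr
      exact_mod_cast hcr.of_mul_right_left
    have h4 : ((4 * r : ℕ) : 𝓞 K) = 2 * (2 * r) := by push_cast; ring
    rw [h4, ← Ideal.span_singleton_mul_span_singleton, ← Ideal.span_singleton_mul_span_singleton]
    exact IsCoprime.mul_right h2 (IsCoprime.mul_right h2 hcr)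
  obtain ⟨v, hv⟩ := hunit
  obtain ⟨u, hu⟩ := ZMod.intCast_surjective
    ((↑v⁻¹ : ZMod (charMod 𝔠)) * ((b + a₀ : ℤ) : ZMod (charMod 𝔠)))
  have hinj : Set.InjOn (fun j : ℕ => a₀ + ((4 * r : ℕ) : ℤ) * (j : ℤ))
      (Finset.range (L + 1)) := by
    intro i _ j _ hij
    have hm : ((4 * r : ℕ) : ℤ) ≠ 0 := by positivity
    simpa [hr.ne'] using hij
  have hchar : ∀ a ∈ T, ((quadSym (Ideal.span {β + (a : 𝓞 K)}) γ : ℤ) : ℝ) =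
      (s : ℝ) * ((idealChar hs ((b + a : ℤ) : ZMod (charMod 𝔠)) : ℤ) : ℝ) := by
    intro a ha
    rw [hsT a ha]; push_cast; rfl
  rw [Finset.sum_congr rfl hchar, himg, Finset.sum_image hinj]
  have hterm : ∀ j : ℕ, ((b + (a₀ + ((4 * r : ℕ) : ℤ) * (j : ℤ)) : ℤ) : ZMod (charMod 𝔠)) =
      ((4 * r : ℕ) : ZMod (charMod 𝔠)) * ((u + j : ℤ) : ZMod (charMod 𝔠)) := by
    intro j
    rw [Int.cast_add u, hu, ← hv, mul_add, ← mul_assoc, Units.mul_inv, one_mul, hv]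
    push_cast; ring
  simp only [hterm, map_mul, Int.cast_mul]
  rw [← Finset.mul_sum, ← Finset.mul_sum, abs_mul, abs_mul]
  have hlen' : ((L + 1 : ℕ) : ℝ) ≤ L₀ := by
    refine le_trans ?_ (hlen _ h0 _ h1)
    push_cast
    have h4 : (1 : ℝ) ≤ 4 * r := by exact_mod_cast (by omega : 1 ≤ 4 * r)
    nlinarith [(Nat.cast_nonneg L : (0 : ℝ) ≤ L)]
  have h2 := sum_range_char_le hs.charMod_pos (idealChar hs) hsum hX u hlen'
  have h3 : |((idealChar hs ((4 * r : ℕ) : ZMod (charMod 𝔠)) : ℤ) : ℝ)| ≤ 1 := by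
    have h5 : idealChar hs ((4 * r : ℕ) : ZMod (charMod 𝔠)) =
        quadSym 𝔠 (((4 * r : ℕ) : ℤ) : 𝓞 K) := by
      rw [← idealChar_intCast hs]; push_cast; rfl
    rw [h5]
    rcases quadSym_trichotomy 𝔠 (((4 * r : ℕ) : ℤ) : 𝓞 K) with h | h | h <;> rw [h] <;> simp
  have h6 : |(s : ℝ)| ≤ 1 := by exact_mod_cast hs1
  calc _ ≤ 1 * (1 * X) := by gcongr
    _ = X := by ring

lemma fibre_sum_le [IsGalois ℚ K] (ι : K →+* ℝ) {γ : 𝓞 K} (hγ : γ ≠ 0)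
    {𝔠 𝔤 : Ideal (𝓞 K)} (hfac : Ideal.span {γ} = 𝔠 * 𝔤) {m₀ s : ℕ} (hr : 0 < m₀ * s)
    (h2r : 2 ∣ m₀ * s)
    (hcr : IsCoprime 𝔠 (Ideal.span {((m₀ * s : ℕ) : 𝓞 K)}))
    (hrg : ((m₀ * s : ℕ) : 𝓞 K) ∈ 𝔤.radical)
    (hs : IsSplitIdeal 𝔠) {L₀ X : ℝ} (hX : 0 ≤ X)
    (hsum : ∀ M : ℝ, 0 ≤ M → ∀ N : ℝ, 1 ≤ N → N ≤ L₀ →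
      |∑ m ∈ Finset.Ioc ⌊M⌋₊ ⌊M + N⌋₊, ((idealChar hs (m : ZMod (charMod 𝔠)) : ℤ) : ℝ)| ≤ X)
    (β : 𝓞 K) (T : Finset ℤ)
    (hT : ∀ a ∈ T, TotPos (β + (a : 𝓞 K)) ∧ OddIdeal (Ideal.span {β + (a : 𝓞 K)}))
    (hdvd : ∀ a ∈ T, (m₀ : ℤ) ∣ a)
    (hconv : ∀ a b c : ℤ, a ∈ T → c ∈ T → a ≤ b → b ≤ c →
      ((4 * (m₀ * s) : ℕ) : ℤ) ∣ b - a → b ∈ T)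
    (hlen : ∀ a ∈ T, ∀ c ∈ T, ((c - a : ℤ) : ℝ) + 1 ≤ L₀) :
    |∑ a ∈ T, ((quadSym (Ideal.span {β + (a : 𝓞 K)}) γ : ℤ) : ℝ)| ≤ 4 * s * X := by
  set R : Finset ℤ := (Finset.range (4 * s)).image (fun j : ℕ => (m₀ : ℤ) * j) with hR
  have hmaps : ∀ a ∈ T, a % ((4 * (m₀ * s) : ℕ) : ℤ) ∈ R := by
    intro a ha
    obtain ⟨k, rfl⟩ := hdvd a ha
    have hm : (0 : ℤ) < m₀ := by exact_mod_cast Nat.pos_of_mul_pos_right hr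
    have hs0 : (0 : ℤ) < 4 * s := by
      have := Nat.pos_of_mul_pos_left hr
      omega
    have heq : ((4 * (m₀ * s) : ℕ) : ℤ) = m₀ * (4 * s) := by push_cast; ring
    rw [heq, Int.mul_emod_mul_of_pos _ _ hm, hR, Finset.mem_image]
    refine ⟨(k % (4 * s)).toNat, ?_, ?_⟩
    · rw [Finset.mem_range]
      have := Int.emod_lt_of_pos k hs0
      have := Int.emod_nonneg k hs0.ne'
      omega
    · rw [Int.toNat_of_nonneg (Int.emod_nonneg k hs0.ne')]
  rw [← Finset.sum_fiberwise_of_maps_to hmaps]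
  refine (Finset.abs_sum_le_sum_abs _ _).trans ?_
  have hcard : (R.card : ℝ) ≤ 4 * s := by
    have := Finset.card_image_le (s := Finset.range (4 * s)) (f := fun j : ℕ => (m₀ : ℤ) * j)
    rw [Finset.card_range] at this
    exact_mod_cast this
  refine (Finset.sum_le_card_nsmul R _ X fun ρ _ => ?_).trans ?_
  · have hmod : ∀ a ∈ T, ∀ c, a % ((4 * (m₀ * s) : ℕ) : ℤ) = ρ →
        (((4 * (m₀ * s) : ℕ) : ℤ) ∣ c - a ↔ c % ((4 * (m₀ * s) : ℕ) : ℤ) = ρ) := by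
      rintro a _ c rfl
      rw [← Int.emod_emod_of_dvd a dvd_rfl, eq_comm, Int.emod_emod_of_dvd a dvd_rfl]
      exact Int.modEq_iff_dvd.symm
    apply progression_sum_le ι hγ hfac hr h2r hcr hrg hs hX hsum β
    · exact fun a ha => hT a (Finset.mem_filter.1 ha).1
    · intro a ha c hc
      rw [Finset.mem_filter] at ha hc
      exact (hmod a ha.1 c ha.2).2 hc.2
    · intro a b c ha hc hab hbc hd
      rw [Finset.mem_filter] at ha hc ⊢
      exact ⟨hconv a b c ha.1 hc.1 hab hbc hd, (hmod a ha.1 b ha.2).1 hd⟩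
    · exact fun a ha c hc => hlen a (Finset.mem_filter.1 ha).1 c (Finset.mem_filter.1 hc).1
  · rw [nsmul_eq_mul]
    gcongr

lemma isSplitIdeal_of_badProd_dvd {γ : 𝓞 K} (hγ : γ ≠ 0) {𝔠 𝔤 : Ideal (𝓞 K)}
    (hfac : Ideal.span {γ} = 𝔠 * 𝔤) {r : ℕ} (hdr : badProd γ ∣ r)
    (hcr : IsCoprime 𝔠 (Ideal.span {(r : 𝓞 K)})) : IsSplitIdeal 𝔠 := by
  have h0 : 𝔠 ≠ ⊥ := by
    intro h
    have hbot : Ideal.span {γ} = ⊥ := by rw [hfac, h, ← Ideal.zero_eq_bot, zero_mul]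
    exact hγ (Ideal.span_singleton_eq_bot.1 hbot)
  have hmem' : γ ∈ 𝔠 * 𝔤 := by
    rw [← hfac]
    exact Ideal.mem_span_singleton_self γ
  have hmem : γ ∈ 𝔠 := Ideal.mul_le_left hmem'
  refine ⟨h0, fun 𝔭 hp hle => ?_⟩
  obtain ⟨p, hpp, hp𝔭⟩ := exists_natPrime_mem hp (by
    rintro rfl
    exact h0 (le_bot_iff.1 hle))
  have hgood : ¬ IsBad γ p := by
    intro hb
    refine not_mem_of_coprime hcr hle hp.ne_top (Ideal.mem_of_dvd _ ?_ hp𝔭)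
    have hpd : p ∣ badProd γ := Finset.dvd_prod_of_mem (fun p => p) ((mem_badSet hγ).2 hb)
    exact Nat.cast_dvd_cast (hpd.trans hdr)
  have h𝔭 : 𝔭 ∈ primesAt γ p := ⟨hp, hp𝔭, hle hmem⟩
  have hN : Ideal.absNorm 𝔭 = p := by
    by_contra h
    exact hgood ⟨hpp, 𝔭, h𝔭, Or.inl h⟩
  refine ⟨by rwa [hN], fun 𝔭' hp' hle' hNN => ?_⟩
  by_contra hne
  refine hgood ⟨hpp, 𝔭, h𝔭, Or.inr ⟨𝔭', ⟨hp', ?_, hle' hmem⟩, hne⟩⟩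
  rw [← hN, ← hNN]
  exact Ideal.absNorm_mem 𝔭'

lemma exists_mem_primesAt {γ : 𝓞 K} (hγ : γ ≠ 0) {p : ℕ} (hp : p.Prime)
    (hd : p ∣ Ideal.absNorm (Ideal.span {γ})) : ∃ 𝔭, 𝔭 ∈ primesAt γ p := by
  have h0 : Ideal.span {γ} ≠ ⊥ := by rwa [Ne, Ideal.span_singleton_eq_bot]
  by_contra hcon
  push Not at hcon
  have hcop : IsCoprime (Ideal.span {γ}) (Ideal.span {(p : 𝓞 K)}) := by
    apply Ideal.coprime_of_no_prime_ge
    intro P h1 h2 hP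
    rw [Ideal.span_singleton_le_iff_mem] at h1 h2
    exact hcon P ⟨hP, h2, h1⟩
  have key : ∀ I : Ideal (𝓞 K), I ≠ 0 → I ∣ Ideal.span {γ} → ¬ p ∣ Ideal.absNorm I := by
    intro I
    induction I using UniqueFactorizationMonoid.induction_on_prime with
    | h₁ => exact fun h => absurd rfl h
    | h₂ I hI =>
      intro _ _ hpd
      rw [Ideal.isUnit_iff.1 hI, Ideal.absNorm_top] at hpd
      exact hp.one_lt.ne' (Nat.dvd_one.1 hpd)
    | h₃ I P hI hP ih =>
      intro _ hdvd hpd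
      rw [map_mul] at hpd
      rcases hp.dvd_mul.1 hpd with h | h
      · have hPp := Ideal.isPrime_of_prime hP
        obtain ⟨q, hq, hqP⟩ := exists_natPrime_mem hPp hP.ne_zero
        obtain ⟨f, _, hN⟩ := exists_absNorm_eq_pow hq hPp hqP
        have := (Nat.prime_dvd_prime_iff_eq hp hq).1 (hp.dvd_of_dvd_pow (hN ▸ h))
        exact hcon P ⟨hPp, this ▸ hqP, Ideal.dvd_span_singleton.1 ((dvd_mul_right P I).trans hdvd)⟩
      · exact ih hI ((dvd_mul_left I P).trans hdvd) h
  exact key _ h0 dvd_rfl hd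

lemma sq_dvd_absNorm_of_isBad {γ : 𝓞 K} {p : ℕ} (h : IsBad γ p) :
    p ^ 2 ∣ Ideal.absNorm (Ideal.span {γ}) := by
  obtain ⟨hp, 𝔭, h𝔭, h⟩ := h
  obtain ⟨f, hf, h1⟩ := exists_absNorm_eq_pow hp h𝔭.1 h𝔭.2.1
  rcases h with h | ⟨𝔭', h𝔭', hne⟩
  · refine dvd_trans ?_ (absNorm_dvd_of_mem h𝔭.2.2)
    rw [h1]
    refine pow_dvd_pow p ?_
    by_contra hlt
    have : f = 1 := by omega
    rw [this, pow_one] at h1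
    exact h h1
  · obtain ⟨f', hf', h1'⟩ := exists_absNorm_eq_pow hp h𝔭'.1 h𝔭'.2.1
    have hcop : IsCoprime 𝔭' 𝔭 := by
      apply Ideal.coprime_of_no_prime_ge
      intro P h2 h3 hP
      have hm := h𝔭.1.isMaximal (ne_bot_of_natCast_mem hp h𝔭.2.1)
      have hm' := h𝔭'.1.isMaximal (ne_bot_of_natCast_mem hp h𝔭'.2.1)
      exact hne ((hm'.eq_of_le hP.ne_top h2).trans (hm.eq_of_le hP.ne_top h3).symm)
    have hmem : γ ∈ 𝔭' * 𝔭 := by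
      rw [Ideal.mul_eq_inf_of_coprime (Ideal.isCoprime_iff_sup_eq.1 hcop)]
      exact ⟨h𝔭'.2.2, h𝔭.2.2⟩
    refine dvd_trans ?_ (absNorm_dvd_of_mem hmem)
    rw [map_mul, h1, h1', ← pow_add]
    exact pow_dvd_pow p (by omega)

lemma sq_dvd_absNorm_of_idealChar_eq_one {γ : 𝓞 K} (hγ : γ ≠ 0) {𝔠 𝔤 : Ideal (𝓞 K)}
    (hfac : Ideal.span {γ} = 𝔠 * 𝔤) {m : ℕ} (h2 : 2 ∣ m)
    (hcr : IsCoprime 𝔠 (Ideal.span {((m * badProd γ : ℕ) : 𝓞 K)}))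
    (hrg : ((m * badProd γ : ℕ) : 𝓞 K) ∈ 𝔤.radical)
    (hs : IsSplitIdeal 𝔠) (hχ : idealChar hs = 1) {p : ℕ} (hp : p.Prime) (hpm : ¬ p ∣ m)
    (hpN : p ∣ Ideal.absNorm (Ideal.span {γ})) : p ^ 2 ∣ Ideal.absNorm (Ideal.span {γ}) := by
  by_cases hb : IsBad γ p
  · exact sq_dvd_absNorm_of_isBad hb
  obtain ⟨𝔭, h𝔭⟩ := exists_mem_primesAt hγ hp hpN
  have hodd : OddIdeal 𝔠 := by
    apply Ideal.coprime_of_no_prime_ge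
    intro P h1 h3 hP
    refine not_mem_of_coprime hcr h1 hP.ne_top ?_
    exact Ideal.mem_of_dvd _ (by exact_mod_cast Nat.cast_dvd_cast (α := 𝓞 K) (h2.mul_right _))
      (h3 (Ideal.mem_span_singleton_self _))
  have hle : 𝔠 ≤ 𝔭 := by
    have h1 : Ideal.span {γ} ≤ 𝔭 := (Ideal.span_singleton_le_iff_mem _).2 h𝔭.2.2
    rw [hfac, h𝔭.1.mul_le] at h1
    refine h1.resolve_right fun h3 => ?_
    have h4 := h𝔭.1.radical_le_iff.2 h3 hrg
    rw [Nat.cast_mul, badProd, Nat.cast_prod] at h4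
    rcases h𝔭.1.mem_or_mem h4 with h4 | h4
    · have hd : IsCoprime (p : ℤ) (m : ℤ) :=
        Nat.isCoprime_iff_coprime.2 ((Nat.Prime.coprime_iff_not_dvd hp).2 hpm)
      obtain ⟨a, b, hab⟩ := hd
      apply h𝔭.1.ne_top
      rw [Ideal.eq_top_iff_one]
      have h5 : ((a * p + b * m : ℤ) : 𝓞 K) ∈ 𝔭 := by
        push_cast
        exact add_mem (Ideal.mul_mem_left _ _ h𝔭.2.1) (Ideal.mul_mem_left _ _ h4)
      rw [hab] at h5
      simpa using h5
    · obtain ⟨q, hq, hq𝔭⟩ := (h𝔭.1.prod_mem_iff).1 h4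
      have := natPrime_eq_of_mem hp (prime_of_mem_badSet hq) h𝔭.1.ne_top h𝔭.2.1 hq𝔭
      rw [← this, mem_badSet hγ] at hq
      exact hb hq
  have hsq := hs.sq_dvd_of_idealChar_eq_one hodd hχ h𝔭.1 hle
  obtain ⟨f, hf, hN⟩ := exists_absNorm_eq_pow hp h𝔭.1 h𝔭.2.1
  have h5 : 𝔭 ^ 2 ∣ Ideal.span {γ} := hsq.trans (hfac ▸ dvd_mul_right 𝔠 𝔤)
  have h6 := Ideal.absNorm_dvd_absNorm_of_le (Ideal.le_of_dvd h5)
  rw [map_pow, hN, ← pow_mul] at h6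
  exact (pow_dvd_pow p (by omega)).trans h6

/-- Either the norm of `γ` is powerful away from `m₀ * (2 * F)`, or the character sum bound
applies to the fibre of `γ`. -/
lemma powerful_or_fibre_sum_le [IsGalois ℚ K] (ι : K →+* ℝ) {γ : 𝓞 K} (hγ : γ ≠ 0)
    {m₀ F : ℕ} (hm : 0 < m₀) (hF : 0 < F) {Q L₀ X : ℝ} (hX : 0 ≤ X)
    (hQ : (Ideal.absNorm (Ideal.span {γ}) : ℝ) ≤ Q)
    (hsum : ∀ q : ℕ, 0 < q → (q : ℝ) ≤ Q → ∀ χ : DirichletCharacter ℤ q, χ ≠ 1 →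
      ∀ M : ℝ, 0 ≤ M → ∀ N : ℝ, 1 ≤ N → N ≤ L₀ →
      |∑ m ∈ Finset.Ioc ⌊M⌋₊ ⌊M + N⌋₊, ((χ (m : ZMod q) : ℤ) : ℝ)| ≤ X)
    (β : 𝓞 K) (T : Finset ℤ)
    (hT : ∀ a ∈ T, TotPos (β + (a : 𝓞 K)) ∧ OddIdeal (Ideal.span {β + (a : 𝓞 K)}))
    (hdvd : ∀ a ∈ T, (m₀ : ℤ) ∣ a)
    (hconv : ∀ a b c : ℤ, a ∈ T → c ∈ T → a ≤ b → b ≤ c → ((m₀ * F : ℕ) : ℤ) ∣ b - a → b ∈ T)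
    (hlen : ∀ a ∈ T, ∀ c ∈ T, ((c - a : ℤ) : ℝ) + 1 ≤ L₀) :
    (∀ p : ℕ, p.Prime → ¬ p ∣ m₀ * (2 * F) → p ∣ Ideal.absNorm (Ideal.span {γ}) →
      p ^ 2 ∣ Ideal.absNorm (Ideal.span {γ})) ∨
    |∑ a ∈ T, ((quadSym (Ideal.span {β + (a : 𝓞 K)}) γ : ℤ) : ℝ)| ≤ 8 * F * badProd γ * X := by
  have hγ0 : Ideal.span {γ} ≠ 0 := by rwa [Ne, Ideal.zero_eq_bot, Ideal.span_singleton_eq_bot]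
  obtain ⟨𝔠, 𝔤, hfac, hcr, hrg⟩ :=
    exists_coprime_part hγ0 ((m₀ * (2 * F * badProd γ) : ℕ) : 𝓞 K)
  have hd := badProd_pos γ
  have hs : IsSplitIdeal 𝔠 := isSplitIdeal_of_badProd_dvd hγ hfac
    (Dvd.intro_left (m₀ * (2 * F)) (by ring)) hcr
  have heq : m₀ * (2 * F * badProd γ) = m₀ * (2 * F) * badProd γ := by ring
  by_cases hχ : idealChar hs = 1
  · left
    intro p hp hpm hpN
    rw [heq] at hcr hrg
    exact sq_dvd_absNorm_of_idealChar_eq_one hγ hfac (Dvd.intro_left (m₀ * F) (by ring))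
      hcr hrg hs hχ hp hpm hpN
  · right
    have hq : (charMod 𝔠 : ℝ) ≤ Q := by
      refine le_trans ?_ hQ
      have h1 : Ideal.absNorm (Ideal.span {γ}) ≠ 0 := by
        rwa [Ne, Ideal.absNorm_eq_zero_iff]
      have h2 : Ideal.absNorm 𝔠 ∣ Ideal.absNorm (Ideal.span {γ}) := by
        rw [hfac, map_mul]
        exact dvd_mul_right _ _
      exact_mod_cast Nat.le_of_dvd (Nat.pos_of_ne_zero h1) ((charMod_dvd 𝔠).trans h2)
    have hpos : 0 < m₀ * (2 * F * badProd γ) := by positivity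
    have := fibre_sum_le ι hγ hfac hpos (Dvd.intro_left (m₀ * F * badProd γ) (by ring))
      hcr hrg hs hX (hsum _ hs.charMod_pos hq _ hχ) β T hT hdvd
      (fun a b c ha hc hab hbc hd => hconv a b c ha hc hab hbc
        (dvd_trans (by
          norm_cast
          exact Dvd.intro_left (8 * badProd γ) (by ring)) hd)) hlen
    refine this.trans (le_of_eq ?_)
    push_cast
    ring

lemma TotPos.eq_sq_of_associated (hunits : ∀ u : (𝓞 K)ˣ, TotPos (u : 𝓞 K) → ∃ w : (𝓞 K)ˣ, u = w ^ 2)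
    {α β : 𝓞 K} (hα : TotPos α) (hβ : TotPos β)
    (h : Ideal.span {α} = Ideal.span {β}) : ∃ w : (𝓞 K)ˣ, β = (w : 𝓞 K) ^ 2 * α := by
  obtain ⟨u, hu⟩ := Ideal.span_singleton_eq_span_singleton.1 h
  have hpos : TotPos (u : 𝓞 K) := by
    intro v
    have h1 := hβ v
    rw [← hu, co_mul, map_mul] at h1
    exact (mul_pos_iff_of_pos_left (hα v)).1 h1
  obtain ⟨w, rfl⟩ := hunits u hpos
  exact ⟨w, by rw [← hu, Units.val_pow_eq_pow_val, mul_comm]⟩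

lemma spin_span [IsGalois ℚ K]
    (hunits : ∀ u : (𝓞 K)ˣ, TotPos (u : 𝓞 K) → ∃ w : (𝓞 K)ˣ, u = w ^ 2)
    (ι : K →+* ℝ) (σ : K ≃ₐ[ℚ] K) {α : 𝓞 K} (hα : TotPos α) :
    spin σ (Ideal.span {α}) = quadSym (Ideal.span {galInt σ α}) (α - galInt σ α) := by
  have hex : ∃ β : 𝓞 K, Ideal.span {β} = Ideal.span {α} ∧ TotPos β := ⟨α, rfl, hα⟩
  rw [spin, dif_pos hex, galMap_span]
  obtain ⟨w, hw⟩ := hα.eq_sq_of_associated hunits hex.choose_spec.2 hex.choose_spec.1.symm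
  rw [hw, quadSym_sq_mul]
  · apply quadSym_congr
    intro 𝔭 _ hle
    rw [sub_sub_cancel]
    exact hle (Ideal.mem_span_singleton_self _)
  · rw [Ne, Ideal.span_singleton_eq_bot]
    exact (hα.galInt σ).ne_zero ι
  · rw [Ideal.span_singleton_eq_top.2 w.isUnit, ← Ideal.one_eq_top]
    exact isCoprime_one_right

/-- The elements of the fundamental domain generating the ideals that are summed over. -/
def IsAdm [IsGalois ℚ K] (ι : K →+* ℝ) (𝔐 : Ideal (𝓞 K)) (μ : 𝓞 K) (F : ℕ) (𝔪 : Ideal (𝓞 K))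
    (x : ℝ) (α : 𝓞 K) : Prop :=
  InDom ι α ∧ (Ideal.absNorm (Ideal.span {α}) : ℝ) ≤ x ∧
    IsCoprime (Ideal.span {α}) (Ideal.span {(F : 𝓞 K)}) ∧ α ∈ 𝔪 ∧
    ∃ u : (𝓞 K)ˣ, (u : 𝓞 K) ^ 2 * α - μ ∈ 𝔐

lemma exists_isAdm_bound [IsGalois ℚ K] (ι : K →+* ℝ) {n : ℕ} (hn : Module.finrank ℚ K = n) :
    ∃ C : ℝ, 1 ≤ C ∧ ∀ (𝔐 : Ideal (𝓞 K)) (μ : 𝓞 K) (F : ℕ) (𝔪 : Ideal (𝓞 K)) (x : ℝ) (α : 𝓞 K),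
      IsAdm ι 𝔐 μ F 𝔪 x α → ∀ τ : K ≃ₐ[ℚ] K, cnj ι τ α ≤ C * x ^ ((1 : ℝ) / n) := by
  obtain ⟨C, hC, h⟩ := exists_inDom_bound (K := K) ι
  refine ⟨C, hC, fun 𝔐 μ F 𝔪 x α hα τ => (le_abs_self _).trans ((h α hα.1 τ).trans ?_)⟩
  rw [hn]
  have := hα.2.1
  gcongr

lemma finite_isAdm [IsGalois ℚ K] (ι : K →+* ℝ) (𝔐 : Ideal (𝓞 K)) (μ : 𝓞 K) (F : ℕ)
    (𝔪 : Ideal (𝓞 K)) (x : ℝ) : {α : 𝓞 K | IsAdm ι 𝔐 μ F 𝔪 x α}.Finite := by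
  obtain ⟨C, _, h⟩ := exists_isAdm_bound (K := K) ι rfl
  refine (finite_cnj_le ι (C * x ^ ((1 : ℝ) / Module.finrank ℚ K))).subset fun α hα τ => ?_
  rw [abs_of_pos (hα.1.1.cnj_pos ι τ)]
  exact h _ _ _ _ _ _ hα τ

lemma finsum_spin_eq [IsGalois ℚ K]
    (hunits : ∀ u : (𝓞 K)ˣ, TotPos (u : 𝓞 K) → ∃ w : (𝓞 K)ˣ, u = w ^ 2)
    (ι : K →+* ℝ) (σ : K ≃ₐ[ℚ] K) (𝔐 : Ideal (𝓞 K)) (μ : 𝓞 K) (F : ℕ) (𝔪 : Ideal (𝓞 K)) (x : ℝ) :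
    ∑ᶠ 𝔞 : Ideal (𝓞 K), Set.indicator
      {𝔞 : Ideal (𝓞 K) | 𝔞 ≠ ⊥ ∧ (Ideal.absNorm 𝔞 : ℝ) ≤ x ∧
        IsCoprime 𝔞 (Ideal.span {(F : 𝓞 K)}) ∧ 𝔪 ∣ 𝔞 ∧ rCond 𝔐 μ 𝔞}
      (fun 𝔞 => ((spin σ 𝔞 : ℤ) : ℝ)) 𝔞 =
    ∑ α ∈ (finite_isAdm ι 𝔐 μ F 𝔪 x).toFinset,
      ((quadSym (Ideal.span {galInt σ α}) (α - galInt σ α) : ℤ) : ℝ) := by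
  rw [← finsum_mem_eq_finite_toFinset_sum, ← finsum_mem_def]
  symm
  apply finsum_mem_eq_of_bijOn (fun α => Ideal.span {α})
  · refine ⟨?_, ?_, ?_⟩
    · intro α hα
      obtain ⟨hD, hx, hF, hm, u, hu⟩ := hα
      refine ⟨?_, hx, hF, Ideal.dvd_span_singleton.2 hm, (u : 𝓞 K) ^ 2 * α, ?_,
        hD.1.unit_sq_mul u, hu⟩
      · rw [Ne, Ideal.span_singleton_eq_bot]
        exact hD.1.ne_zero ι
      · rw [Ideal.span_singleton_mul_left_unit (u.isUnit.pow 2)]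
    · intro α hα β hβ hαβ
      obtain ⟨w, rfl⟩ := hα.1.1.eq_sq_of_associated hunits hβ.1.1 hαβ
      exact (hα.1.eq_of_unit_sq_mul ι hβ.1).symm
    · rintro 𝔞 ⟨_, hx, hF, hm, α, rfl, hpos, hu⟩
      obtain ⟨u, hD⟩ := hpos.exists_inDom ι
      have hsp : Ideal.span {(u : 𝓞 K) ^ 2 * α} = Ideal.span {α} :=
        Ideal.span_singleton_mul_left_unit (u.isUnit.pow 2) α
      refine ⟨(u : 𝓞 K) ^ 2 * α, ⟨hD, ?_, ?_, ?_, u⁻¹, ?_⟩, hsp⟩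
      · rwa [hsp]
      · rwa [hsp]
      · exact Ideal.mul_mem_left _ _ (Ideal.dvd_span_singleton.1 hm)
      · rwa [← mul_assoc, ← mul_pow, Units.inv_mul, one_pow, one_mul]
  · intro α hα
    rw [spin_span hunits ι σ hα.1.1]

lemma exists_intCast_of_galInt_eq [IsGalois ℚ K] {σ : K ≃ₐ[ℚ] K}
    (hσ : ∀ τ : K ≃ₐ[ℚ] K, τ ∈ Subgroup.zpowers σ) {α : 𝓞 K} (h : galInt σ α = α) :
    ∃ a : ℤ, α = a := by
  have hfix : ∀ τ : K ≃ₐ[ℚ] K, τ (α : K) = α := by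
    intro τ
    have hle : Subgroup.zpowers σ ≤ MulAction.stabilizer (K ≃ₐ[ℚ] K) (α : K) := by
      rw [Subgroup.zpowers_le, MulAction.mem_stabilizer_iff]
      exact congrArg (fun β : 𝓞 K => (β : K)) h
    exact MulAction.mem_stabilizer_iff.1 (hle (hσ τ))
  obtain ⟨q, hq⟩ := IntermediateField.mem_bot.1 ((IsGalois.mem_bot_iff_fixed (α : K)).2 hfix)
  have hint : IsIntegral ℤ q := by
    have h1 : IsIntegral ℤ (α : K) := RingOfIntegers.isIntegral_coe α
    rw [← hq] at h1
    exact (isIntegral_algebraMap_iff (algebraMap ℚ K).injective).1 h1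
  obtain ⟨a, ha⟩ := IsIntegrallyClosed.isIntegral_iff.1 hint
  refine ⟨a, RingOfIntegers.ext ?_⟩
  rw [← hq, ← ha]
  simp

lemma exists_nat_mem_iff_dvd {𝔪 : Ideal (𝓞 K)} (h : 𝔪 ≠ ⊥) :
    ∃ m : ℕ, 0 < m ∧ m ≤ Ideal.absNorm 𝔪 ∧ ∀ a : ℤ, (a : 𝓞 K) ∈ 𝔪 ↔ (m : ℤ) ∣ a := by
  obtain ⟨g, hg⟩ := (IsPrincipalIdealRing.principal (𝔪.comap (Int.castRingHom (𝓞 K)))).principal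
  have hmem : ∀ a : ℤ, (a : 𝓞 K) ∈ 𝔪 ↔ (g.natAbs : ℤ) ∣ a := by
    intro a
    rw [Int.natAbs_dvd, ← Ideal.mem_span_singleton, ← Ideal.submodule_span_eq, ← hg,
        Ideal.mem_comap]
    rfl
  have hN0 : 0 < Ideal.absNorm 𝔪 := Nat.pos_of_ne_zero (by rwa [Ne, Ideal.absNorm_eq_zero_iff])
  have hdvd : g.natAbs ∣ Ideal.absNorm 𝔪 := by
    have := (hmem (Ideal.absNorm 𝔪)).1 (by exact_mod_cast Ideal.absNorm_mem 𝔪)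
    exact_mod_cast this
  exact ⟨_, Nat.pos_of_dvd_of_pos hdvd hN0, Nat.le_of_dvd hN0 hdvd, hmem⟩

lemma injective_add_intCast (α : 𝓞 K) : Function.Injective fun a : ℤ => α + (a : 𝓞 K) :=
  fun _ _ h => Int.cast_injective (add_left_cancel h)

/-- The integers by which `α` may be translated within the domain of summation. -/
def translates [IsGalois ℚ K] (ι : K →+* ℝ) (𝔐 : Ideal (𝓞 K)) (μ : 𝓞 K) (F : ℕ)
    (𝔪 : Ideal (𝓞 K)) (x : ℝ) (α : 𝓞 K) : Finset ℤ :=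
  (finite_isAdm ι 𝔐 μ F 𝔪 x).toFinset.preimage (fun a : ℤ => α + (a : 𝓞 K))
    (injective_add_intCast α).injOn

section

variable [IsGalois ℚ K] {ι : K →+* ℝ} {𝔐 : Ideal (𝓞 K)} {μ : 𝓞 K} {F : ℕ} {𝔪 : Ideal (𝓞 K)} {x : ℝ}
  {α : 𝓞 K}

lemma mem_translates {a : ℤ} :
    a ∈ translates ι 𝔐 μ F 𝔪 x α ↔ IsAdm ι 𝔐 μ F 𝔪 x (α + (a : 𝓞 K)) := by
  rw [translates, Finset.mem_preimage, Set.Finite.mem_toFinset]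
  rfl

lemma sum_fibre_eq {σ : K ≃ₐ[ℚ] K} (hσ : ∀ τ : K ≃ₐ[ℚ] K, τ ∈ Subgroup.zpowers σ) :
    ∑ β ∈ (finite_isAdm ι 𝔐 μ F 𝔪 x).toFinset with β - galInt σ β = α - galInt σ α,
      ((quadSym (Ideal.span {galInt σ β}) (β - galInt σ β) : ℤ) : ℝ) =
    ∑ a ∈ translates ι 𝔐 μ F 𝔪 x α,
      ((quadSym (Ideal.span {galInt σ α + (a : 𝓞 K)}) (α - galInt σ α) : ℤ) : ℝ) := by
  symm
  have hsub : ∀ a : ℤ, α + (a : 𝓞 K) - galInt σ (α + (a : 𝓞 K)) = α - galInt σ α := by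
    intro a
    rw [map_add, map_intCast]
    ring
  refine Finset.sum_bij (fun a _ => α + (a : 𝓞 K)) ?_ ?_ ?_ ?_
  · intro a ha
    rw [Finset.mem_filter, Set.Finite.mem_toFinset]
    exact ⟨mem_translates.1 ha, hsub a⟩
  · exact fun a _ b _ h => injective_add_intCast α h
  · intro β hβ
    rw [Finset.mem_filter, Set.Finite.mem_toFinset] at hβ
    obtain ⟨a, ha⟩ := exists_intCast_of_galInt_eq hσ (α := β - α) (by
      rw [map_sub]
      linear_combination -hβ.2)
    have hβa : α + (a : 𝓞 K) = β := by rw [← ha]; ring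
    refine ⟨a, mem_translates.2 ?_, hβa⟩
    rw [hβa]
    exact hβ.1
  · intro a _
    rw [hsub, map_add, map_intCast]

lemma translates_diff_le {B : ℝ} (hB : ∀ β : 𝓞 K, IsAdm ι 𝔐 μ F 𝔪 x β → cnj ι 1 β ≤ B) {a c : ℤ}
    (ha : a ∈ translates ι 𝔐 μ F 𝔪 x α) (hc : c ∈ translates ι 𝔐 μ F 𝔪 x α) :
    ((c - a : ℤ) : ℝ) ≤ B := by
  have h1 := hB _ (mem_translates.1 hc)
  have h2 := (mem_translates.1 ha).1.1.cnj_pos ι 1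
  rw [cnj_add, cnj_intCast] at h1 h2
  push_cast
  linarith

lemma card_translates_le {B : ℝ} (hB0 : 0 ≤ B)
    (hB : ∀ β : 𝓞 K, IsAdm ι 𝔐 μ F 𝔪 x β → cnj ι 1 β ≤ B) :
    ((translates ι 𝔐 μ F 𝔪 x α).card : ℝ) ≤ B + 1 := by
  set T := translates ι 𝔐 μ F 𝔪 x α with hT
  rcases T.eq_empty_or_nonempty with h | hne
  · rw [h, Finset.card_empty, Nat.cast_zero]
    linarith
  have h1 := translates_diff_le hB (T.min'_mem hne) (T.max'_mem hne)
  have h2 : T.card ≤ (Finset.Icc (T.min' hne) (T.max' hne)).card :=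
    Finset.card_le_card fun a ha => Finset.mem_Icc.2 ⟨T.min'_le _ ha, T.le_max' _ ha⟩
  rw [Int.card_Icc] at h2
  have h3 := T.min'_le _ (T.max'_mem hne)
  have h4 : (T.card : ℤ) ≤ T.max' hne - T.min' hne + 1 := by omega
  have h5 : (T.card : ℝ) ≤ ((T.max' hne - T.min' hne : ℤ) : ℝ) + 1 := by exact_mod_cast h4
  linarith

lemma translates_convex {m : ℕ} (hm : ∀ a : ℤ, (a : 𝓞 K) ∈ 𝔪 ↔ (m : ℤ) ∣ a)
    (hF𝔐 : 𝔐 ∣ Ideal.span {(F : 𝓞 K)}) (a b c : ℤ)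
    (ha : a ∈ translates ι 𝔐 μ F 𝔪 x α) (hc : c ∈ translates ι 𝔐 μ F 𝔪 x α)
    (hab : a ≤ b) (hbc : b ≤ c) (hd : ((m * F : ℕ) : ℤ) ∣ b - a) :
    b ∈ translates ι 𝔐 μ F 𝔪 x α := by
  rw [mem_translates] at ha hc ⊢
  have hD : InDom ι (α + (b : 𝓞 K)) := InDom.convex ι hab hbc ha.1 hc.1
  have hba : α + (b : 𝓞 K) = α + (a : 𝓞 K) + ((b - a : ℤ) : 𝓞 K) := by push_cast; ring
  have hFd : (F : 𝓞 K) ∣ ((b - a : ℤ) : 𝓞 K) := by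
    have h1 : (F : ℤ) ∣ b - a := dvd_trans (by push_cast; exact dvd_mul_left _ _) hd
    simpa using map_dvd (Int.castRingHom (𝓞 K)) h1
  refine ⟨hD, ?_, ?_, ?_, ?_⟩
  · refine le_trans ?_ hc.2.1
    have h1 := hD.1.absNorm_le_add ι (a := c - b) (by omega)
    have hcb : α + (c : 𝓞 K) = α + (b : 𝓞 K) + ((c - b : ℤ) : 𝓞 K) := by push_cast; ring
    rw [hcb]
    exact_mod_cast h1
  · apply Ideal.coprime_of_no_prime_ge
    intro P h1 h2 hP
    have h3 : (F : 𝓞 K) ∈ P := h2 (Ideal.mem_span_singleton_self _)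
    refine not_mem_of_coprime ha.2.2.1 ?_ hP.ne_top h3
    rw [Ideal.span_singleton_le_iff_mem] at h1 ⊢
    have h4 := sub_mem h1 (Ideal.mem_of_dvd _ hFd h3)
    rwa [hba, add_sub_cancel_right] at h4
  · rw [hba]
    refine add_mem ha.2.2.2.1 ((hm _).2 (dvd_trans ?_ hd))
    push_cast
    exact dvd_mul_right _ _
  · obtain ⟨u, hu⟩ := ha.2.2.2.2
    refine ⟨u, ?_⟩
    have h1 : (u : 𝓞 K) ^ 2 * (α + (b : 𝓞 K)) - μ =
        ((u : 𝓞 K) ^ 2 * (α + (a : 𝓞 K)) - μ) + (u : 𝓞 K) ^ 2 * ((b - a : ℤ) : 𝓞 K) := by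
      rw [hba]; ring
    rw [h1]
    exact add_mem hu (Ideal.mul_mem_left _ _ (Ideal.mem_of_dvd _ hFd (Ideal.dvd_span_singleton.1 hF𝔐)))

end

lemma oddIdeal_galInt {α : 𝓞 K} (σ : K ≃ₐ[ℚ] K) {F : ℕ} (h2 : 2 ∣ F)
    (h : IsCoprime (Ideal.span {α}) (Ideal.span {(F : 𝓞 K)})) :
    OddIdeal (Ideal.span {galInt σ α}) := by
  obtain ⟨k, rfl⟩ := h2
  rw [Nat.cast_mul, ← Ideal.span_singleton_mul_span_singleton] at h
  have h3 := (Ideal.isCoprime_span_singleton_iff _ _).1 h.of_mul_right_left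
  have h4 := h3.map (galInt σ)
  rw [OddIdeal, Ideal.isCoprime_span_singleton_iff]
  rw [map_natCast] at h4
  exact_mod_cast h4

lemma abs_quadSym_le (𝔟 : Ideal (𝓞 K)) (α : 𝓞 K) : |((quadSym 𝔟 α : ℤ) : ℝ)| ≤ 1 := by
  rcases quadSym_trichotomy 𝔟 α with h | h | h <;> simp [h]

section

variable [IsGalois ℚ K] {ι : K →+* ℝ} {𝔐 : Ideal (𝓞 K)} {μ : 𝓞 K} {F : ℕ} {𝔪 : Ideal (𝓞 K)} {x : ℝ}
  {α : 𝓞 K} {σ : K ≃ₐ[ℚ] K}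

lemma abs_sum_fibre_le (hσ : ∀ τ : K ≃ₐ[ℚ] K, τ ∈ Subgroup.zpowers σ) {B : ℝ} (hB0 : 0 ≤ B)
    (hB : ∀ β : 𝓞 K, IsAdm ι 𝔐 μ F 𝔪 x β → cnj ι 1 β ≤ B) (α : 𝓞 K) :
    |∑ β ∈ (finite_isAdm ι 𝔐 μ F 𝔪 x).toFinset with β - galInt σ β = α - galInt σ α,
      ((quadSym (Ideal.span {galInt σ β}) (β - galInt σ β) : ℤ) : ℝ)| ≤ B + 1 := by
  rw [sum_fibre_eq hσ]
  refine (Finset.abs_sum_le_sum_abs _ _).trans ?_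
  refine (Finset.sum_le_card_nsmul _ _ 1 fun a _ => abs_quadSym_le _ _).trans ?_
  rw [nsmul_eq_mul, mul_one]
  exact card_translates_le hB0 hB

lemma powerful_or_abs_sum_fibre_le (hσ : ∀ τ : K ≃ₐ[ℚ] K, τ ∈ Subgroup.zpowers σ) {B : ℝ}
    (hB : ∀ β : 𝓞 K, IsAdm ι 𝔐 μ F 𝔪 x β → cnj ι 1 β ≤ B)
    (hF : 0 < F) (h2F : 2 ∣ F) (hF𝔐 : 𝔐 ∣ Ideal.span {(F : 𝓞 K)})
    {m : ℕ} (hm0 : 0 < m) (hm : ∀ a : ℤ, (a : 𝓞 K) ∈ 𝔪 ↔ (m : ℤ) ∣ a)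
    {Q X : ℝ} (hX : 0 ≤ X)
    (hsum : ∀ q : ℕ, 0 < q → (q : ℝ) ≤ Q → ∀ χ : DirichletCharacter ℤ q, χ ≠ 1 →
      ∀ M : ℝ, 0 ≤ M → ∀ N : ℝ, 1 ≤ N → N ≤ B + 1 →
      |∑ m ∈ Finset.Ioc ⌊M⌋₊ ⌊M + N⌋₊, ((χ (m : ZMod q) : ℤ) : ℝ)| ≤ X)
    (hα : IsAdm ι 𝔐 μ F 𝔪 x α) (hne : α - galInt σ α ≠ 0)
    (hQ : (Ideal.absNorm (Ideal.span {α - galInt σ α}) : ℝ) ≤ Q) :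
    (∀ p : ℕ, p.Prime → ¬ p ∣ m * (2 * F) → p ∣ Ideal.absNorm (Ideal.span {α - galInt σ α}) →
      p ^ 2 ∣ Ideal.absNorm (Ideal.span {α - galInt σ α})) ∨
    |∑ β ∈ (finite_isAdm ι 𝔐 μ F 𝔪 x).toFinset with β - galInt σ β = α - galInt σ α,
      ((quadSym (Ideal.span {galInt σ β}) (β - galInt σ β) : ℤ) : ℝ)| ≤
        8 * F * badProd (α - galInt σ α) * X := by
  rw [sum_fibre_eq hσ]
  refine powerful_or_fibre_sum_le ι hne hm0 hF hX hQ hsum _ _ ?_ ?_ ?_ ?_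
  · intro a ha
    rw [mem_translates] at ha
    have h1 : galInt σ α + (a : 𝓞 K) = galInt σ (α + (a : 𝓞 K)) := by rw [map_add, map_intCast]
    rw [h1]
    exact ⟨ha.1.1.galInt σ, oddIdeal_galInt σ h2F ha.2.2.1⟩
  · intro a ha
    rw [mem_translates] at ha
    rw [← hm]
    have := sub_mem ha.2.2.2.1 hα.2.2.2.1
    rwa [add_sub_cancel_left] at this
  · exact translates_convex hm hF𝔐
  · intro a ha c hc
    have := translates_diff_le hB ha hc
    linarith

end

lemma sum_galInt_sub_eq_zero [IsGalois ℚ K] (σ : K ≃ₐ[ℚ] K) (α : 𝓞 K) :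
    ∑ τ : K ≃ₐ[ℚ] K, galInt τ (α - galInt σ α) = 0 := by
  have h : ∀ τ : K ≃ₐ[ℚ] K, galInt τ (galInt σ α) = galInt (τ * σ) α := fun τ => rfl
  simp only [map_sub, h, Finset.sum_sub_distrib]
  rw [Fintype.sum_equiv (Equiv.mulRight σ) (fun τ => galInt (τ * σ) α) (fun τ => galInt τ α)
    fun τ => rfl, sub_self]

lemma exists_total_le_rpow {n : ℕ} (hn : 3 ≤ n) {δ ε : ℝ} (hδ1 : δ < 1) (hε : 0 < ε)
    {c D E E' G H : ℝ} (hc : 0 ≤ c) (hD : 0 ≤ D) (hE : 0 ≤ E) (hE' : 0 ≤ E') (hG : 0 ≤ G)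
    (hH : 0 ≤ H) :
    ∃ C : ℝ, 0 < C ∧ ∀ x : ℝ, 2 ≤ x → ∀ m : ℝ, 0 ≤ m → m ≤ H * x →
      c * x ^ ((1 : ℝ) / n) +
        E * (m ^ (ε / 2) * ((c * x ^ ((1 : ℝ) / n)) ^ ((n : ℝ) / 2) *
          (c * x ^ ((1 : ℝ) / n)) ^ (ε / 2))) * (c * x ^ ((1 : ℝ) / n)) +
        √(G * (D * (c ^ n * x) ^ ((1 - δ) / n + ε / 2)) * (c * x ^ ((1 : ℝ) / n))) *
          (E' * ((c * x ^ ((1 : ℝ) / n)) ^ (n - 1) * (c * x ^ ((1 : ℝ) / n)) ^ (ε / 2))) ≤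
      C * x ^ (1 - δ / (2 * n) + ε) := by
  have hn0 : (3 : ℝ) ≤ n := by exact_mod_cast hn
  have hn1 : (1 : ℝ) / n ≤ 1 / 3 := one_div_le_one_div_of_le (by norm_num) hn0
  have hni : (0 : ℝ) ≤ 1 / n := by positivity
  set w : ℝ := (1 : ℝ) / n with hw
  have hnw : (n : ℝ) * w = 1 := by rw [hw]; field_simp
  set e : ℝ := 1 - δ / (2 * n) + ε with he
  have he' : e = 1 - δ * w / 2 + ε := by rw [he, hw]; ring
  have hδ : (1 - δ) / n = (1 - δ) * w := by rw [hw]; ring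
  have hδw : δ * w ≤ w := by nlinarith
  set K₁ := c
  set K₂ := E * (H ^ (ε / 2) * (c ^ ((n : ℝ) / 2) * c ^ (ε / 2))) * c with hK₂
  set K₃ := √(G * (D * (c ^ n) ^ ((1 - δ) / n + ε / 2)) * c) *
    (E' * (c ^ (n - 1) * c ^ (ε / 2))) with hK₃
  have hK₂0 : 0 ≤ K₂ := by positivity
  have hK₃0 : 0 ≤ K₃ := by positivity
  refine ⟨c + K₂ + K₃ + 1, by positivity, fun x hx m hm0 hm => ?_⟩
  have hx0 : 0 < x := by linarith
  have hx1 : 1 ≤ x := by linarith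
  have hpow : ∀ a : ℝ, (c * x ^ w) ^ a = c ^ a * x ^ (w * a) := by
    intro a
    rw [Real.mul_rpow hc (by positivity), ← Real.rpow_mul hx0.le]
  have hmono : ∀ a : ℝ, a ≤ e → x ^ a ≤ x ^ e := fun a ha => Real.rpow_le_rpow_of_exponent_le hx1 ha
  have hwε : w * ε ≤ ε / 3 := by nlinarith
  have h1 : c * x ^ w ≤ c * x ^ e := by
    gcongr
    rw [he']; nlinarith
  have h2 : E * (m ^ (ε / 2) * ((c * x ^ w) ^ ((n : ℝ) / 2) * (c * x ^ w) ^ (ε / 2))) *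
      (c * x ^ w) ≤ K₂ * x ^ e := by
    calc _ ≤ E * ((H * x) ^ (ε / 2) * ((c * x ^ w) ^ ((n : ℝ) / 2) * (c * x ^ w) ^ (ε / 2))) *
          (c * x ^ w) := by gcongr
      _ = K₂ * (x ^ (ε / 2) * x ^ (w * ((n : ℝ) / 2)) * x ^ (w * (ε / 2)) * x ^ w) := by
          rw [hpow, hpow, Real.mul_rpow hH hx0.le, hK₂]
          ring
      _ = K₂ * x ^ (ε / 2 + w * ((n : ℝ) / 2) + w * (ε / 2) + w) := by
          rw [Real.rpow_add hx0, Real.rpow_add hx0, Real.rpow_add hx0]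
      _ ≤ K₂ * x ^ e := by
          gcongr
          rw [he']; nlinarith
  have h3 : √(G * (D * (c ^ n * x) ^ ((1 - δ) / n + ε / 2)) * (c * x ^ w)) *
      (E' * ((c * x ^ w) ^ (n - 1) * (c * x ^ w) ^ (ε / 2))) ≤ K₃ * x ^ e := by
    have hsq : √(x ^ ((1 - δ) / n + ε / 2) * x ^ w) = x ^ (((1 - δ) / n + ε / 2 + w) / 2) := by
      rw [← Real.rpow_add hx0, Real.sqrt_eq_rpow, ← Real.rpow_mul hx0.le]
      congr 1
      ring
    have hcast : ((n - 1 : ℕ) : ℝ) = n - 1 := by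
      rw [Nat.cast_sub (by omega), Nat.cast_one]
    have hpown : (c * x ^ w) ^ (n - 1) = c ^ (n - 1) * x ^ (w * ((n : ℝ) - 1)) := by
      rw [← Real.rpow_natCast, hpow, hcast, ← hcast, Real.rpow_natCast]
    calc _ = K₃ * (x ^ (((1 - δ) / n + ε / 2 + w) / 2) * x ^ (w * ((n : ℝ) - 1)) *
            x ^ (w * (ε / 2))) := by
          rw [hpown, hpow, Real.mul_rpow (by positivity) hx0.le]
          rw [show G * (D * ((c ^ n) ^ ((1 - δ) / n + ε / 2) * x ^ ((1 - δ) / n + ε / 2))) *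
              (c * x ^ w) = (G * (D * (c ^ n) ^ ((1 - δ) / n + ε / 2)) * c) *
                (x ^ ((1 - δ) / n + ε / 2) * x ^ w) by ring,
            Real.sqrt_mul (by positivity), hsq, hK₃]
          ring
      _ = K₃ * x ^ (((1 - δ) / n + ε / 2 + w) / 2 + w * ((n : ℝ) - 1) + w * (ε / 2)) := by
          rw [Real.rpow_add hx0, Real.rpow_add hx0]
      _ ≤ K₃ * x ^ e := by
          gcongr
          rw [he', hδ]; nlinarith
  have h4 : 0 ≤ x ^ e := by positivity
  calc _ ≤ c * x ^ e + K₂ * x ^ e + K₃ * x ^ e := add_le_add (add_le_add h1 h2) h3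
    _ ≤ (c + K₂ + K₃ + 1) * x ^ e := by nlinarith

lemma sum_abs_fibres_le {ι' : Type*} (Γ : Finset ι') (V w : ι' → ℝ) (P Z : ι' → Prop) {A Y N S : ℝ}
    (z₀ : ι') (hZ : ∀ γ, Z γ ↔ γ = z₀) (hA : 0 ≤ A) (hY : 0 ≤ Y) (hw : ∀ γ, 0 ≤ w γ)
    (hV : ∀ γ ∈ Γ, |V γ| ≤ A) (hV' : ∀ γ ∈ Γ, ¬ Z γ → P γ ∨ |V γ| ≤ Y * w γ ^ 2)
    (hN : ((Γ.filter fun γ => ¬ Z γ ∧ P γ).card : ℝ) ≤ N)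
    (hS : ∑ γ ∈ Γ with ¬ Z γ, w γ ≤ S) :
    |∑ γ ∈ Γ, V γ| ≤ A + N * A + √(Y * A) * S := by
  have hpt : ∀ γ ∈ Γ, |V γ| ≤ (if γ = z₀ then A else 0) + (if ¬ Z γ ∧ P γ then A else 0) +
      √(Y * A) * (if ¬ Z γ then w γ else 0) := by
    intro γ hγ
    by_cases hz : Z γ
    · simp only [if_pos ((hZ γ).1 hz), hz, not_true_eq_false, false_and, if_false, mul_zero,
        add_zero]
      exact hV γ hγ
    · have hz' : γ ≠ z₀ := fun h => hz ((hZ γ).2 h)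
      by_cases hp : P γ
      · have := mul_nonneg (Real.sqrt_nonneg (Y * A)) (hw γ)
        simpa [hz, hp, hz'] using (hV γ hγ).trans (le_add_of_nonneg_right this)
      · have h1 := (hV' γ hγ hz).resolve_left hp
        have h2 : |V γ| ≤ √(Y * A) * w γ := by
          rw [← Real.sqrt_sq (hw γ), ← Real.sqrt_mul (by positivity)]
          apply Real.le_sqrt_of_sq_le
          calc |V γ| ^ 2 = |V γ| * |V γ| := sq _
            _ ≤ (Y * w γ ^ 2) * A := by
              have := hV γ hγ
              gcongr
            _ = Y * A * w γ ^ 2 := by ring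
        simpa [hz, hp, hz'] using h2
  refine (Finset.abs_sum_le_sum_abs _ _).trans ((Finset.sum_le_sum hpt).trans ?_)
  rw [Finset.sum_add_distrib, Finset.sum_add_distrib, ← Finset.mul_sum, ← Finset.sum_filter,
    ← Finset.sum_filter, ← Finset.sum_filter, Finset.sum_const, Finset.sum_const, nsmul_eq_mul,
    nsmul_eq_mul]
  have hcard : ((Γ.filter fun γ => γ = z₀).card : ℝ) ≤ 1 := by
    have : (Γ.filter fun γ => γ = z₀).card ≤ 1 :=
      Finset.card_le_one.2 fun a ha b hb =>
        (Finset.mem_filter.1 ha).2.trans (Finset.mem_filter.1 hb).2.symm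
    exact_mod_cast this
  have h3 : ((Γ.filter fun γ => γ = z₀).card : ℝ) * A ≤ A := by nlinarith
  gcongr

theorem exists_sum_adm_le [IsGalois ℚ K] {n : ℕ} (hn : 3 ≤ n) (hdeg : Module.finrank ℚ K = n)
    (ι : K →+* ℝ) {σ : K ≃ₐ[ℚ] K} (hσ : ∀ τ : K ≃ₐ[ℚ] K, τ ∈ Subgroup.zpowers σ)
    {𝔐 : Ideal (𝓞 K)} (μ : 𝓞 K) {F : ℕ} (hF : 0 < F) (h2F : 2 ∣ F)
    (hF𝔐 : 𝔐 ∣ Ideal.span {(F : 𝓞 K)}) {δ : ℝ} (hδ1 : δ < 1) (hconj : ConjectureC n δ)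
    {ε : ℝ} (hε : 0 < ε) :
    ∃ C : ℝ, 0 < C ∧ ∀ (𝔪 : Ideal (𝓞 K)) (x : ℝ), 2 ≤ x →
      |∑ α ∈ (finite_isAdm ι 𝔐 μ F 𝔪 x).toFinset,
        ((quadSym (Ideal.span {galInt σ α}) (α - galInt σ α) : ℤ) : ℝ)| ≤
        C * x ^ (1 - δ / (2 * n) + ε) := by
  obtain ⟨C₀, hC₀, hbox⟩ := exists_isAdm_bound ι hdeg
  obtain ⟨D, hD, hDX⟩ := hconj (ε / 2) (by positivity)
  obtain ⟨E, hE, hpow⟩ := exists_card_powerful_norm_le ι (by omega) hdeg (half_pos hε)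
  obtain ⟨E', hE', hsqrt⟩ := exists_sum_sqrt_badProd_le ι hn hdeg (half_pos hε)
  set c := C₀ + 1 with hc
  obtain ⟨C, hC, hfinal⟩ := exists_total_le_rpow hn hδ1 hε (c := c) (D := D) (E := E) (E' := E')
    (G := 8 * F) (H := 2 * F) (by positivity) hD.le (by linarith) (by linarith) (by positivity)
    (by positivity)
  refine ⟨C, hC, fun 𝔪 x hx => ?_⟩
  have hx0 : 0 < x := by linarith
  set S := (finite_isAdm ι 𝔐 μ F 𝔪 x).toFinset with hS
  have hmemS : ∀ α, α ∈ S ↔ IsAdm ι 𝔐 μ F 𝔪 x α := fun α => by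
    rw [hS, Set.Finite.mem_toFinset]; rfl
  rcases S.eq_empty_or_nonempty with h | ⟨α₀, hα₀⟩
  · rw [h, Finset.sum_empty, abs_zero]
    positivity
  rw [hmemS] at hα₀
  have hα₀0 : α₀ ≠ 0 := hα₀.1.1.ne_zero ι
  have h𝔪 : 𝔪 ≠ ⊥ := by
    rintro rfl
    exact hα₀0 hα₀.2.2.2.1
  obtain ⟨m, hm0, hmN, hm⟩ := exists_nat_mem_iff_dvd h𝔪
  have hmx : (m : ℝ) ≤ x := by
    refine le_trans ?_ hα₀.2.1
    exact_mod_cast hmN.trans (Nat.le_of_dvd (one_le_absNorm_span hα₀0)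
      (absNorm_dvd_of_mem hα₀.2.2.2.1))
  set R := x ^ ((1 : ℝ) / n) with hR
  have hR1 : 1 ≤ R := Real.one_le_rpow (by linarith) (by positivity)
  have hRn : R ^ n = x := by
    rw [hR, one_div, Real.rpow_inv_natCast_pow hx0.le (by omega)]
  set B := c * R with hB
  have hc2 : 2 ≤ c := by linarith
  have hB1 : 1 ≤ B := by nlinarith
  have hC₀R : C₀ * R + 1 ≤ B := by rw [hB, hc]; nlinarith
  have hQ : (c ^ n * x) ^ ((1 : ℝ) / n) = B := by
    rw [← hRn, ← mul_pow, one_div, Real.pow_rpow_inv_natCast (by positivity) (by omega)]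
  have hQ3 : 3 ≤ c ^ n * x := by
    have : (1 : ℝ) ≤ c ^ (n - 1) := one_le_pow₀ (by linarith)
    have h1 : c ^ n = c ^ (n - 1) * c := by rw [← pow_succ]; congr 1; omega
    have h2 : 2 ≤ c ^ n := by rw [h1]; nlinarith
    nlinarith
  set X := D * (c ^ n * x) ^ ((1 - δ) / n + ε / 2) with hX
  have hX0 : 0 ≤ X := by positivity
  have hγB : ∀ α, IsAdm ι 𝔐 μ F 𝔪 x α → ∀ τ : K ≃ₐ[ℚ] K, |cnj ι τ (α - galInt σ α)| ≤ B := by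
    intro α hα τ
    rw [cnj_sub, cnj_galInt, abs_le]
    have h1 := hbox _ _ _ _ _ _ hα τ
    have h2 := hbox _ _ _ _ _ _ hα (τ * σ)
    have h3 := hα.1.1.cnj_pos ι τ
    have h4 := hα.1.1.cnj_pos ι (τ * σ)
    constructor <;> linarith
  set g : 𝓞 K → 𝓞 K := fun α => α - galInt σ α with hg
  have hΓ : ∀ γ ∈ S.image g, ∃ α, IsAdm ι 𝔐 μ F 𝔪 x α ∧ g α = γ := by
    intro γ hγ
    obtain ⟨α, hα, rfl⟩ := Finset.mem_image.1 hγ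
    exact ⟨α, (hmemS α).1 hα, rfl⟩
  rw [← Finset.sum_fiberwise_of_maps_to (t := S.image g) (g := g)
    fun α hα => Finset.mem_image_of_mem g hα]
  refine (sum_abs_fibres_le (S.image g) _ (fun γ => √(badProd γ : ℝ))
    (fun γ => ∀ p : ℕ, p.Prime → ¬ p ∣ m * (2 * F) → p ∣ Ideal.absNorm (Ideal.span {γ}) →
      p ^ 2 ∣ Ideal.absNorm (Ideal.span {γ})) (fun γ => γ = 0) (A := B) (Y := 8 * F * X)
    (N := E * (((m * (2 * F) : ℕ) : ℝ) ^ (ε / 2) * (B ^ ((n : ℝ) / 2) * B ^ (ε / 2))))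
    (S := E' * (B ^ (n - 1) * B ^ (ε / 2))) 0 (fun γ => Iff.rfl) (by linarith) (by positivity)
    (fun γ => Real.sqrt_nonneg _) ?_ ?_ ?_ ?_).trans ?_
  · intro γ hγ
    obtain ⟨α, hα, rfl⟩ := hΓ γ hγ
    exact (abs_sum_fibre_le hσ (by positivity) (fun β hβ => hbox _ _ _ _ _ _ hβ 1) α).trans hC₀R
  · intro γ hγ hne
    obtain ⟨α, hα, rfl⟩ := hΓ γ hγ
    refine (powerful_or_abs_sum_fibre_le hσ (fun β hβ => hbox _ _ _ _ _ _ hβ 1) hF h2F hF𝔐 hm0 hm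
      hX0 (Q := c ^ n * x) ?_ hα hne ?_).imp id fun h => h.trans (le_of_eq ?_)
    · intro q hq hqQ χ hχ M hM N hN hNL
      exact hDX _ hQ3 M hM N hN (by rw [hQ]; linarith) q hq hqQ χ hχ
    · refine (absNorm_le_pow ι hdeg (hγB α hα)).trans (le_of_eq ?_)
      rw [hB, mul_pow, hRn]
    · rw [Real.sq_sqrt (Nat.cast_nonneg _)]
      ring
  · apply hpow B hB1 _ (by positivity)
    intro γ hγ
    rw [Finset.mem_filter] at hγ
    obtain ⟨α, hα, rfl⟩ := hΓ γ hγ.1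
    exact ⟨hγ.2.1, hγB α hα, hγ.2.2⟩
  · apply hsqrt B hB1
    intro γ hγ
    rw [Finset.mem_filter] at hγ
    obtain ⟨α, hα, rfl⟩ := hΓ γ hγ.1
    exact ⟨hγ.2, sum_galInt_sub_eq_zero σ α, hγB α hα⟩
  · refine hfinal x hx ((m * (2 * F) : ℕ) : ℝ) (Nat.cast_nonneg _) ?_
    push_cast
    nlinarith [(Nat.cast_nonneg F : (0 : ℝ) ≤ F)]

lemma exists_real_embedding (htotreal : ∀ φ : K →+* ℂ, ComplexEmbedding.IsReal φ) :
    Nonempty (K →+* ℝ) := by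
  obtain ⟨φ⟩ : Nonempty (K →+* ℂ) := inferInstance
  exact ⟨(htotreal φ).embedding⟩

/-- **Proposition 5.1** (Friedlander–Iwaniec–Mazur–Rubin, "The spin of prime ideals").
In the standing setting (`K/ℚ` totally real cyclic of degree `n ≥ 3`, totally positive
units are squares, `σ` a generator of the Galois group), fix a collection `𝒞ℓ` of odd
integral ideals consisting of exactly two representatives of each ideal class, with
`f = N(∏_{ℭ ∈ 𝒞ℓ} ℭ)` squarefree; fix `𝔐 ∣ (F)`, `μ` coprime to `𝔐`, and a positive
integer `F` divisible by `2^{2h+3} f` (`h` the class number).  Assume Conjecture `C_n`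
with exponent `δ`.  Then for every `ε > 0` there is a constant `C` (independent of `𝔪`)
such that for every ideal `𝔪` coprime to `σ(𝔪)` and to `F`, and every `x ≥ 2`,
`|A(x)| = |∑_{N𝔞 ≤ x, (𝔞,F)=1, 𝔪 ∣ 𝔞} r(𝔞) spin(σ,𝔞)| ≤ C x^{1-δ/(2n)+ε}`. -/
theorem spins_of_prime_ideals_stmt5
    (n : ℕ) (hn : 3 ≤ n)
    (K : Type*) [Field K] [NumberField K] [IsGalois ℚ K]
    (hdeg : Module.finrank ℚ K = n)
    (htotreal : ∀ φ : K →+* ℂ, ComplexEmbedding.IsReal φ)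
    (hcyc : IsCyclic (K ≃ₐ[ℚ] K))
    (hunits : ∀ u : (𝓞 K)ˣ, TotPos (u : 𝓞 K) → ∃ w : (𝓞 K)ˣ, u = w ^ 2)
    (σ : K ≃ₐ[ℚ] K) (hσ : ∀ τ : K ≃ₐ[ℚ] K, τ ∈ Subgroup.zpowers σ)
    (𝒞ℓ : Finset (Ideal (𝓞 K)))
    (h𝒞ℓodd : ∀ ℭ ∈ 𝒞ℓ, OddIdeal ℭ)
    (h𝒞ℓtwo : ∀ c : ClassGroup (𝓞 K),
      (𝒞ℓ.filter (fun 𝔄 => 𝔄 ≠ 0 ∧ idealClass 𝔄 = c)).card = 2)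
    (hf : Squarefree (Ideal.absNorm (∏ ℭ ∈ 𝒞ℓ, ℭ)))
    (𝔐 : Ideal (𝓞 K)) (h𝔐2 : Ideal.span {(2 : 𝓞 K)} ∣ 𝔐)
    (μ : 𝓞 K) (hμ : IsCoprime (Ideal.span {μ}) 𝔐)
    (F : ℕ) (hF0 : 0 < F)
    (hF𝔐 : 𝔐 ∣ Ideal.span {(F : 𝓞 K)})
    (hFf : 2 ^ (2 * NumberField.classNumber K + 3) * Ideal.absNorm (∏ ℭ ∈ 𝒞ℓ, ℭ) ∣ F)
    (δ : ℝ) (hδ0 : 0 < δ) (hδ1 : δ < 1) (hconj : ConjectureC n δ)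
    (ε : ℝ) (hε : 0 < ε) :
    ∃ C : ℝ, 0 < C ∧
      ∀ 𝔪 : Ideal (𝓞 K),
        IsCoprime 𝔪 (galMap σ 𝔪) → IsCoprime 𝔪 (Ideal.span {(F : 𝓞 K)}) →
        ∀ x : ℝ, 2 ≤ x →
          |∑ᶠ 𝔞 : Ideal (𝓞 K), Set.indicator
              {𝔞 : Ideal (𝓞 K) | 𝔞 ≠ ⊥ ∧ (Ideal.absNorm 𝔞 : ℝ) ≤ x ∧
                IsCoprime 𝔞 (Ideal.span {(F : 𝓞 K)}) ∧ 𝔪 ∣ 𝔞 ∧ rCond 𝔐 μ 𝔞}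
              (fun 𝔞 => ((spin σ 𝔞 : ℤ) : ℝ)) 𝔞|
            ≤ C * x ^ (1 - δ / (2 * n) + ε) := by
  obtain ⟨ι⟩ := exists_real_embedding htotreal
  have h2F : 2 ∣ F := (Dvd.dvd.mul_right (dvd_pow_self 2 (by omega)) _).trans hFf
  obtain ⟨C, hC, h⟩ := exists_sum_adm_le hn hdeg ι hσ (𝔐 := 𝔐) μ hF0 h2F hF𝔐 hδ1 hconj hε
  refine ⟨C, hC, fun 𝔪 _ _ x hx => ?_⟩
  rw [finsum_spin_eq hunits ι σ]
  exact h 𝔪 x hx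

end
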